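/- There exists an absolute constant C ≥ 1 such that the following holds. Let G be a graph on n vertices such that (i) |N(U)| ≥ C|U| for every set U ⊆ V(G) with |U| < n/(2C), and (ii) there is an edge of G between any two disjoint sets U, W ⊆ V(G) with |U|, |W| ≥ n/(2C). Then G is Hamilton-connected, i.e., for any two distinct vertices x, y ∈ V(G) there exists a Hamilton path in G with endpoints x and y. -/

import Mathlib

/-- A graph is Hamilton-connected if any two distinct vertices are the endpoints
of some Hamilton path. -/
def HamiltonConnected {α : Type*} [DecidableEq α] (G : SimpleGraph α) : Prop :=
  ∀ u v : α, u ≠ v → ∃ w : G.Walk u v, w.IsHamiltonian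

/-- The (external) neighbourhood of a vertex set `U`: all vertices adjacent to at
least one vertex of `U`. -/
def nbhdSet {α : Type*} (G : SimpleGraph α) (U : Finset α) : Set α :=
  {w | ∃ u ∈ U, G.Adj u w}

set_option linter.unusedSectionVars false

namespace HE
noncomputable section
open scoped Classical
open Finset

variable {V : Type*} [Fintype V]

def nb (G : SimpleGraph V) (U W : Finset V) : Finset V := W.filter fun w => ∃ u ∈ U, G.Adj u w

def ch (T : Finset V) (par : V → V) (v : V) : Finset V := T.filter fun y => par y = v

def cr (T : Finset V) (par : V → V) (U : Finset V) : Finset V := T.filter fun y => par y ∈ U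

def Ext (G : SimpleGraph V) (W : Finset V) (K M : ℕ) (T : Finset V) (par : V → V) : Prop :=
  (∀ U : Finset V, U.card ≤ M → K * U.card ≤ (nb G U W \ T).card + (cr T par U).card) ∧
    T ⊆ W ∧ ∀ y ∈ T, G.Adj (par y) y

theorem mem_nb {G : SimpleGraph V} {U W : Finset V} {w : V} :
    w ∈ nb G U W ↔ w ∈ W ∧ ∃ u ∈ U, G.Adj u w := by simp [nb]

theorem nb_mono {G : SimpleGraph V} {U U' W : Finset V} (h : U ⊆ U') : nb G U W ⊆ nb G U' W := by
  intro w; simp only [mem_nb]; rintro ⟨h1, u, hu, h2⟩; exact ⟨h1, u, h hu, h2⟩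

theorem ext_sub {G : SimpleGraph V} {W : Finset V} {K M : ℕ} {T T' : Finset V} {par : V → V}
    (h : Ext G W K M T par) (hT : T' ⊆ T) : Ext G W K M T' par := by
  refine ⟨?_, hT.trans h.2.1, fun y hy => h.2.2 y (hT hy)⟩
  intro U hU
  have h1 := h.1 U hU
  have h2 : (cr T par U).card ≤ (cr T' par U).card + ((cr T par U) \ T').card := by
    have : cr T par U ⊆ cr T' par U ∪ (cr T par U) \ T' := by
      intro y; simp only [cr, mem_union, mem_filter, mem_sdiff]; tauto
    exact (card_le_card this).trans (card_union_le _ _)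
  have h3 : (nb G U W \ T).card + ((cr T par U) \ T').card ≤ (nb G U W \ T').card := by
    rw [← card_union_of_disjoint]
    · apply card_le_card
      intro y
      simp only [mem_union, mem_sdiff, cr, mem_filter, mem_nb]
      rintro (⟨⟨h1, h2⟩, h3⟩ | ⟨⟨h1, h2⟩, h3⟩)
      · exact ⟨⟨h1, h2⟩, fun h => h3 (hT h)⟩
      · exact ⟨⟨h.2.1 h1, _, h2, h.2.2 y h1⟩, h3⟩
    · rw [Finset.disjoint_left]
      intro y
      simp only [mem_sdiff, cr, mem_filter]
      tauto
  omega

theorem nb_sdiff_submod (G : SimpleGraph V) (A B W T : Finset V) :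
    (nb G (A ∪ B) W \ T).card + (nb G (A ∩ B) W \ T).card ≤
      (nb G A W \ T).card + (nb G B W \ T).card := by
  have h1 : nb G (A ∪ B) W \ T = (nb G A W \ T) ∪ (nb G B W \ T) := by
    ext y; simp only [mem_sdiff, mem_union, mem_nb]
    constructor
    · rintro ⟨⟨h1, u, hu | hu, h2⟩, h3⟩
      · exact Or.inl ⟨⟨h1, u, hu, h2⟩, h3⟩
      · exact Or.inr ⟨⟨h1, u, hu, h2⟩, h3⟩
    · rintro (⟨⟨h1, u, hu, h2⟩, h3⟩ | ⟨⟨h1, u, hu, h2⟩, h3⟩)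
      · exact ⟨⟨h1, u, Or.inl hu, h2⟩, h3⟩
      · exact ⟨⟨h1, u, Or.inr hu, h2⟩, h3⟩
  have h2 : nb G (A ∩ B) W \ T ⊆ (nb G A W \ T) ∩ (nb G B W \ T) := by
    intro y; simp only [mem_sdiff, mem_inter, mem_nb]
    rintro ⟨⟨h1, u, hu, h2⟩, h3⟩
    exact ⟨⟨⟨h1, u, hu.1, h2⟩, h3⟩, ⟨⟨h1, u, hu.2, h2⟩, h3⟩⟩
  have h3 := card_union_add_card_inter (nb G A W \ T) (nb G B W \ T)
  have h4 := card_le_card h2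
  rw [h1]; omega

theorem cr_mod (A B T : Finset V) (par : V → V) :
    (cr T par (A ∪ B)).card + (cr T par (A ∩ B)).card = (cr T par A).card + (cr T par B).card := by
  have h1 : cr T par (A ∪ B) = cr T par A ∪ cr T par B := by
    ext y; simp only [cr, mem_union, mem_filter]; tauto
  have h2 : cr T par (A ∩ B) = cr T par A ∩ cr T par B := by
    ext y; simp only [cr, mem_inter, mem_filter]; tauto
  rw [h1, h2, card_union_add_card_inter]

theorem ext_add {G : SimpleGraph V} {W : Finset V} {K m : ℕ} {T : Finset V} {par : V → V}
    (hm : 1 ≤ m) (h : Ext G W K (2 * m) T par)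
    (hs : ∀ U : Finset V, m < U.card → U.card ≤ 2 * m → K * U.card + T.card < (nb G U W).card)
    (v : V) (hv : (ch T par v).card < K) :
    ∃ y ∈ W, y ∉ T ∧ G.Adj v y ∧ Ext G W K (2 * m) (insert y T) (Function.update par y v) := by
  by_contra hcon
  push Not at hcon
  let tight : Finset V → Prop := fun U =>
    U.card ≤ m ∧ v ∉ U ∧ (nb G U W \ T).card + (cr T par U).card = K * U.card
  have small : ∀ U : Finset V, U.card ≤ 2 * m →
      (nb G U W \ T).card + (cr T par U).card = K * U.card → U.card ≤ m := by
    intro U hU hU2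
    by_contra hlt
    have := hs U (by omega) hU
    have h2 : (nb G U W).card ≤ (nb G U W \ T).card + T.card := by
      have := card_le_card (show nb G U W ⊆ (nb G U W \ T) ∪ T by
        intro y; simp only [mem_union, mem_sdiff]; tauto)
      exact this.trans (card_union_le _ _)
    omega
  have key : ∀ y ∈ W, y ∉ T → G.Adj v y → ∃ U, tight U ∧ y ∈ nb G U W := by
    intro y hy hyT hvy
    have hne := hcon y hy hyT hvy
    have : ∃ U : Finset V, U.card ≤ 2 * m ∧ ¬ (K * U.card ≤ (nb G U W \ insert y T).card +
        (cr (insert y T) (Function.update par y v) U).card) := by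
      by_contra hc
      push Not at hc
      apply hne
      refine ⟨hc, ?_, ?_⟩
      · intro z hz; rw [mem_insert] at hz; rcases hz with rfl | hz
        · exact hy
        · exact h.2.1 hz
      · intro z hz; rw [mem_insert] at hz; rcases hz with rfl | hz
        · simpa using hvy
        · rw [Function.update_of_ne (by rintro rfl; exact hyT hz)]; exact h.2.2 z hz
    obtain ⟨U, hU, hU2⟩ := this
    have h1 := h.1 U hU
    have hA : cr T par U ⊆ cr (insert y T) (Function.update par y v) U := by
      intro z; simp only [cr, mem_filter, mem_insert]
      rintro ⟨hz, hz2⟩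
      refine ⟨Or.inr hz, ?_⟩
      rw [Function.update_of_ne (by rintro rfl; exact hyT hz)]; exact hz2
    have hB : (nb G U W \ T).card ≤ (nb G U W \ insert y T).card + 1 := by
      have := card_le_card (show nb G U W \ T ⊆ insert y (nb G U W \ insert y T) by
        intro z; simp only [mem_insert, mem_sdiff]; tauto)
      exact this.trans (card_insert_le _ _)
    have hyU : y ∈ nb G U W := by
      by_contra hyU
      have : nb G U W \ T ⊆ nb G U W \ insert y T := by
        intro z; simp only [mem_insert, mem_sdiff]
        rintro ⟨h1, h2⟩
        exact ⟨h1, by rintro (rfl | h3); exacts [hyU h1, h2 h3]⟩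
      have := card_le_card this
      have := card_le_card hA
      omega
    have hvU : v ∉ U := by
      intro hvU
      have : insert y (cr T par U) ⊆ cr (insert y T) (Function.update par y v) U := by
        intro z; rw [mem_insert]; rintro (rfl | hz)
        · simp [cr, hvU]
        · exact hA hz
      have := card_le_card this
      rw [card_insert_of_notMem (by simp [cr, hyT])] at this
      omega
    have := card_le_card hA
    exact ⟨U, ⟨small U hU (by omega), hvU, by omega⟩, hyU⟩
  have tun : ∀ A B, tight A → tight B → tight (A ∪ B) := by
    rintro A B ⟨hA, hvA, hA2⟩ ⟨hB, hvB, hB2⟩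
    have c1 : (A ∪ B).card ≤ 2 * m := (card_union_le _ _).trans (by omega)
    have c2 : (A ∩ B).card ≤ 2 * m := (card_le_card inter_subset_left).trans (by omega)
    have e1 := h.1 _ c1
    have e2 := h.1 _ c2
    have e3 := nb_sdiff_submod G A B W T
    have e4 := cr_mod A B T par
    have e5 := card_union_add_card_inter A B
    have e6 : K * (A ∪ B).card + K * (A ∩ B).card = K * A.card + K * B.card := by
      rw [← Nat.mul_add, ← Nat.mul_add, e5]
    have e7 : (nb G (A ∪ B) W \ T).card + (cr T par (A ∪ B)).card = K * (A ∪ B).card := by omega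
    exact ⟨small _ c1 e7, by simp [hvA, hvB], e7⟩
  have big : ∀ S : Finset V, (∀ y ∈ S, y ∈ W ∧ y ∉ T ∧ G.Adj v y) →
      ∃ U, tight U ∧ S ⊆ nb G U W := by
    intro S
    induction S using Finset.induction_on with
    | empty =>
      intro _
      refine ⟨∅, ⟨by simp, by simp, ?_⟩, by simp⟩
      have : nb G ∅ W = ∅ := by ext; simp [nb]
      simp [this, cr]
    | insert y S _ ih =>
      intro hS
      obtain ⟨U, hU, hSU⟩ := ih (fun z hz => hS z (mem_insert_of_mem hz))
      obtain ⟨h1, h2, h3⟩ := hS y (mem_insert_self _ _)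
      obtain ⟨U', hU', hy⟩ := key y h1 h2 h3
      refine ⟨U ∪ U', tun _ _ hU hU', ?_⟩
      intro z hz; rw [mem_insert] at hz; rcases hz with rfl | hz
      · exact nb_mono subset_union_right hy
      · exact nb_mono subset_union_left (hSU hz)
  obtain ⟨U, ⟨hU1, hvU, hU2⟩, hU3⟩ := big (W.filter fun y => y ∉ T ∧ G.Adj v y)
    (by intro y hy; simpa using hy)
  have e1 := h.1 (insert v U) (by rw [card_insert_of_notMem hvU]; omega)
  rw [card_insert_of_notMem hvU] at e1
  have e2 : nb G (insert v U) W \ T ⊆ nb G U W \ T := by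
    intro z; simp only [mem_sdiff, mem_nb, mem_insert]
    rintro ⟨⟨hz, u, rfl | hu, h2⟩, h3⟩
    · exact ⟨mem_nb.1 (hU3 (by simp [hz, h3, h2])), h3⟩
    · exact ⟨⟨hz, u, hu, h2⟩, h3⟩
  have e3 : cr T par (insert v U) ⊆ cr T par U ∪ ch T par v := by
    intro z; simp only [cr, ch, mem_filter, mem_union, mem_insert]; tauto
  have e4 := card_le_card e2
  have e5 := (card_le_card e3).trans (card_union_le _ _)
  rw [Nat.mul_add] at e1
  omega

theorem ch_eq {T T' : Finset V} {par par' : V → V} {U : Finset V} (hT : T ⊆ T')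
    (hp : ∀ y ∈ T, par' y = par y) (hn : ∀ y ∈ T' \ T, par' y ∈ U) {v : V} (hv : v ∉ U) :
    ch T' par' v = ch T par v := by
  ext y; simp only [ch, mem_filter]
  constructor
  · rintro ⟨h1, h2⟩
    by_cases hy : y ∈ T
    · exact ⟨hy, by rw [← hp y hy, h2]⟩
    · exact absurd (h2 ▸ hn y (by simp [h1, hy])) hv
  · rintro ⟨h1, h2⟩
    exact ⟨hT h1, by rw [hp y h1, h2]⟩

theorem fill_one {G : SimpleGraph V} {W : Finset V} {K m Tm : ℕ} (hm : 1 ≤ m)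
    (hs : ∀ U : Finset V, m < U.card → U.card ≤ 2 * m → K * U.card + Tm < (nb G U W).card)
    (u : V) (k : ℕ) : ∀ {T : Finset V} {par : V → V}, Ext G W K (2 * m) T par →
    (ch T par u).card + k ≤ K → T.card + k ≤ Tm + 1 →
    ∃ T' par', T ⊆ T' ∧ (∀ y ∈ T, par' y = par y) ∧ Ext G W K (2 * m) T' par' ∧
      (∀ y ∈ T' \ T, par' y = u) ∧ (ch T' par' u).card = (ch T par u).card + k ∧
      T'.card = T.card + k := by
  induction k with
  | zero =>
    intro T par h _ _
    exact ⟨T, par, Subset.refl _, fun _ _ => rfl, h, by simp, rfl, rfl⟩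
  | succ k ih =>
    intro T par h hc hT
    obtain ⟨T1, p1, h1, h2, h3, h4, h5, h6⟩ := ih h (by omega) (by omega)
    obtain ⟨y, hy, hyT, hadj, hE⟩ := ext_add hm h3
      (fun U a b => lt_of_le_of_lt (by omega) (hs U a b)) u (by omega)
    refine ⟨insert y T1, Function.update p1 y u, h1.trans (subset_insert _ _), ?_, hE, ?_, ?_, ?_⟩
    · intro z hz
      rw [Function.update_of_ne (by rintro rfl; exact hyT (h1 hz)), h2 z hz]
    · intro z hz
      simp only [mem_sdiff, mem_insert] at hz
      by_cases hzy : z = y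
      · subst hzy; simp
      · rw [Function.update_of_ne hzy]
        exact h4 z (by simp; tauto)
    · have : ch (insert y T1) (Function.update p1 y u) u = insert y (ch T1 p1 u) := by
        ext z
        simp only [ch, mem_filter, mem_insert]
        by_cases hzy : z = y
        · subst hzy; simp
        · simp [hzy, Function.update_of_ne hzy]
      rw [this, card_insert_of_notMem (by simp [ch, hyT])]
      omega
    · rw [card_insert_of_notMem hyT]; omega

theorem fill {G : SimpleGraph V} {W : Finset V} {K m Tm : ℕ} (hm : 1 ≤ m)
    (hs : ∀ U : Finset V, m < U.card → U.card ≤ 2 * m → K * U.card + Tm < (nb G U W).card)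
    (k : ℕ) (U : Finset V) {T : Finset V} {par : V → V} (h : Ext G W K (2 * m) T par)
    (hc : ∀ u ∈ U, (ch T par u).card + k ≤ K) (hT : T.card + k * U.card ≤ Tm + 1) :
    ∃ T' par', T ⊆ T' ∧ (∀ y ∈ T, par' y = par y) ∧ Ext G W K (2 * m) T' par' ∧
      (∀ y ∈ T' \ T, par' y ∈ U) ∧ (∀ u ∈ U, (ch T' par' u).card = (ch T par u).card + k) ∧
      T'.card = T.card + k * U.card := by
  induction U using Finset.induction_on with
  | empty =>
    exact ⟨T, par, Subset.refl _, fun _ _ => rfl, h, by simp, by simp, by simp⟩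
  | insert u U hu ih =>
    rw [card_insert_of_notMem hu, Nat.mul_add] at hT
    obtain ⟨T1, p1, h1, h2, h3, h4, h5, h6⟩ :=
      ih (fun x hx => hc x (mem_insert_of_mem hx)) (by omega)
    have hcu : ch T1 p1 u = ch T par u := ch_eq h1 h2 h4 hu
    obtain ⟨T2, p2, g1, g2, g3, g4, g5, g6⟩ := fill_one hm hs u k h3
      (by rw [hcu]; exact hc u (mem_insert_self _ _)) (by omega)
    refine ⟨T2, p2, h1.trans g1, ?_, g3, ?_, ?_, ?_⟩
    · intro y hy; rw [g2 y (h1 hy), h2 y hy]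
    · intro y hy
      simp only [mem_sdiff] at hy
      by_cases hy1 : y ∈ T1
      · rw [g2 y hy1]; exact mem_insert_of_mem (h4 y (by simp [hy1, hy.2]))
      · rw [g4 y (by simp [hy1, hy.1])]; exact mem_insert_self _ _
    · intro x hx
      rw [mem_insert] at hx
      rcases hx with rfl | hx
      · rw [g5, hcu]
      · have : ch T2 p2 x = ch T1 p1 x :=
          ch_eq (U := {u}) g1 g2 (fun y hy => by simpa using g4 y hy)
            (by simp; rintro rfl; exact hu hx)
        rw [this, h5 x hx]
    · rw [card_insert_of_notMem hu, Nat.mul_add]; omega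

end
end HE

namespace HE
noncomputable section
open scoped Classical
open Finset

variable {V : Type*} [Fintype V]

/-- joinedness -/
def Joined (G : SimpleGraph V) (m : ℕ) : Prop :=
  ∀ U W : Finset V, Disjoint U W → m ≤ U.card → m ≤ W.card → ∃ u ∈ U, ∃ w ∈ W, G.Adj u w

theorem joined_nb {G : SimpleGraph V} {m : ℕ} (hJ : Joined G m) (U W : Finset V) (hU : m ≤ U.card) :
    W.card < (nb G U W).card + U.card + m := by
  by_contra hlt
  push Not at hlt
  have h1 : W.card ≤ (nb G U W).card + U.card + (W \ (nb G U W ∪ U)).card := by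
    have := card_le_card (show W ⊆ (nb G U W ∪ U) ∪ (W \ (nb G U W ∪ U)) by
      intro y; simp only [mem_union, mem_sdiff]; tauto)
    have h2 := this.trans (card_union_le _ _)
    have h3 := card_union_le (nb G U W) U
    omega
  obtain ⟨u, hu, w, hw, h⟩ := hJ U (W \ (nb G U W ∪ U))
    (by rw [Finset.disjoint_left]; intro y; simp only [mem_sdiff, mem_union]; tauto) hU (by omega)
  simp only [mem_sdiff, mem_union, not_or] at hw
  exact hw.2.1 (mem_nb.2 ⟨hw.1, u, hu, h⟩)

theorem label_exists (S : Finset V) (h : S.card = 360) :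
    ∃ l : V → Fin 6, ∀ i, (S.filter fun y => l y = i).card = 60 := by
  let e := S.equivFinOfCardEq h
  refine ⟨fun y => if hy : y ∈ S then ⟨(e ⟨y, hy⟩).1 % 6, Nat.mod_lt _ (by norm_num)⟩ else 0, ?_⟩
  intro i
  have h1 : (univ.filter fun k : Fin 360 => k.1 % 6 = i.1).card = 60 := by
    revert i; decide
  rw [← h1]
  refine Finset.card_bij (fun y hy => e ⟨y, (mem_filter.1 hy).1⟩) ?_ ?_ ?_
  · intro y hy
    have hy2 := hy
    rw [mem_filter] at hy
    rw [mem_filter]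
    refine ⟨mem_univ _, ?_⟩
    have := hy.2
    simp only [dif_pos hy.1] at this
    exact congrArg Fin.val this
  · intro a ha b hb hab
    have := e.injective hab
    simpa using this
  · intro k hk
    rw [mem_filter] at hk
    refine ⟨(e.symm k).1, ?_, ?_⟩
    · rw [mem_filter]
      refine ⟨(e.symm k).2, ?_⟩
      simp only [dif_pos (e.symm k).2]
      apply Fin.ext
      simpa using hk.2
    · simp

theorem classes (V : Type*) [Fintype V] : ∃ a : V → Fin 6, ∀ i, Fintype.card V / 6 ≤ (univ.filter fun y => a y = i).card := by
  let e := Fintype.equivFin V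
  refine ⟨fun y => ⟨(e y).1 % 6, Nat.mod_lt _ (by norm_num)⟩, fun i => ?_⟩
  rw [← Finset.card_range (Fintype.card V / 6)]
  refine Finset.card_le_card_of_surjOn (fun y => (e y).1 / 6) ?_
  intro j hj
  have hj : j < Fintype.card V / 6 := by simpa using hj
  have hi := i.2
  refine ⟨e.symm ⟨6 * j + i.1, by omega⟩, ?_, ?_⟩
  · simp only [coe_filter, mem_univ, true_and, Set.mem_ofPred_eq, Equiv.apply_symm_apply]
    apply Fin.ext
    simp only
    omega
  · simp only [Equiv.apply_symm_apply]; omega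

theorem card_le_sdiff (A T : Finset V) : A.card ≤ (A \ T).card + T.card := by
  have := card_le_card (show A ⊆ (A \ T) ∪ T by
    intro y; simp only [mem_union, mem_sdiff]; tauto)
  exact this.trans (card_union_le _ _)

theorem nb_union (G : SimpleGraph V) (A B W : Finset V) : nb G (A ∪ B) W = nb G A W ∪ nb G B W := by
  ext y; simp only [mem_union, mem_nb]
  constructor
  · rintro ⟨h1, u, hu | hu, h2⟩
    · exact Or.inl ⟨h1, u, hu, h2⟩
    · exact Or.inr ⟨h1, u, hu, h2⟩
  · rintro (⟨h1, u, hu, h2⟩ | ⟨h1, u, hu, h2⟩)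
    · exact ⟨h1, u, Or.inl hu, h2⟩
    · exact ⟨h1, u, Or.inr hu, h2⟩

structure PS (G : SimpleGraph V) (m : ℕ) (A : Fin 6 → Finset V) (D : Fin 6 → Finset V)
    (T : Finset V) (par : V → V) : Prop where
  ext : Ext G univ 360 (2 * m) T par
  prn : ∀ y ∈ T, par y ∈ univ.biUnion D
  chc : ∀ d ∈ univ.biUnion D, (ch T par d).card = 360
  Tc : T.card = 360 * (univ.biUnion D).card
  small : ∀ i, (D i).card < m
  bad : ∀ i, (nb G (D i) (A i) \ T).card ≤ 60 * (D i).card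

theorem ps_card {G : SimpleGraph V} {m : ℕ} {A D : Fin 6 → Finset V} {T : Finset V} {par : V → V}
    (h : PS G m A D T par) : (univ.biUnion D).card ≤ 6 * m := by
  refine card_biUnion_le.trans ?_
  refine (Finset.sum_le_card_nsmul _ _ m (fun i _ => (h.small i).le)).trans ?_
  simp

theorem ps_step {G : SimpleGraph V} {m : ℕ} (hm : 1 ≤ m) (hJ : Joined G m)
    (hn : 100000 * m ≤ Fintype.card V) {A D : Fin 6 → Finset V} {T : Finset V} {par : V → V}
    (hA : ∀ i, Fintype.card V / 6 ≤ (A i).card)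
    (h : PS G m A D T par) (i : Fin 6) (U : Finset V) (hU : U.card < m)
    (hUD : Disjoint U (univ.biUnion D)) (hb : (nb G U (A i) \ T).card < 60 * U.card) :
    ∃ D' T' par', PS G m A D' T' par' ∧ (univ.biUnion D).card < (univ.biUnion D').card := by
  have hs : ∀ U : Finset V, m < U.card → U.card ≤ 2 * m →
      360 * U.card + 4320 * m < (nb G U univ).card := by
    intro U h1 h2
    have := joined_nb hJ U univ h1.le
    rw [card_univ] at this
    omega
  have hD := ps_card h
  have hch : ∀ u ∈ U, ch T par u = ∅ := by
    intro u hu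
    rw [Finset.eq_empty_iff_forall_notMem]
    intro y hy
    simp only [ch, mem_filter] at hy
    have := h.prn y hy.1
    rw [hy.2] at this
    exact Finset.disjoint_left.1 hUD hu this
  have hTc := h.Tc
  obtain ⟨T', par', h1, h2, h3, h4, h5, h6⟩ := fill hm hs 360 U h.ext
    (by intro u hu; rw [hch u hu]; simp) (by omega)
  have hbU : univ.biUnion (Function.update D i (D i ∪ U)) = univ.biUnion D ∪ U := by
    ext y
    simp only [mem_biUnion, mem_univ, true_and, mem_union]
    constructor
    · rintro ⟨j, hj⟩
      by_cases hji : j = i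
      · subst hji
        simp only [Function.update_self, mem_union] at hj
        rcases hj with hj | hj
        · exact Or.inl ⟨_, hj⟩
        · exact Or.inr hj
      · rw [Function.update_of_ne hji] at hj; exact Or.inl ⟨_, hj⟩
    · rintro (⟨j, hj⟩ | hj)
      · by_cases hji : j = i
        · subst hji; exact ⟨j, by simp [hj]⟩
        · exact ⟨j, by rw [Function.update_of_ne hji]; exact hj⟩
      · exact ⟨i, by simp [hj]⟩
  have hcu : (univ.biUnion D ∪ U).card = (univ.biUnion D).card + U.card :=
    card_union_of_disjoint hUD.symm
  have hdi : (D i ∪ U).card = (D i).card + U.card := by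
    apply card_union_of_disjoint
    exact (hUD.mono_right (subset_biUnion_of_mem D (mem_univ i))).symm
  have hnbi : (nb G (D i ∪ U) (A i) \ T').card ≤ 60 * (D i ∪ U).card := by
    have e1 : nb G (D i ∪ U) (A i) \ T' ⊆ (nb G (D i) (A i) \ T) ∪ (nb G U (A i) \ T) := by
      rw [nb_union]
      intro y; simp only [mem_sdiff, mem_union]
      rintro ⟨h | h, h'⟩
      · exact Or.inl ⟨h, fun h'' => h' (h1 h'')⟩
      · exact Or.inr ⟨h, fun h'' => h' (h1 h'')⟩
    have e2 := (card_le_card e1).trans (card_union_le _ _)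
    have := h.bad i
    rw [hdi]; omega
  refine ⟨Function.update D i (D i ∪ U), T', par', ⟨h3, ?_, ?_, ?_, ?_, ?_⟩, ?_⟩
  · rw [hbU]
    intro y hy
    by_cases hyT : y ∈ T
    · rw [h2 y hyT]; exact mem_union_left _ (h.prn y hyT)
    · exact mem_union_right _ (h4 y (by simp [hy, hyT]))
  · rw [hbU]
    intro d hd
    rw [mem_union] at hd
    rcases hd with hd | hd
    · rw [ch_eq h1 h2 h4 (Finset.disjoint_right.1 hUD hd)]
      exact h.chc d hd
    · rw [h5 d hd, hch d hd]; simp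
  · rw [hbU, hcu, h6]; omega
  · intro j
    by_cases hji : j = i
    · subst hji
      rw [Function.update_self]
      by_contra hlt
      push Not at hlt
      have e1 := joined_nb hJ (D j ∪ U) (A j) hlt
      have e2 := h.small j
      have e3 := card_le_sdiff (nb G (D j ∪ U) (A j)) T'
      have e4 := hA j
      omega
    · rw [Function.update_of_ne hji]; exact h.small j
  · intro j
    by_cases hji : j = i
    · subst hji
      rw [Function.update_self]; exact hnbi
    · rw [Function.update_of_ne hji]
      exact (card_le_card (sdiff_subset_sdiff (Subset.refl _) h1)).trans (h.bad j)
  · rw [hbU, hcu]; omega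

theorem partition {G : SimpleGraph V} {m : ℕ} (hm : 1 ≤ m) (hJ : Joined G m)
    (hn : 100000 * m ≤ Fintype.card V)
    (hX : ∀ U : Finset V, U.card < m → 360 * U.card ≤ (nb G U univ).card) :
    ∃ p : V → Fin 6, ∀ i, Fintype.card V ≤ 7 * (univ.filter fun y => p y = i).card ∧
      ∀ U : Finset V, U.card < m → 30 * U.card ≤ (nb G U (univ.filter fun y => p y = i)).card := by
  obtain ⟨a, ha⟩ := classes V
  set A : Fin 6 → Finset V := fun i => univ.filter fun y => a y = i with hAdef
  have h0 : PS G m A (fun _ => ∅) ∅ id := by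
    refine ⟨⟨?_, by simp, by simp⟩, by simp, by simp, by simp [Finset.eq_empty_iff_forall_notMem], by simp; omega, ?_⟩
    · intro U hU
      simp only [sdiff_empty]
      by_cases h : U.card < m
      · have := hX U h; omega
      · have := joined_nb hJ U univ (by omega)
        rw [card_univ] at this
        omega
    · intro i
      have : nb G ∅ (A i) = ∅ := by ext; simp [nb]
      simp [this]
  have hmax : ∃ D T par, PS G m A D T par ∧ ∀ i, ∀ U : Finset V, U.card < m →
      Disjoint U (univ.biUnion D) → 60 * U.card ≤ (nb G U (A i) \ T).card := by
    by_contra hcon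
    push Not at hcon
    have : ∀ k : ℕ, ∃ D T par, PS G m A D T par ∧ k ≤ (univ.biUnion D).card := by
      intro k
      induction k with
      | zero => exact ⟨_, _, _, h0, by simp⟩
      | succ k ih =>
        obtain ⟨D, T, par, h, hk⟩ := ih
        obtain ⟨i, U, hU, hUD, hb⟩ := hcon D T par h
        obtain ⟨D', T', par', h', hlt⟩ := ps_step hm hJ hn ha h i U hU hUD hb
        exact ⟨D', T', par', h', by omega⟩
    obtain ⟨D, T, par, h, hk⟩ := this (6 * m + 1)
    have := ps_card h
    omega
  obtain ⟨D, T, par, h, hgood⟩ := hmax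
  have hlab : ∀ d : V, ∃ l : V → Fin 6, d ∈ univ.biUnion D →
      ∀ i, ((ch T par d).filter fun y => l y = i).card = 60 := by
    intro d
    by_cases hd : d ∈ univ.biUnion D
    · obtain ⟨l, hl⟩ := label_exists _ (h.chc d hd)
      exact ⟨l, fun _ => hl⟩
    · exact ⟨fun _ => 0, fun h => absurd h hd⟩
  choose l hl using hlab
  refine ⟨fun y => if y ∈ T then l (par y) y else a y, fun i => ⟨?_, ?_⟩⟩
  · have e1 : (A i \ T) ⊆ univ.filter fun y => (if y ∈ T then l (par y) y else a y) = i := by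
      intro y
      simp only [hAdef, mem_sdiff, mem_filter, mem_univ, true_and]
      rintro ⟨h1, h2⟩
      rw [if_neg h2, h1]
    have e2 := card_le_card e1
    have e3 := card_le_sdiff (A i) T
    have e4 := h.Tc
    have e5 := ps_card h
    have e6 : Fintype.card V / 6 ≤ (A i).card := ha i
    show Fintype.card V ≤ 7 * (univ.filter fun y => (if y ∈ T then l (par y) y else a y) = i).card
    omega
  · intro U hU
    set W := univ.filter fun y => (if y ∈ T then l (par y) y else a y) = i with hW
    have hsplit : U.card = (U ∩ univ.biUnion D).card + (U \ univ.biUnion D).card := by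
      rw [add_comm]; exact (card_sdiff_add_card_inter _ _).symm
    have e1 : 60 * (U \ univ.biUnion D).card ≤ (nb G U W).card := by
      refine (hgood i (U \ univ.biUnion D) ?_ sdiff_disjoint).trans ?_
      · exact (card_le_card sdiff_subset).trans_lt hU
      · apply card_le_card
        intro y
        simp only [mem_sdiff, mem_nb, hW, hAdef, mem_filter, mem_univ, true_and]
        rintro ⟨⟨h1, u, hu, h2⟩, h3⟩
        exact ⟨by rw [if_neg h3, h1], u, hu.1, h2⟩
    have e2 : 60 * (U ∩ univ.biUnion D).card ≤ (nb G U W).card := by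
      have : (U ∩ univ.biUnion D).card * 60 =
          ((U ∩ univ.biUnion D).biUnion fun d => (ch T par d).filter fun y => l d y = i).card := by
        rw [card_biUnion, Finset.sum_const_nat]
        · intro d hd; exact hl d (mem_inter.1 hd).2 i
        · intro d _ d' _ hdd
          rw [Function.onFun, Finset.disjoint_left]
          intro y
          simp only [ch, mem_filter]
          rintro ⟨⟨_, h1⟩, _⟩ ⟨⟨_, h2⟩, _⟩
          exact hdd (h1.symm.trans h2)
      rw [mul_comm, this]
      apply card_le_card
      intro y
      simp only [mem_biUnion, ch, mem_filter, mem_inter, mem_nb, hW, mem_univ, true_and]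
      rintro ⟨d, ⟨h1, _⟩, ⟨h2, h3⟩, h4⟩
      refine ⟨by rw [if_pos h2, h3, h4], d, h1, ?_⟩
      rw [← h3]; exact h.ext.2.2 y h2
    omega

end
end HE

namespace HE
noncomputable section
open scoped Classical
open Finset

variable {α : Type*} [Fintype α]

structure Good (G : SimpleGraph α) (l : ℕ) (F : SimpleGraph α) : Prop where
  le : F ≤ G
  deg : ∀ v, F.degree v ≤ 2
  cyc : ∀ (v : α) (c : F.Walk v v), c.IsCycle → l ≤ c.length

theorem cycle_closed {F : SimpleGraph α} (hd : ∀ v, F.degree v ≤ 2) {v : α} {c : F.Walk v v}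
    (hc : c.IsCycle) {x y : α} (hx : x ∈ c.support) (hxy : F.Adj x y) : y ∈ c.support := by
  have h2 := hc.ncard_neighborSet_toSubgraph_eq_two hx
  have hsub : c.toSubgraph.neighborSet x ⊆ F.neighborSet x := c.toSubgraph.neighborSet_subset x
  have hle : (F.neighborSet x).ncard ≤ (c.toSubgraph.neighborSet x).ncard := by
    rw [h2, Set.ncard_eq_toFinset_card']
    exact hd x
  have heq := Set.eq_of_subset_of_ncard_le hsub hle (Set.toFinite _)
  have : y ∈ c.toSubgraph.neighborSet x := by rw [heq]; exact hxy
  exact c.mem_verts_toSubgraph.1 (c.toSubgraph.edge_vert this.symm)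

theorem walk_closed {F : SimpleGraph α} {P : α → Prop} (hP : ∀ x y, P x → F.Adj x y → P y)
    {x y : α} (w : F.Walk x y) (hx : P x) : P y := by
  induction w with
  | nil => exact hx
  | cons h p ih => exact ih (hP _ _ hx h)

theorem exists_cut {F : SimpleGraph α} (hd : ∀ v, F.degree v ≤ 2) {r z : α} (hr : F.degree r ≤ 1)
    (hrz : r ≠ z) (hz : F.degree z = 2) :
    ∃ z', F.Adj z z' ∧ ¬ (F.deleteEdges {s(z, z')}).Reachable r z := by
  by_cases hreach : F.Reachable r z
  · obtain ⟨p, hp⟩ := hreach.exists_isPath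
    have hnil : ¬ p.Nil := SimpleGraph.Walk.not_nil_of_ne hrz
    have hadj := p.adj_penultimate hnil
    refine ⟨p.penultimate, hadj.symm, ?_⟩
    have hbr : F.IsBridge s(z, p.penultimate) := by
      rw [SimpleGraph.isBridge_iff_forall_cycle_notMem (by exact hadj.symm)]
      intro u c hc he
      have hzc := c.fst_mem_support_of_mem_edges he
      have hrc : r ∈ c.support := walk_closed (P := fun x => x ∈ c.support)
        (fun x y hx hxy => cycle_closed hd hc hx hxy) p.reverse hzc
      have h2 := hc.ncard_neighborSet_toSubgraph_eq_two hrc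
      have hle := Set.ncard_le_ncard (c.toSubgraph.neighborSet_subset r) (Set.toFinite _)
      rw [h2, Set.ncard_eq_toFinset_card'] at hle
      have : (F.neighborSet r).toFinset.card = F.degree r := rfl
      omega
    rw [SimpleGraph.isBridge_iff] at hbr
    intro hcon
    apply hbr
    have h3 : (F.deleteEdges {s(z, p.penultimate)}).Reachable r p.penultimate := by
      rw [SimpleGraph.reachable_deleteEdges_iff_exists_walk]
      refine ⟨p.dropLast, fun he => ?_⟩
      have := p.dropLast.fst_mem_support_of_mem_edges he
      rw [SimpleGraph.Walk.support_dropLast hnil] at this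
      have hnd := hp.support_nodup
      rw [← SimpleGraph.Walk.dropLast_support_concat p] at hnd
      rw [List.nodup_append] at hnd
      exact hnd.2.2 _ this z (by simp) rfl
    exact hcon.symm.trans h3
  · have : 0 < F.degree z := by omega
    obtain ⟨z', hz'⟩ := (F.degree_pos_iff_exists_adj z).1 this
    exact ⟨z', hz', fun h => hreach (h.mono (SimpleGraph.deleteEdges_le _))⟩

def rot (F : SimpleGraph α) (r z z' : α) : SimpleGraph α :=
  F.deleteEdges {s(z, z')} ⊔ SimpleGraph.edge r z

theorem rot_adj {F : SimpleGraph α} {r z z' x y : α} (h : r ≠ z) :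
    (rot F r z z').Adj x y ↔ (F.Adj x y ∧ s(x, y) ≠ s(z, z')) ∨ s(x, y) = s(r, z) := by
  simp only [rot, SimpleGraph.sup_adj, SimpleGraph.deleteEdges_adj, Set.mem_singleton_iff,
    SimpleGraph.edge_adj, Sym2.eq_iff, ne_eq]
  constructor
  · rintro (h | h)
    · exact Or.inl h
    · right; tauto
  · rintro (h | h)
    · exact Or.inl h
    · right; refine ⟨h, ?_⟩
      rintro rfl; rcases h with ⟨h1, h2⟩ | ⟨h1, h2⟩ <;> simp_all

theorem sum_deg_aux {F F' : SimpleGraph α} {x : α} {a b : Finset α}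
    (h : ∀ y, F'.Adj x y ↔ (F.Adj x y ∧ y ∉ a) ∨ y ∈ b) (ha : ∀ y ∈ a, F.Adj x y)
    (hb : ∀ y ∈ b, ¬ F.Adj x y) : F'.degree x + a.card = F.degree x + b.card := by
  have e1 : F'.neighborFinset x = (F.neighborFinset x \ a) ∪ b := by
    ext y; simp [h]
  rw [← SimpleGraph.card_neighborFinset_eq_degree, ← SimpleGraph.card_neighborFinset_eq_degree, e1,
    card_union_of_disjoint]
  · have : (F.neighborFinset x \ a).card + a.card = (F.neighborFinset x).card := by
      apply card_sdiff_add_card_eq_card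
      intro y hy; simpa using ha y hy
    omega
  · rw [Finset.disjoint_left]
    intro y hy hyb
    simp only [mem_sdiff, SimpleGraph.mem_neighborFinset] at hy
    exact hb y hyb hy.1

theorem rot_deg {F : SimpleGraph α} {r z z' : α} (hrz : r ≠ z) (hn : ¬ F.Adj r z)
    (hz : F.Adj z z') (x : α) :
    (rot F r z z').degree x + (if x = z' then 1 else 0) = F.degree x + (if x = r then 1 else 0) := by
  have hz'r : z' ≠ r := by rintro rfl; exact hn hz.symm
  have hzz' : z ≠ z' := hz.ne
  by_cases h1 : x = z
  · subst h1
    rw [if_neg hzz', if_neg (Ne.symm hrz)]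
    have := sum_deg_aux (F := F) (F' := rot F r x z') (x := x) (a := {z'}) (b := {r})
      (by intro y; rw [rot_adj hrz]; simp only [Sym2.eq_iff, mem_singleton]; grind)
      (by simpa using hz) (by simpa using fun h => hn h.symm)
    simpa using this
  · by_cases h2 : x = r
    · subst h2
      rw [if_neg (Ne.symm hz'r), if_pos rfl]
      have := sum_deg_aux (F := F) (F' := rot F x z z') (x := x) (a := ∅) (b := {z})
        (by intro y; rw [rot_adj hrz]; simp only [Sym2.eq_iff, mem_singleton]; grind)
        (by simp) (by simpa using hn)
      simpa using this
    · by_cases h3 : x = z'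
      · subst h3
        rw [if_neg hz'r, if_pos rfl]
        have := sum_deg_aux (F := F) (F' := rot F r z x) (x := x) (a := {z}) (b := ∅)
          (by intro y; rw [rot_adj hrz]; simp only [Sym2.eq_iff, mem_singleton]; grind)
          (by simpa using hz.symm) (by simp)
        simpa using this
      · rw [if_neg h3, if_neg h2]
        have := sum_deg_aux (F := F) (F' := rot F r z z') (x := x) (a := ∅) (b := ∅)
          (by intro y; rw [rot_adj hrz]; simp only [Sym2.eq_iff]; grind)
          (by simp) (by simp)
        simpa using this

theorem rot_good {G F : SimpleGraph α} {l : ℕ} (hF : Good G l F) {r z : α} (hr : F.degree r ≤ 1)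
    (hrz : G.Adj r z) (hn : ¬ F.Adj r z) (hz : F.degree z = 2) :
    ∃ z', F.Adj z z' ∧ Good G l (rot F r z z') := by
  obtain ⟨z', hz', hcut⟩ := exists_cut hF.deg hr hrz.ne hz
  refine ⟨z', hz', ?_, ?_, ?_⟩
  · intro x y hxy
    rw [rot_adj hrz.ne] at hxy
    rcases hxy with h | h
    · exact hF.le h.1
    · rw [Sym2.eq_iff] at h
      rcases h with ⟨rfl, rfl⟩ | ⟨rfl, rfl⟩
      exacts [hrz, hrz.symm]
  · intro x
    have := rot_deg hrz.ne hn hz' x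
    have h2 := hF.deg x
    by_cases hx : x = r
    · subst hx; simp at this; omega
    · rw [if_neg hx] at this; omega
  · intro v c hc
    have hbr : (rot F r z z').IsBridge s(r, z) := by
      rw [SimpleGraph.isBridge_iff]
      intro h
      apply hcut
      refine h.mono ?_
      intro x y
      rw [SimpleGraph.deleteEdges_adj, rot_adj hrz.ne, SimpleGraph.deleteEdges_adj]
      simp only [Set.mem_singleton_iff]
      tauto
    have hne := hbr.notMem_edges_of_isCycle hc
    have hmem : ∀ e ∈ c.edges, e ∈ F.edgeSet := by
      intro e he
      induction e with
      | h x y =>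
        have := c.adj_of_mem_edges he
        rw [rot_adj hrz.ne] at this
        rcases this with h | h
        · exact h.1
        · exact absurd (h ▸ he) hne
    have := hF.cyc v (c.transfer F hmem) (hc.transfer hmem)
    simpa using this

end
end HE

namespace HE
noncomputable section
open scoped Classical
open Finset

variable {α : Type*} [Fintype α]

inductive Reach (G F0 : SimpleGraph α) (l : ℕ) (Z : Finset α) : SimpleGraph α → α → α → Prop
  | base (u : α) (hu : u ∈ Z) (hd : F0.degree u ≤ 1) : Reach G F0 l Z F0 u u
  | step (F : SimpleGraph α) (u r z z' : α) (h : Reach G F0 l Z F u r) (hz : z ∈ Z)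
      (hrz : G.Adj r z) (hn : ¬ F.Adj r z) (hd : F.degree z = 2) (hzz : F.Adj z z')
      (hg : Good G l (rot F r z z')) : Reach G F0 l Z (rot F r z z') u z'

def Zp (F : SimpleGraph α) (Z : Finset α) : Finset α := Z ∪ nb F Z univ

def XZ (G F0 : SimpleGraph α) (l : ℕ) (Z : Finset α) : Finset α :=
  univ.filter fun r => ∃ F u, Reach G F0 l Z F u r

structure RInv (G F0 : SimpleGraph α) (l : ℕ) (Z : Finset α) (F : SimpleGraph α) (u r : α) : Prop where
  good : Good G l F
  uZ : u ∈ Z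
  uE : F0.degree u ≤ 1
  rZ : r ∈ Zp F0 Z
  deg : ∀ x, F.degree x + (if x = r then 1 else 0) = F0.degree x + (if x = u then 1 else 0)
  agree : ∀ x y, x ∉ Zp F0 Z ∨ y ∉ Zp F0 Z → (F.Adj x y ↔ F0.Adj x y)

theorem reach_inv {G F0 : SimpleGraph α} {l : ℕ} {Z : Finset α} (h0 : Good G l F0)
    {F : SimpleGraph α} {u r : α} (h : Reach G F0 l Z F u r) : RInv G F0 l Z F u r := by
  induction h with
  | base u hu hd =>
    exact ⟨h0, hu, hd, mem_union_left _ hu, fun _ => rfl, fun _ _ _ => Iff.rfl⟩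
  | step F u r z z' h hz hrz hn hd hzz hg ih =>
    have hzp : z ∈ Zp F0 Z := mem_union_left _ hz
    have hz'p : z' ∈ Zp F0 Z := by
      by_contra hcon
      have := (ih.agree z z' (Or.inr hcon)).1 hzz
      exact hcon (mem_union_right _ (mem_nb.2 ⟨mem_univ _, z, hz, this⟩))
    refine ⟨hg, ih.uZ, ih.uE, hz'p, ?_, ?_⟩
    · intro x
      have h1 := rot_deg hrz.ne hn hzz x
      have h2 := ih.deg x
      omega
    · intro x y hxy
      rw [← ih.agree x y hxy, rot_adj hrz.ne]
      have hr := ih.rZ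
      constructor
      · rintro (h | h)
        · exact h.1
        · rw [Sym2.eq_iff] at h
          rcases h with ⟨rfl, rfl⟩ | ⟨rfl, rfl⟩ <;> tauto
      · intro h
        left
        refine ⟨h, ?_⟩
        intro h
        rw [Sym2.eq_iff] at h
        rcases h with ⟨rfl, rfl⟩ | ⟨rfl, rfl⟩ <;> tauto

theorem reach_mono {G F0 : SimpleGraph α} {l : ℕ} {Z Z' : Finset α} (hZ : Z ⊆ Z')
    {F : SimpleGraph α} {u r : α} (h : Reach G F0 l Z F u r) : Reach G F0 l Z' F u r := by
  induction h with
  | base u hu hd => exact Reach.base u (hZ hu) hd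
  | step F u r z z' h hz hrz hn hd hzz hg ih => exact Reach.step F u r z z' ih (hZ hz) hrz hn hd hzz hg

theorem XZ_mono {G F0 : SimpleGraph α} {l : ℕ} {Z Z' : Finset α} (hZ : Z ⊆ Z') :
    XZ G F0 l Z ⊆ XZ G F0 l Z' := by
  intro r; simp only [XZ, mem_filter, mem_univ, true_and]
  rintro ⟨F, u, h⟩; exact ⟨F, u, reach_mono hZ h⟩

theorem reach_edge {G F0 : SimpleGraph α} {l : ℕ} {Z : Finset α}
    {F : SimpleGraph α} {u r : α} (h : Reach G F0 l Z F u r) :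
    ∀ x y, F.Adj x y → F0.Adj x y ∨ (x ∈ Zp F0 (XZ G F0 l Z) ∧ y ∈ Zp F0 (XZ G F0 l Z)) := by
  induction h with
  | base u hu hd => intro x y h; exact Or.inl h
  | step F u r z z' h hz hrz hn hd hzz hg ih =>
    have hr : r ∈ XZ G F0 l Z := by simp only [XZ, mem_filter, mem_univ, true_and]; exact ⟨_, _, h⟩
    have hz' : z' ∈ XZ G F0 l Z := by
      simp only [XZ, mem_filter, mem_univ, true_and]
      exact ⟨_, _, Reach.step F u r z z' h hz hrz hn hd hzz hg⟩
    have hzX : z ∈ Zp F0 (XZ G F0 l Z) := by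
      rcases ih z z' hzz with h1 | h1
      · exact mem_union_right _ (mem_nb.2 ⟨mem_univ _, z', hz', h1.symm⟩)
      · exact h1.1
    intro x y hxy
    rw [rot_adj hrz.ne] at hxy
    rcases hxy with h1 | h1
    · exact ih x y h1.1
    · rw [Sym2.eq_iff] at h1
      right
      rcases h1 with ⟨rfl, rfl⟩ | ⟨rfl, rfl⟩
      · exact ⟨mem_union_left _ hr, hzX⟩
      · exact ⟨hzX, mem_union_left _ hr⟩

theorem reach_closure {G F0 : SimpleGraph α} {l : ℕ} {Z : Finset α} (h0 : Good G l F0) :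
    nb G (XZ G F0 l Z) Z ⊆ Zp F0 (XZ G F0 l Z) := by
  intro z hz
  rw [mem_nb] at hz
  obtain ⟨hz, r, hr, hrz⟩ := hz
  have hr0 := hr
  simp only [XZ, mem_filter, mem_univ, true_and] at hr
  obtain ⟨F, u, h⟩ := hr
  have inv := reach_inv h0 h
  by_cases hadj : F.Adj r z
  · rcases reach_edge h r z hadj with h1 | h1
    · exact mem_union_right _ (mem_nb.2 ⟨mem_univ _, r, hr0, h1⟩)
    · exact h1.2
  · have hdr : F.degree r ≤ 1 := by
      have h1 := inv.deg r
      rw [if_pos rfl] at h1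
      have h2 := inv.uE
      have h3 := h0.deg r
      by_cases hru : r = u
      · subst hru; rw [if_pos rfl] at h1; omega
      · rw [if_neg hru] at h1; omega
    by_cases hd : F.degree z = 2
    · obtain ⟨z', hzz', hg⟩ := rot_good inv.good hdr hrz hadj hd
      have hs := Reach.step F u r z z' h hz hrz hadj hd hzz' hg
      have hz' : z' ∈ XZ G F0 l Z := by
        simp only [XZ, mem_filter, mem_univ, true_and]; exact ⟨_, _, hs⟩
      rcases reach_edge h z z' hzz' with h1 | h1
      · exact mem_union_right _ (mem_nb.2 ⟨mem_univ _, z', hz', h1.symm⟩)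
      · exact h1.1
    · have h1 := inv.deg z
      rw [if_neg hrz.ne'] at h1
      have h2 := inv.good.deg z
      apply mem_union_left
      simp only [XZ, mem_filter, mem_univ, true_and]
      exact ⟨F0, z, Reach.base z hz (by omega)⟩

theorem Zp_card {F : SimpleGraph α} (hd : ∀ v, F.degree v ≤ 2) (X : Finset α) :
    (Zp F X).card ≤ 3 * X.card := by
  have : nb F X univ ⊆ X.biUnion fun x => F.neighborFinset x := by
    intro y; rw [mem_nb]; rintro ⟨_, u, hu, h⟩
    simp only [mem_biUnion, SimpleGraph.mem_neighborFinset]; exact ⟨u, hu, h⟩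
  have h1 := (card_le_card this).trans (card_biUnion_le_card_mul _ _ 2 (fun x _ => hd x))
  have h2 := card_union_le X (nb F X univ)
  unfold Zp
  omega

theorem reach_count {G F0 : SimpleGraph α} {l : ℕ} {Z : Finset α} (h0 : Good G l F0) :
    (nb G (XZ G F0 l Z) Z).card ≤ 3 * (XZ G F0 l Z).card :=
  (card_le_card (reach_closure h0)).trans (Zp_card h0.deg _)

theorem sub_XZ {G F0 : SimpleGraph α} {l : ℕ} {Z : Finset α} :
    (Z.filter fun u => F0.degree u ≤ 1) ⊆ XZ G F0 l Z := by
  intro u hu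
  rw [mem_filter] at hu
  simp only [XZ, mem_filter, mem_univ, true_and]
  exact ⟨F0, u, Reach.base u hu.1 hu.2⟩

/-- the combination of two local modifications plus an edge -/
def comb (A : Finset α) (F1 F2 : SimpleGraph α) (u v : α) (x y : α) : Prop :=
  (if x ∈ A then F1.Adj x y else F2.Adj x y) ∨ s(x, y) = s(u, v)

theorem combine {G F : SimpleGraph α} {l : ℕ} (h0 : Good G l F) {Z1 Z2 : Finset α}
    {γ : Type*} (comp : α → γ) (d : α → ℕ)
    (hcomp : ∀ x y, F.Adj x y → comp x = comp y ∧ d x ≤ d y + 1)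
    (hfar : ∀ x ∈ Zp F Z1, ∀ y ∈ Zp F Z2, comp x = comp y → d x + l < d y ∨ d y + l < d x)
    {F1 F2 : SimpleGraph α} {u u' v v' : α}
    (h1 : RInv G F l Z1 F1 u u') (h2 : RInv G F l Z2 F2 v v') (huv : G.Adj u' v') (hl : 1 ≤ l) :
    ∃ F', Good G l F' ∧ ∑ x, F'.degree x = ∑ x, F.degree x + 2 := by
  set A := Zp F Z1 with hA
  set B := Zp F Z2 with hB
  have hdisj : ∀ x ∈ A, x ∉ B := by
    intro x hx hx2
    have := hfar x hx x hx2 rfl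
    omega
  have hd2 : ∀ x y, F.Adj x y → comp y = comp x ∧ d y ≤ d x + 1 := fun x y h => hcomp y x h.symm
  have hnoedge : ∀ x ∈ A, ∀ y ∈ B, ¬ F.Adj x y := by
    intro x hx y hy h
    have := hcomp x y h
    have h3 := hd2 x y h
    have := hfar x hx y hy this.1
    omega
  have e1 : ∀ x y, x ∈ A → y ∉ A → (F1.Adj x y ↔ F2.Adj x y) := by
    intro x y hx hy
    rw [h1.agree x y (Or.inr hy), h2.agree x y (Or.inl (hdisj x hx))]
  have hu'A : u' ∈ A := h1.rZ
  have hv'B : v' ∈ B := h2.rZ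
  have hv'A : v' ∉ A := fun h => hdisj v' h hv'B
  have huA : u ∈ A := mem_union_left _ h1.uZ
  have hvB : v ∈ B := mem_union_left _ h2.uZ
  have hvA : v ∉ A := fun h => hdisj v h hvB
  let F' : SimpleGraph α :=
    { Adj := comb A F1 F2 u' v'
      symm := ⟨by
        intro x y h
        unfold comb at h ⊢
        rw [Sym2.eq_swap (a := y)]
        rcases h with h | h
        · left
          by_cases hx : x ∈ A <;> by_cases hy : y ∈ A <;> simp only [hx, hy, if_true, if_false] at h ⊢
          · exact h.symm
          · exact ((e1 x y hx hy).1 h).symm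
          · exact (e1 y x hy hx).2 h.symm
          · exact h.symm
        · exact Or.inr h⟩
      loopless := ⟨by
        intro x h
        unfold comb at h
        rcases h with h | h
        · by_cases hx : x ∈ A <;> simp [hx] at h
        · rw [Sym2.eq_iff] at h
          rcases h with ⟨rfl, h⟩ | ⟨rfl, h⟩
          · exact huv.ne h
          · exact huv.ne h.symm⟩ }
  have hadj : ∀ x y, F'.Adj x y ↔ (if x ∈ A then F1.Adj x y else F2.Adj x y) ∨ s(x, y) = s(u', v') :=
    fun _ _ => Iff.rfl
  have hno : ¬ F1.Adj u' v' ∧ ¬ F2.Adj u' v' := by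
    constructor
    · rw [h1.agree _ _ (Or.inr hv'A)]; exact hnoedge _ hu'A _ hv'B
    · rw [h2.agree _ _ (Or.inl (hdisj _ hu'A))]; exact hnoedge _ hu'A _ hv'B
  have hdeg : ∀ x, F'.degree x = F.degree x + ((if x = u then 1 else 0) + (if x = v then 1 else 0)) := by
    intro x
    by_cases hx : x ∈ A
    · have hxv : x ≠ v := by rintro rfl; exact hvA hx
      have hxv' : x ≠ v' := by rintro rfl; exact hv'A hx
      rw [if_neg hxv, add_zero, ← h1.deg x]
      by_cases hxu : x = u'
      · subst hxu
        have := sum_deg_aux (F := F1) (F' := F') (x := x) (a := ∅) (b := {v'})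
          (by intro y; rw [hadj, if_pos hx]; simp only [Sym2.eq_iff, mem_singleton]; grind)
          (by simp) (by simpa using hno.1)
        simpa using this
      · rw [if_neg hxu]
        have := sum_deg_aux (F := F1) (F' := F') (x := x) (a := ∅) (b := ∅)
          (by intro y; rw [hadj, if_pos hx]; simp only [Sym2.eq_iff]; grind)
          (by simp) (by simp)
        simpa using this
    · have hxu : x ≠ u := by rintro rfl; exact hx huA
      have hxu' : x ≠ u' := by rintro rfl; exact hx hu'A
      rw [if_neg hxu, zero_add, ← h2.deg x]
      by_cases hxu : x = v'
      · subst hxu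
        have := sum_deg_aux (F := F2) (F' := F') (x := x) (a := ∅) (b := {u'})
          (by intro y; rw [hadj, if_neg hx]; simp only [Sym2.eq_iff, mem_singleton]; grind)
          (by simp) (by simpa using fun h => hno.2 h.symm)
        simpa using this
      · rw [if_neg hxu]
        have := sum_deg_aux (F := F2) (F' := F') (x := x) (a := ∅) (b := ∅)
          (by intro y; rw [hadj, if_neg hx]; simp only [Sym2.eq_iff]; grind)
          (by simp) (by simp)
        simpa using this
  have hwalk : ∀ (x y : α) (w : F'.Walk x y) (i : ℕ), s(u', v') ∉ w.edges →
      (∃ a ∈ A, comp a = comp x ∧ d a ≤ d x + i ∧ d x ≤ d a + i) → i + w.length ≤ l →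
      (∃ a ∈ A, comp a = comp y ∧ d a ≤ d y + l ∧ d y ≤ d a + l) ∧
      ∀ e ∈ w.edges, e ∈ F1.edgeSet := by
    intro x y w
    induction w with
    | nil =>
      rintro i _ ⟨a, ha, hac, h3, h4⟩ hi
      simp at hi
      exact ⟨⟨a, ha, hac, by omega, by omega⟩, by simp⟩
    | @cons x z y h p ih =>
      rintro i hne ⟨a, ha, hac, h3, h4⟩ hi
      rw [SimpleGraph.Walk.edges_cons, List.mem_cons, not_or] at hne
      rw [SimpleGraph.Walk.length_cons] at hi
      have hxB : x ∉ B := by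
        intro hxB
        have := hfar a ha x hxB hac
        omega
      have hF1 : F1.Adj x z := by
        rw [hadj] at h
        rcases h with h | h
        · by_cases hx : x ∈ A
          · rwa [if_pos hx] at h
          · rw [if_neg hx, h2.agree _ _ (Or.inl hxB)] at h
            rwa [h1.agree _ _ (Or.inl hx)]
        · exact absurd h.symm hne.1
      have hPz : ∃ a ∈ A, comp a = comp z ∧ d a ≤ d z + (i + 1) ∧ d z ≤ d a + (i + 1) := by
        by_cases hz : z ∈ A
        · exact ⟨z, hz, rfl, by omega, by omega⟩
        · rw [h1.agree _ _ (Or.inr hz)] at hF1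
          have g1 := hcomp x z hF1
          have g2 := hd2 x z hF1
          exact ⟨a, ha, hac.trans g1.1, by omega, by omega⟩
      obtain ⟨r1, r2⟩ := ih (i + 1) hne.2 hPz (by omega)
      refine ⟨r1, ?_⟩
      intro e he
      rw [SimpleGraph.Walk.edges_cons, List.mem_cons] at he
      rcases he with rfl | he
      · exact hF1
      · exact r2 e he
  have hsep : ∀ w : F'.Walk u' v', s(u', v') ∉ w.edges → l < w.length := by
    intro w hw
    by_contra hlt
    push Not at hlt
    obtain ⟨⟨a, ha, hac, h3, h4⟩, -⟩ := hwalk u' v' w 0 hw ⟨u', hu'A, rfl, by omega, by omega⟩ (by omega)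
    have := hfar a ha v' hv'B hac
    omega
  refine ⟨F', ⟨?_, ?_, ?_⟩, ?_⟩
  · intro x y h
    rw [hadj] at h
    rcases h with h | h
    · by_cases hx : x ∈ A
      · rw [if_pos hx] at h; exact h1.good.le h
      · rw [if_neg hx] at h; exact h2.good.le h
    · rw [Sym2.eq_iff] at h
      rcases h with ⟨rfl, rfl⟩ | ⟨rfl, rfl⟩
      exacts [huv, huv.symm]
  · intro x
    rw [hdeg]
    have g1 := h1.uE
    have g2 := h2.uE
    have g3 := h0.deg x
    by_cases hxu : x = u
    · have : x ≠ v := by rintro rfl; exact hvA (hxu ▸ huA)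
      rw [if_pos hxu, if_neg this]; subst hxu; omega
    · rw [if_neg hxu]
      by_cases hxv : x = v
      · rw [if_pos hxv]; subst hxv; omega
      · rw [if_neg hxv]; omega
  · intro x c hc
    by_contra hlt
    push Not at hlt
    by_cases he : s(u', v') ∈ c.edges
    · have hu := c.fst_mem_support_of_mem_edges he
      have hc' := hc.rotate hu
      have he' : s(u', v') ∈ (c.rotate u' hu).edges := (c.rotate_edges u' hu).mem_iff.2 he
      have hv := (c.rotate u' hu).snd_mem_support_of_mem_edges he'
      have hlen : (c.rotate u' hu).length = c.length := by simp
      set c' := c.rotate u' hu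
      have hsplit := c'.take_spec hv
      have hnd := hc'.isTrail.edges_nodup
      rw [← hsplit, SimpleGraph.Walk.edges_append] at hnd
      have hll : (c'.takeUntil v' hv).length + (c'.dropUntil v' hv).length = c'.length := by
        rw [← SimpleGraph.Walk.length_append, hsplit]
      by_cases hin : s(u', v') ∈ (c'.takeUntil v' hv).edges
      · have hnin : s(u', v') ∉ (c'.dropUntil v' hv).edges :=
          fun h => List.disjoint_of_nodup_append hnd hin h
        have := hsep (c'.dropUntil v' hv).reverse (by
          rw [SimpleGraph.Walk.edges_reverse, List.mem_reverse]; exact hnin)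
        rw [SimpleGraph.Walk.length_reverse] at this
        omega
      · have := hsep _ hin
        omega
    · by_cases hex : ∃ a ∈ A, a ∈ c.support
      · obtain ⟨a, ha, hac⟩ := hex
        have he' : s(u', v') ∉ (c.rotate a hac).edges := fun h => he ((c.rotate_edges a hac).mem_iff.1 h)
        have hlen : (c.rotate a hac).length = c.length := by simp
        obtain ⟨-, h3⟩ := hwalk a a (c.rotate a hac) 0 he' ⟨a, ha, rfl, by omega, by omega⟩ (by omega)
        have := h1.good.cyc a ((c.rotate a hac).transfer F1 h3) ((hc.rotate hac).transfer h3)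
        rw [SimpleGraph.Walk.length_transfer] at this
        omega
      · push Not at hex
        have h3 : ∀ e ∈ c.edges, e ∈ F2.edgeSet := by
          intro e hee
          induction e with
          | h p q =>
            have g1 := c.adj_of_mem_edges hee
            rw [hadj] at g1
            have hp : p ∉ A := fun h => hex p h (c.fst_mem_support_of_mem_edges hee)
            rcases g1 with g1 | g1
            · rwa [if_neg hp] at g1
            · exact absurd (g1 ▸ hee) he
        have := h2.good.cyc x (c.transfer F2 h3) (hc.transfer h3)
        rw [SimpleGraph.Walk.length_transfer] at this
        omega
  · simp only [hdeg, sum_add_distrib]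
    simp

end
end HE

namespace HE
noncomputable section
open scoped Classical
open Finset

variable {α : Type*} [Fintype α]

theorem dist_pred {F : SimpleGraph α} {r x : α} {k : ℕ} (h : F.Reachable r x) (hd : F.dist r x = k + 1) :
    ∃ w, F.Adj w x ∧ F.Reachable r w ∧ F.dist r w = k := by
  obtain ⟨p, hp⟩ := h.exists_walk_length_eq_dist
  have hnil : ¬ p.Nil := by
    intro hn
    have := SimpleGraph.Walk.length_eq_zero_iff.2 hn
    omega
  have hadj := p.adj_penultimate hnil
  refine ⟨p.penultimate, hadj, ⟨p.dropLast⟩, ?_⟩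
  have h1 := F.dist_le p.dropLast
  have h2 := SimpleGraph.Walk.length_dropLast_add_one hnil
  obtain ⟨q, hq⟩ := (show F.Reachable r p.penultimate from ⟨p.dropLast⟩).exists_walk_length_eq_dist
  have h3 := F.dist_le (q.concat hadj)
  rw [SimpleGraph.Walk.length_concat] at h3
  omega

theorem layer_card {F : SimpleGraph α} (hd : ∀ v, F.degree v ≤ 2) (r : α) (k : ℕ) :
    (univ.filter fun x => F.Reachable r x ∧ F.dist r x = k).card ≤ 2 := by
  induction k with
  | zero =>
    have : (univ.filter fun x => F.Reachable r x ∧ F.dist r x = 0) ⊆ {r} := by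
      intro x; simp only [mem_filter, mem_univ, true_and, mem_singleton]
      rintro ⟨h1, h2⟩
      exact (h1.dist_eq_zero_iff.1 h2).symm
    exact (card_le_card this).trans (by simp)
  | succ k ih =>
    rcases k with _ | k
    · have : (univ.filter fun x => F.Reachable r x ∧ F.dist r x = 0 + 1) ⊆ F.neighborFinset r := by
        intro x; simp only [mem_filter, mem_univ, true_and, SimpleGraph.mem_neighborFinset]
        rintro ⟨h1, h2⟩
        obtain ⟨w, hw, hr, h0⟩ := dist_pred h1 h2
        rw [hr.dist_eq_zero_iff.1 h0]; exact hw
      exact (card_le_card this).trans (hd r)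
    · refine le_trans ?_ ih
      have hex : ∀ x : α, ∃ w, F.Reachable r x ∧ F.dist r x = k + 1 + 1 →
          F.Adj w x ∧ F.Reachable r w ∧ F.dist r w = k + 1 := by
        intro x
        by_cases h : F.Reachable r x ∧ F.dist r x = k + 1 + 1
        · obtain ⟨w, hw⟩ := dist_pred h.1 h.2
          exact ⟨w, fun _ => hw⟩
        · exact ⟨x, fun h' => absurd h' h⟩
      choose g hg using hex
      refine Finset.card_le_card_of_injOn g ?_ ?_
      · intro x hx
        simp only [coe_filter, mem_univ, true_and, Set.mem_ofPred_eq] at hx ⊢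
        exact (hg x hx).2
      · intro x hx y hy hxy
        simp only [coe_filter, mem_univ, true_and, Set.mem_ofPred_eq] at hx hy
        by_contra hne
        obtain ⟨a1, a2, a3⟩ := hg x hx
        obtain ⟨b1, b2, b3⟩ := hg y hy
        obtain ⟨w, w1, w2, w3⟩ := dist_pred a2 a3
        rw [← hxy] at b1
        have hsub : ({x, y, w} : Finset α) ⊆ F.neighborFinset (g x) := by
          intro z; simp only [mem_insert, mem_singleton, SimpleGraph.mem_neighborFinset]
          rintro (rfl | rfl | rfl)
          exacts [a1, b1, w1.symm]
        have hxw : x ≠ w := by rintro rfl; omega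
        have hyw : y ≠ w := by rintro rfl; omega
        have h3 : ({x, y, w} : Finset α).card = 3 := by
          rw [card_eq_three]; exact ⟨x, y, w, hne, hxw, hyw, rfl⟩
        have := card_le_card hsub
        have h4 := hd (g x)
        rw [← SimpleGraph.card_neighborFinset_eq_degree] at h4
        omega

theorem layers {F : SimpleGraph α} (hd : ∀ v, F.degree v ≤ 2) :
    ∃ d : α → ℕ, (∀ x y, F.Adj x y → F.connectedComponentMk x = F.connectedComponentMk y ∧ d x ≤ d y + 1) ∧
      ∀ c k, (univ.filter fun x => F.connectedComponentMk x = c ∧ d x = k).card ≤ 2 := by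
  have hr : ∀ x, F.Reachable (F.connectedComponentMk x).out x := by
    intro x
    exact SimpleGraph.ConnectedComponent.exact (Quot.out_eq _)
  refine ⟨fun x => F.dist (F.connectedComponentMk x).out x, ?_, ?_⟩
  · intro x y hxy
    have hc : F.connectedComponentMk x = F.connectedComponentMk y :=
      SimpleGraph.ConnectedComponent.sound hxy.reachable
    refine ⟨hc, ?_⟩
    simp only [hc]
    obtain ⟨q, hq⟩ := (hr y).exists_walk_length_eq_dist
    have h3 := F.dist_le (q.concat hxy.symm)
    rw [SimpleGraph.Walk.length_concat] at h3
    omega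
  · intro c k
    refine le_trans (card_le_card ?_) (layer_card hd c.out k)
    intro x; simp only [mem_filter, mem_univ, true_and]
    rintro ⟨rfl, h⟩
    exact ⟨hr x, h⟩

theorem mod_count (a lam k : ℕ) :
    ((range lam).filter fun t => (a + t) % lam < k).card ≤ k := by
  conv_rhs => rw [← card_range k]
  refine Finset.card_le_card_of_injOn (fun t => (a + t) % lam) ?_ ?_
  · intro t ht
    simp only [coe_filter, mem_range, Set.mem_ofPred_eq] at ht
    simpa using ht.2
  · intro t ht s hs h
    simp only [coe_filter, mem_range, Set.mem_ofPred_eq] at ht hs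
    have h2 : t ≡ s [MOD lam] := Nat.ModEq.add_left_cancel' a h
    exact Nat.ModEq.eq_of_lt_of_lt h2 ht.1 hs.1

theorem shift_exists (d : α → ℕ) (lam k : ℕ) (hlam : 0 < lam) :
    ∃ t, lam * (univ.filter fun x => (d x + t) % lam < k).card ≤ k * Fintype.card α := by
  by_contra hcon
  push Not at hcon
  have h1 : ∑ t ∈ range lam, (univ.filter fun x => (d x + t) % lam < k).card ≤ k * Fintype.card α := by
    simp only [card_filter]
    rw [sum_comm]
    simp only [← card_filter]
    refine (sum_le_card_nsmul _ _ k (fun x _ => mod_count (d x) lam k)).trans ?_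
    simp [mul_comm]
  have h2 : ∑ t ∈ range lam, k * Fintype.card α <
      ∑ t ∈ range lam, lam * (univ.filter fun x => (d x + t) % lam < k).card :=
    sum_lt_sum_of_nonempty (by simpa using hlam.ne') (fun t _ => hcon t)
  rw [sum_const, card_range, smul_eq_mul, ← mul_sum] at h2
  have := Nat.mul_le_mul_left lam h1
  omega

section color
variable {ι : Type*} [Fintype ι]

def ep (S : Finset ι) (J : ι) : ℤ := if J ∈ S then -1 else 1

theorem sum_split (J : ι) (g : Finset ι → ℤ) :
    ∑ S, g S = ∑ S ∈ (univ.erase J).powerset, (g S + g (insert J S)) := by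
  rw [sum_add_distrib, ← sum_powerset_insert (notMem_erase J univ), insert_erase (mem_univ J),
    powerset_univ]

theorem influence {h : Finset ι → ℤ} (h0 : ∀ S, 0 ≤ h S) (ha : ∀ S T, S ⊆ T → h T ≤ h S)
    {f : Finset ι → ι → ℤ} {L : ℤ} (hf : ∀ S T, S ⊆ T → ∀ J, f S J ≤ f T J) (hL : ∀ S J, f S J ≤ L) :
    ∑ S, h S * ∑ J, ep S J * f S J ≤ ∑ S, h S * ∑ J, ep S J * L := by
  rw [← sub_nonneg, ← sum_sub_distrib]
  have : ∀ S, h S * ∑ J, ep S J * L - h S * ∑ J, ep S J * f S J =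
      ∑ J, h S * ep S J * (L - f S J) := by
    intro S
    rw [← mul_sub, ← sum_sub_distrib, mul_sum]
    apply sum_congr rfl; intro J _; ring
  simp only [this]
  rw [sum_comm]
  apply sum_nonneg
  intro J _
  rw [sum_split J]
  apply sum_nonneg
  intro S hS
  have hJ : J ∉ S := fun h => by
    have := mem_powerset.1 hS h
    simp at this
  simp only [ep, hJ, if_false, mem_insert_self, if_true]
  have e1 := ha S _ (subset_insert J S)
  have e2 := hf S _ (subset_insert J S) J
  have e3 := hL (insert J S) J
  have e4 := h0 (insert J S)
  nlinarith [mul_le_mul e1 (show L - f (insert J S) J ≤ L - f S J by linarith) (by linarith) (h0 S)]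

theorem variance_aux (w : ι → ℤ) (s : Finset ι) : ∀ c : ℤ,
    ∑ S ∈ s.powerset, (c + ∑ J ∈ s, ep S J * w J) ^ 2 = 2 ^ s.card * (c ^ 2 + ∑ J ∈ s, w J ^ 2) := by
  induction s using Finset.induction_on with
  | empty => intro c; simp
  | insert a s ha ih =>
    intro c
    rw [sum_powerset_insert ha]
    have e1 : ∀ S ∈ s.powerset, (c + ∑ J ∈ insert a s, ep S J * w J) ^ 2 =
        ((c + w a) + ∑ J ∈ s, ep S J * w J) ^ 2 := by
      intro S hS
      have : a ∉ S := fun h => ha (mem_powerset.1 hS h)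
      rw [sum_insert ha]; simp only [ep, this, if_false]; ring
    have e2 : ∀ S ∈ s.powerset, (c + ∑ J ∈ insert a s, ep (insert a S) J * w J) ^ 2 =
        ((c - w a) + ∑ J ∈ s, ep S J * w J) ^ 2 := by
      intro S hS
      rw [sum_insert ha]
      have : ∑ J ∈ s, ep (insert a S) J * w J = ∑ J ∈ s, ep S J * w J := by
        apply sum_congr rfl
        intro J hJ
        have : J ≠ a := by rintro rfl; exact ha hJ
        simp [ep, this]
      rw [this]; simp only [ep, mem_insert_self, if_true]; ring
    rw [sum_congr rfl e1, sum_congr rfl e2, ih, ih, card_insert_of_notMem ha, sum_insert ha]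
    ring

theorem variance (w : ι → ℤ) :
    ∑ S, (∑ J, ep S J * w J) ^ 2 = 2 ^ Fintype.card ι * ∑ J, w J ^ 2 := by
  have := variance_aux w univ 0
  simpa using this

theorem color (L r Mr : ℤ) (hL1 : 1 ≤ L) (hr1 : 1 ≤ r) {h : Finset ι → ℤ} (h01 : ∀ S, h S = 0 ∨ h S = 1)
    (ha : ∀ S T, S ⊆ T → h T ≤ h S) (hc : ∀ S, 1 ≤ h S + h Sᶜ)
    {f : Finset ι → ι → ℤ} (hf : ∀ S T, S ⊆ T → ∀ J, f S J ≤ f T J) (hL : ∀ S J, f S J ≤ L)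
    (a : ι → ℤ) (a0 : ∀ J, 0 ≤ a J) (aL : ∀ J, a J ≤ L)
    (key : ∀ S, h S = 1 → ∑ J, a J - ∑ J, ep S J * a J - Mr ≤ ∑ J, ep S J * f S J)
    (hι : (Fintype.card ι : ℤ) ≤ r ^ 2) : ∑ J, a J - Mr ≤ 4 * L * r := by
  set D := ∑ J, a J - Mr with hD
  by_contra hlt
  push Not at hlt
  have h0 : ∀ S, 0 ≤ h S := fun S => by rcases h01 S with e | e <;> simp [e]
  set H := ∑ S, h S with hH
  set Y : Finset ι → ℤ := fun S => ∑ J, ep S J * (L + a J) with hY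
  have e1 : D * H ≤ ∑ S, h S * Y S := by
    have i1 := influence h0 ha hf hL
    have i2 : ∑ S, h S * (D - ∑ J, ep S J * a J) ≤ ∑ S, h S * ∑ J, ep S J * f S J := by
      apply sum_le_sum
      intro S _
      rcases h01 S with e | e
      · simp [e]
      · rw [e]; have := key S e; linarith
    have i3 : ∀ S, h S * Y S = h S * (∑ J, ep S J * L) + h S * ∑ J, ep S J * a J := by
      intro S
      rw [hY, ← mul_add, ← sum_add_distrib]
      congr 1
      apply sum_congr rfl; intro J _; ring
    simp only [i3, sum_add_distrib]
    simp only [mul_sub, sum_sub_distrib, ← sum_mul] at i2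
    rw [← hH] at i2
    linarith
  set th := 2 * L * r with hth
  have hth0 : 0 < th := by positivity
  have e2 : 2 * th * ∑ S, h S * Y S ≤ 2 ^ Fintype.card ι * (2 * th ^ 2) := by
    have j1 : ∀ S, 2 * th * (h S * Y S) ≤ Y S ^ 2 + th ^ 2 := by
      intro S
      rcases h01 S with e | e
      · rw [e]; nlinarith [sq_nonneg (Y S), sq_nonneg th]
      · rw [e]; nlinarith [sq_nonneg (Y S - th)]
    rw [mul_sum]
    refine (sum_le_sum fun S _ => j1 S).trans ?_
    rw [sum_add_distrib, variance]
    have j2 : ∑ J, (L + a J) ^ 2 ≤ (Fintype.card ι : ℤ) * (4 * L ^ 2) := by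
      have : ∀ J ∈ (univ : Finset ι), (L + a J) ^ 2 ≤ 4 * L ^ 2 := by
        intro J _
        have := a0 J; have := aL J
        nlinarith
      refine (sum_le_card_nsmul _ _ _ this).trans ?_
      simp
    have j3 : (Fintype.card ι : ℤ) * (4 * L ^ 2) ≤ th ^ 2 := by
      rw [hth]; nlinarith [sq_nonneg L]
    have j4 : ∑ S : Finset ι, th ^ 2 = 2 ^ Fintype.card ι * th ^ 2 := by
      simp
    rw [j4]
    have : (0:ℤ) ≤ 2 ^ Fintype.card ι := by positivity
    nlinarith
  have e3 : (2:ℤ) ^ Fintype.card ι ≤ 2 * H := by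
    have k1 : ∑ S : Finset ι, (1:ℤ) ≤ ∑ S, (h S + h Sᶜ) := sum_le_sum fun S _ => hc S
    rw [sum_add_distrib] at k1
    have k2 : ∑ S : Finset ι, h Sᶜ = ∑ S, h S :=
      Function.Bijective.sum_comp (compl_bijective) h
    rw [k2] at k1
    have k3 : ∑ S : Finset ι, (1:ℤ) = 2 ^ Fintype.card ι := by simp
    rw [← k3]; linarith
  have hP : (0:ℤ) < 2 ^ Fintype.card ι := by positivity
  have hD0 : 2 * th < D := by rw [hth]; linarith
  have f1 : 2 * th * (D * H) ≤ 2 ^ Fintype.card ι * (2 * th ^ 2) :=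
    le_trans (mul_le_mul_of_nonneg_left e1 (by linarith)) e2
  have f2 : th * D * 2 ^ Fintype.card ι ≤ th * D * (2 * H) :=
    mul_le_mul_of_nonneg_left e3 (by nlinarith)
  have f3 : 2 ^ Fintype.card ι * (th * D) ≤ 2 ^ Fintype.card ι * (2 * th ^ 2) := by nlinarith
  have f4 := le_of_mul_le_mul_left f3 hP
  nlinarith
end color

end
end HE

namespace HE
noncomputable section
open scoped Classical
open Finset

variable {α : Type*} [Fintype α]

theorem quot_index.{w} {β : Type w} (b : α → β) : ∃ (ι : Type w) (_ : Fintype ι) (bb : α → ι) (π : ι → β),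
    (∀ x, π (bb x) = b x) ∧ (∀ x y, b x = b y → bb x = bb y) ∧ Fintype.card ι ≤ Fintype.card α :=
  ⟨{J // J ∈ univ.image b}, Finset.Subtype.fintype (univ.image b), fun x => ⟨b x, mem_image_of_mem _ (mem_univ _)⟩, Subtype.val,
    fun _ => rfl, fun _ _ h => Subtype.ext h, by
      rw [Fintype.card_coe]
      exact card_image_le.trans (by simp)⟩

set_option maxHeartbeats 1000000 in
theorem few_ends {G F : SimpleGraph α} {m l lam r : ℕ} (hX : ∀ U : Finset α, U.card < m → 8 * U.card ≤ (nb G U univ).card)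
    (hJ : Joined G m) (hF : Good G l F)
    (hmax : ∀ F', Good G l F' → ∑ x, F'.degree x ≤ ∑ x, F.degree x) (hl : 1 ≤ l) (hlam : l + 2 ≤ lam)
    (hr1 : 1 ≤ r) (hr : Fintype.card α ≤ r ^ 2) :
    ∃ M, lam * M ≤ (l + 2) * Fintype.card α ∧
      (univ.filter fun u => F.degree u ≤ 1).card ≤ 2 * M + 8 * lam * r := by
  obtain ⟨d, hd1, hd2⟩ := layers hF.deg
  obtain ⟨t, ht⟩ := shift_exists d lam (l + 2) (by omega)
  set Mar := univ.filter fun x => (d x + t) % lam < l + 2 with hMar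
  refine ⟨Mar.card, ht, ?_⟩
  set b : α → F.ConnectedComponent × ℕ := fun x => (F.connectedComponentMk x, (d x + t) / lam) with hb
  obtain ⟨ι, _, bb, π, hπ, hbb, hcι⟩ := quot_index b
  let Z : Finset ι → Finset α := fun S => univ.filter fun x => x ∉ Mar ∧ bb x ∈ S
  let X : Finset ι → Finset α := fun S => XZ G F l (Z S)
  let zone : ι → Finset α := fun J => univ.filter fun x => x ∉ Mar ∧ bb x = J
  have hZmono : ∀ S T, S ⊆ T → Z S ⊆ Z T := by
    intro S T hST x; simp only [Z, mem_filter, mem_univ, true_and]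
    rintro ⟨h1, h2⟩; exact ⟨h1, hST h2⟩
  have hXmono : ∀ S T, S ⊆ T → X S ⊆ X T := fun S T h => XZ_mono (hZmono S T h)
  have hzone : ∀ J, (zone J).card ≤ 2 * lam := by
    intro J
    have hsub : zone J ⊆ (range lam).biUnion fun i =>
        univ.filter fun x => F.connectedComponentMk x = (π J).1 ∧ d x = lam * (π J).2 + i - t := by
      intro x
      simp only [zone, mem_filter, mem_univ, true_and, mem_biUnion, mem_range]
      rintro ⟨h1, rfl⟩
      refine ⟨(d x + t) % lam, Nat.mod_lt _ (by omega), by rw [hπ], ?_⟩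
      have := Nat.div_add_mod (d x + t) lam
      simp only [hπ, hb]
      omega
    refine (card_le_card hsub).trans ((card_biUnion_le_card_mul _ _ 2 fun i _ => hd2 _ _).trans ?_)
    rw [card_range]; omega
  -- far zones
  have hfar0 : ∀ S, ∀ x ∈ Z S, ∀ y ∈ Z Sᶜ, F.connectedComponentMk x = F.connectedComponentMk y →
      d x + l + 2 < d y ∨ d y + l + 2 < d x := by
    intro S x hx y hy hxy
    simp only [Z, mem_filter, mem_univ, true_and, hMar, not_lt, mem_compl] at hx hy
    have hne : (d x + t) / lam ≠ (d y + t) / lam := by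
      intro h
      apply hy.2
      have : bb y = bb x := by
        apply hbb
        simp only [hb, h, hxy]
      rw [this]; exact hx.2
    have e1 := Nat.div_add_mod (d x + t) lam
    have e2 := Nat.div_add_mod (d y + t) lam
    have m1 := Nat.mod_lt (d x + t) (show lam > 0 by omega)
    have m2 := Nat.mod_lt (d y + t) (show lam > 0 by omega)
    rcases Nat.lt_or_gt_of_ne hne with h | h
    · have := Nat.mul_le_mul_left lam (Nat.succ_le_of_lt h)
      rw [Nat.mul_succ] at this
      omega
    · have := Nat.mul_le_mul_left lam (Nat.succ_le_of_lt h)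
      rw [Nat.mul_succ] at this
      omega
  have hZp : ∀ S, ∀ x ∈ Zp F (Z S), ∃ a ∈ Z S, F.connectedComponentMk a = F.connectedComponentMk x ∧
      d a ≤ d x + 1 ∧ d x ≤ d a + 1 := by
    intro S x hx
    rw [Zp, mem_union, mem_nb] at hx
    rcases hx with hx | ⟨_, a, ha, hax⟩
    · exact ⟨x, hx, rfl, by omega, by omega⟩
    · exact ⟨a, ha, (hd1 a x hax).1, (hd1 a x hax).2, (hd1 x a hax.symm).2⟩
  have hfar : ∀ S, ∀ x ∈ Zp F (Z S), ∀ y ∈ Zp F (Z Sᶜ),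
      F.connectedComponentMk x = F.connectedComponentMk y → d x + l < d y ∨ d y + l < d x := by
    intro S x hx y hy hxy
    obtain ⟨a, ha, h1, h2, h3⟩ := hZp S x hx
    obtain ⟨c, hc, g1, g2, g3⟩ := hZp Sᶜ y hy
    have := hfar0 S a ha c hc (by rw [h1, hxy, g1])
    omega
  have hnot : ∀ S, (X S).card < m ∨ (X Sᶜ).card < m := by
    intro S
    by_contra hcon
    push Not at hcon
    have hsub : ∀ S, X S ⊆ Zp F (Z S) := by
      intro S x hx
      simp only [X, XZ, mem_filter, mem_univ, true_and] at hx
      obtain ⟨F', u, h⟩ := hx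
      exact (reach_inv hF h).rZ
    have hdis : Disjoint (X S) (X Sᶜ) := by
      rw [Finset.disjoint_left]
      intro x h1 h2
      have := hfar S x (hsub _ h1) x (hsub _ h2) rfl
      omega
    obtain ⟨u', hu', v', hv', huv⟩ := hJ _ _ hdis hcon.1 hcon.2
    simp only [X, XZ, mem_filter, mem_univ, true_and] at hu' hv'
    obtain ⟨F1, u, h1⟩ := hu'
    obtain ⟨F2, v, h2⟩ := hv'
    obtain ⟨F', g1, g2⟩ := combine hF F.connectedComponentMk d hd1 (hfar S)
      (reach_inv hF h1) (reach_inv hF h2) huv hl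
    have := hmax F' g1
    omega
  set E := univ.filter fun u => F.degree u ≤ 1 with hE
  -- sums over zones
  have hsumz : ∀ (A : Finset α) (s : Finset ι),
      ∑ J ∈ s, (A ∩ zone J).card = (A ∩ Z s).card := by
    intro A s
    rw [← card_biUnion]
    · congr 1
      ext x
      simp only [mem_biUnion, mem_inter, zone, Z, mem_filter, mem_univ, true_and]
      constructor
      · rintro ⟨J, hJ, h1, h2, rfl⟩; exact ⟨h1, h2, hJ⟩
      · rintro ⟨h1, h2, h3⟩; exact ⟨_, h3, h1, h2, rfl⟩
    · intro J _ J' _ hJJ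
      rw [Function.onFun, Finset.disjoint_left]
      intro x
      simp only [zone, mem_inter, mem_filter, mem_univ, true_and]
      rintro ⟨_, _, h1⟩ ⟨_, _, h2⟩
      exact hJJ (h1.symm.trans h2)
  have hep : ∀ (S : Finset ι) (w : ι → ℤ), ∑ J, ep S J * w J = ∑ J ∈ Sᶜ, w J - ∑ J ∈ S, w J := by
    intro S w
    rw [← sum_add_sum_compl S, sub_eq_add_neg, ← sum_neg_distrib, add_comm]
    congr 1
    · apply sum_congr rfl; intro J hJ; rw [mem_compl] at hJ; simp [ep, hJ]
    · apply sum_congr rfl; intro J hJ; simp [ep, hJ]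
  have hmain := color (ι := ι) (2 * lam : ℕ) r Mar.card (by push_cast; omega) (by exact_mod_cast hr1)
    (h := fun S => if (X S).card < m then 1 else 0)
    (by intro S; by_cases h : (X S).card < m <;> simp [h])
    (by
      intro S T hST
      have := card_le_card (hXmono S T hST)
      by_cases h : (X T).card < m
      · have h' : (X S).card < m := by omega
        simp [h, h']
      · by_cases h' : (X S).card < m <;> simp [h, h'])
    (by
      intro S
      rcases hnot S with h | h
      · simp only [h, if_true]; split_ifs <;> simp
      · simp only [h, if_true]; split_ifs <;> simp)
    (f := fun S J => ((nb G (X S) univ ∩ zone J).card : ℤ))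
    (by
      intro S T hST J
      have : nb G (X S) univ ∩ zone J ⊆ nb G (X T) univ ∩ zone J :=
        inter_subset_inter (nb_mono (hXmono S T hST)) (Subset.refl _)
      exact_mod_cast card_le_card this)
    (by
      intro S J
      exact_mod_cast (card_le_card inter_subset_right).trans (hzone J))
    (fun J => ((E ∩ zone J).card : ℤ)) (by intro J; positivity)
    (by intro J; exact_mod_cast (card_le_card inter_subset_right).trans (hzone J))
    (by
      intro S hS
      have hlt : (X S).card < m := by
        by_contra hcon
        simp [hcon] at hS
      rw [hep, hep]
      have s1 : ∑ J, ((E ∩ zone J).card : ℤ) =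
          ∑ J ∈ S, ((E ∩ zone J).card : ℤ) + ∑ J ∈ Sᶜ, ((E ∩ zone J).card : ℤ) :=
        (sum_add_sum_compl S _).symm
      rw [s1]
      have s2 := hsumz E S
      have s3 := hsumz (nb G (X S) univ) S
      have s4 := hsumz (nb G (X S) univ) Sᶜ
      have s5 : (E ∩ Z S).card ≤ (X S).card := by
        apply card_le_card
        intro x hx
        rw [mem_inter] at hx
        apply sub_XZ
        rw [mem_filter]
        exact ⟨hx.2, by simpa [hE] using hx.1⟩
      have s6 : (nb G (X S) univ ∩ Z S).card ≤ 3 * (X S).card := by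
        refine le_trans (card_le_card ?_) (reach_count (Z := Z S) hF)
        intro x
        rw [mem_inter, mem_nb, mem_nb]
        rintro ⟨⟨_, h⟩, h2⟩; exact ⟨h2, h⟩
      have s7 := hX (X S) hlt
      have s8 : (nb G (X S) univ).card ≤ (nb G (X S) univ ∩ Z S).card +
          (nb G (X S) univ ∩ Z Sᶜ).card + Mar.card := by
        have : nb G (X S) univ ⊆ ((nb G (X S) univ ∩ Z S) ∪ (nb G (X S) univ ∩ Z Sᶜ)) ∪ Mar := by
          intro x hx
          simp only [mem_union, mem_inter, Z, mem_filter, mem_univ, true_and, mem_compl]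
          tauto
        refine (card_le_card this).trans ((card_union_le _ _).trans ?_)
        have := card_union_le (nb G (X S) univ ∩ Z S) (nb G (X S) univ ∩ Z Sᶜ)
        omega
      rw [← s3, ← s4] at s8
      rw [← s3] at s6
      rw [← s2] at s5
      zify at s5 s6 s7 s8
      linarith)
    (by
      exact_mod_cast hcι.trans hr)
  have hEs := hsumz E univ
  have hEc : E.card ≤ (E ∩ Z univ).card + Mar.card := by
    have : E ⊆ (E ∩ Z univ) ∪ Mar := by
      intro x hx
      simp only [mem_union, mem_inter, Z, mem_filter, mem_univ, true_and, and_true]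
      tauto
    exact (card_le_card this).trans (card_union_le _ _)
  rw [← hEs] at hEc
  zify at hEc ⊢
  push_cast at hmain
  linarith

end
end HE

namespace HE
noncomputable section
open scoped Classical
open Finset

variable {α : Type*} [Fintype α]

theorem max_path {F : SimpleGraph α} (S : Finset α) (hS : S.Nonempty) :
    ∃ p : List α, p ≠ [] ∧ p.IsChain F.Adj ∧ p.Nodup ∧ (∀ x ∈ p, x ∈ S) ∧
      ∀ q : List α, q.IsChain F.Adj → q.Nodup → (∀ x ∈ q, x ∈ S) → q.length ≤ p.length := by
  obtain ⟨v, hv⟩ := hS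
  let P : ℕ → Prop := fun k => ∃ p : List α, p ≠ [] ∧ p.IsChain F.Adj ∧ p.Nodup ∧ (∀ x ∈ p, x ∈ S) ∧ p.length = k
  have hP1 : P 1 := ⟨[v], by simp, by simp, by simp, by simpa using hv, rfl⟩
  have hb : ∀ k, P k → k ≤ Fintype.card α := by
    rintro k ⟨p, _, _, h, _, rfl⟩
    exact h.length_le_card
  have h1 := hb 1 hP1
  obtain ⟨p, a, b, c, d, e⟩ := Nat.findGreatest_spec (P := P) h1 hP1
  refine ⟨p, a, b, c, d, fun q q1 q2 q3 => ?_⟩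
  by_cases hq : q = []
  · simp [hq]
  · rw [e]
    exact Nat.le_findGreatest (hb _ ⟨q, hq, q1, q2, q3, rfl⟩) ⟨q, hq, q1, q2, q3, rfl⟩

theorem isChain_symm_reverse {F : SimpleGraph α} {p : List α} (h : p.IsChain F.Adj) : p.reverse.IsChain F.Adj := by
  rw [List.isChain_reverse]
  exact h.imp fun a b h => h.symm

theorem max_path_head {F : SimpleGraph α} {S : Finset α} (hcl : ∀ x ∈ S, ∀ y, F.Adj x y → y ∈ S)
    {x : α} {q : List α} (hc : (x :: q).IsChain F.Adj) (hn : (x :: q).Nodup) (hs : ∀ y ∈ x :: q, y ∈ S)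
    (hmax : ∀ q' : List α, q'.IsChain F.Adj → q'.Nodup → (∀ x ∈ q', x ∈ S) → q'.length ≤ (x :: q).length)
    {y : α} (hxy : F.Adj x y) : y ∈ x :: q := by
  by_contra hy
  have := hmax (y :: x :: q) (List.isChain_cons_cons.2 ⟨hxy.symm, hc⟩) (List.nodup_cons.2 ⟨hy, hn⟩) (by
    intro z hz
    rcases List.mem_cons.1 hz with rfl | hz
    · exact hcl x (hs x (by simp)) _ hxy
    · exact hs z hz)
  simp at this

theorem max_path_closed {F : SimpleGraph α} (hd : ∀ v, F.degree v ≤ 2) {S : Finset α}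
    (hcl : ∀ x ∈ S, ∀ y, F.Adj x y → y ∈ S)
    {p : List α} (hc : p.IsChain F.Adj) (hn : p.Nodup) (hs : ∀ y ∈ p, y ∈ S)
    (hmax : ∀ q' : List α, q'.IsChain F.Adj → q'.Nodup → (∀ x ∈ q', x ∈ S) → q'.length ≤ p.length)
    {x y : α} (hx : x ∈ p) (hxy : F.Adj x y) : y ∈ p := by
  obtain ⟨A, B, rfl⟩ := List.append_of_mem hx
  rcases A.eq_nil_or_concat with rfl | ⟨A, a, rfl⟩
  · exact max_path_head hcl (by simpa using hc) (by simpa using hn) (by simpa using hs) (by simpa using hmax) hxy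
  rcases B with _ | ⟨b, B⟩
  · have := max_path_head (x := x) (q := (A ++ [a]).reverse) hcl (by simpa using isChain_symm_reverse hc)
      (by simpa using List.nodup_reverse.2 hn) (by intro y hy; apply hs; simpa [or_comm, or_assoc, or_left_comm] using hy)
      (by intro q' h1 h2 h3; simpa using hmax q' h1 h2 h3) hxy
    simpa [or_comm, or_assoc, or_left_comm] using this
  · have hax : F.Adj a x := by
      have := hc
      simp [List.isChain_append] at this
      tauto
    have hxb : F.Adj x b := by
      have := hc
      simp [List.isChain_append] at this
      tauto
    have hab : a ≠ b := by
      rintro rfl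
      simp [List.nodup_append] at hn
    have : F.neighborFinset x = {a, b} := by
      symm
      apply eq_of_subset_of_card_le
      · intro z hz
        simp only [mem_insert, mem_singleton] at hz
        rw [SimpleGraph.mem_neighborFinset]
        rcases hz with rfl | rfl
        · exact hax.symm
        · exact hxb
      · rw [card_pair hab]; exact hd x
    have hy : y ∈ F.neighborFinset x := by rwa [SimpleGraph.mem_neighborFinset]
    rw [this] at hy
    simp only [mem_insert, mem_singleton] at hy
    rcases hy with rfl | rfl <;> simp

theorem cycle_long {F : SimpleGraph α} {l : ℕ} (hcyc : ∀ (v : α) (c : F.Walk v v), c.IsCycle → l ≤ c.length)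
    {x b y : α} {C : List α} (hc : (x :: b :: (C ++ [y])).IsChain F.Adj) (hn : (x :: b :: (C ++ [y])).Nodup)
    (hxy : F.Adj x y) : l ≤ C.length + 3 := by
  have hc' := hc.of_cons
  let w0 := SimpleGraph.Walk.ofSupport (b :: (C ++ [y])) (by simp) hc'
  have hlast : (b :: (C ++ [y])).getLast (by simp) = y := by simp
  let w : F.Walk b y := w0.copy rfl hlast
  have hw : w.support = b :: (C ++ [y]) := by
    exact (SimpleGraph.Walk.support_copy _ _ _).trans (SimpleGraph.Walk.support_ofSupport _ _)
  have hxb : F.Adj x b := (List.isChain_cons_cons.1 hc).1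
  let p : F.Walk x y := SimpleGraph.Walk.cons hxb w
  have hp : p.support = x :: b :: (C ++ [y]) := by simp [p, hw]
  have hcy : (SimpleGraph.Walk.cons hxy.symm p).IsCycle := by
    rw [SimpleGraph.Walk.cons_isCycle_iff]
    refine ⟨by rw [SimpleGraph.Walk.isPath_def, hp]; exact hn, ?_⟩
    intro h
    rw [SimpleGraph.Walk.edges_cons, List.mem_cons] at h
    rcases h with h | h
    · rw [Sym2.eq_iff] at h
      rcases h with ⟨h, _⟩ | ⟨h, _⟩
      · exact hxy.ne h.symm
      · subst h; simp at hn
    · have := SimpleGraph.Walk.snd_mem_support_of_mem_edges _ h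
      rw [hw] at this
      exact (List.nodup_cons.1 hn).1 this
  have h1 := hcyc _ _ hcy
  have h2 : p.support.length = p.length + 1 := SimpleGraph.Walk.length_support _
  rw [hp] at h2
  simp at h1 h2
  omega

theorem path_count {F : SimpleGraph α} {l : ℕ} (hd : ∀ v, F.degree v ≤ 2)
    (hcyc : ∀ (v : α) (c : F.Walk v v), c.IsCycle → l ≤ c.length)
    {p : List α} (hne : p ≠ []) (hc : p.IsChain F.Adj) (hn : p.Nodup)
    (hcl : ∀ x ∈ p, ∀ y, F.Adj x y → y ∈ p) : (∃ x ∈ p, F.degree x ≤ 1) ∨ l ≤ p.length := by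
  by_contra hcon
  push Not at hcon
  obtain ⟨h1, h2⟩ := hcon
  rcases p with _ | ⟨x, q⟩
  · exact hne rfl
  have hdx := h1 x (by simp)
  rw [← SimpleGraph.card_neighborFinset_eq_degree] at hdx
  rcases q with _ | ⟨b, q⟩
  · obtain ⟨y, hy⟩ := Finset.card_pos.1 (by omega : 0 < (F.neighborFinset x).card)
    rw [SimpleGraph.mem_neighborFinset] at hy
    have := hcl x (by simp) y hy
    simp at this
    exact hy.ne this.symm
  · obtain ⟨y, hy, hyb⟩ := Finset.exists_mem_ne hdx b
    rw [SimpleGraph.mem_neighborFinset] at hy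
    have := hcl x (by simp) y hy
    simp only [List.mem_cons] at this
    rcases this with h | h | h
    · exact hy.ne h.symm
    · exact hyb h
    · obtain ⟨C, D, rfl⟩ := List.append_of_mem h
      have e : x :: b :: (C ++ y :: D) = (x :: b :: (C ++ [y])) ++ D := by simp
      rw [e] at hc hn
      have := cycle_long hcyc hc.left_of_append (List.Nodup.of_append_left hn) hy
      simp at h2
      omega

theorem cover_aux {F : SimpleGraph α} {l : ℕ} (hd : ∀ v, F.degree v ≤ 2)
    (hcyc : ∀ (v : α) (c : F.Walk v v), c.IsCycle → l ≤ c.length) : ∀ (k : ℕ) (S : Finset α), S.card = k →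
    (∀ x ∈ S, ∀ y, F.Adj x y → y ∈ S) →
    ∃ L : List (List α), (∀ p ∈ L, p ≠ [] ∧ p.IsChain F.Adj) ∧ L.flatten.Nodup ∧
      (∀ x, x ∈ L.flatten ↔ x ∈ S) ∧
      l * L.length ≤ l * (S.filter fun u => F.degree u ≤ 1).card + S.card := by
  intro k
  induction k using Nat.strong_induction_on with
  | _ k ih =>
  intro S hk hcl
  rcases S.eq_empty_or_nonempty with rfl | hS
  · exact ⟨[], by simp, by simp, by simp, by simp⟩
  obtain ⟨p, p1, p2, p3, p4, p5⟩ := max_path (F := F) S hS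
  have hpc : ∀ x ∈ p, ∀ y, F.Adj x y → y ∈ p := fun x hx y hxy => max_path_closed hd hcl p2 p3 p4 p5 hx hxy
  have hsub : p.toFinset ⊆ S := fun x hx => p4 x (List.mem_toFinset.1 hx)
  have hcard : p.toFinset.card = p.length := List.toFinset_card_of_nodup p3
  have hpos : 0 < p.length := List.length_pos_iff.2 p1
  have hsd := card_sdiff_add_card_eq_card hsub
  obtain ⟨L, l1, l2, l3, l4⟩ := ih (S \ p.toFinset).card (by omega) (S \ p.toFinset) rfl (by
    intro x hx y hxy
    simp only [mem_sdiff, List.mem_toFinset] at hx ⊢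
    exact ⟨hcl x hx.1 y hxy, fun h => hx.2 (hpc y h x hxy.symm)⟩)
  refine ⟨p :: L, ?_, ?_, ?_, ?_⟩
  · intro q hq
    rcases List.mem_cons.1 hq with rfl | hq
    · exact ⟨p1, p2⟩
    · exact l1 q hq
  · rw [List.flatten_cons, List.nodup_append']
    refine ⟨p3, l2, ?_⟩
    intro x hx hx'
    rw [l3] at hx'
    simp [hx] at hx'
  · intro x
    rw [List.flatten_cons, List.mem_append, l3, mem_sdiff, List.mem_toFinset]
    have := p4 x
    tauto
  · have hfs : ((S \ p.toFinset).filter fun u => F.degree u ≤ 1).card +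
        (p.toFinset.filter fun u => F.degree u ≤ 1).card = (S.filter fun u => F.degree u ≤ 1).card := by
      rw [← card_union_of_disjoint, ← filter_union, sdiff_union_of_subset hsub]
      exact disjoint_filter_filter sdiff_disjoint
    rw [List.length_cons, Nat.mul_succ, ← hfs, ← hsd, Nat.mul_add]
    rcases path_count hd hcyc p1 p2 p3 hpc with ⟨x, hx, hx1⟩ | h
    · have : 1 ≤ (p.toFinset.filter fun u => F.degree u ≤ 1).card :=
        card_pos.2 ⟨x, by simp [hx, hx1]⟩
      have := Nat.mul_le_mul_left l this
      omega
    · omega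

theorem exists_max_good (G : SimpleGraph α) (l : ℕ) : ∃ F, Good G l F ∧
    ∀ F', Good G l F' → ∑ x, F'.degree x ≤ ∑ x, F.degree x := by
  have hbot : Good G l (⊥ : SimpleGraph α) := by
    refine ⟨bot_le, fun v => by simp, fun v c hc => ?_⟩
    exfalso
    cases c with
    | nil => exact hc.ne_nil rfl
    | cons h _ => exact h
  obtain ⟨F, h1, h2⟩ := Set.Finite.exists_maximalFor (fun F : SimpleGraph α => ∑ x, F.degree x)
    {F | Good G l F} (Set.toFinite _) ⟨_, hbot⟩
  refine ⟨F, h1, fun F' h' => ?_⟩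
  by_contra hcon
  push Not at hcon
  exact absurd (h2 h' hcon.le) (by simpa using hcon)

theorem cover {G : SimpleGraph α} {m l lam r : ℕ} (hX : ∀ U : Finset α, U.card < m → 8 * U.card ≤ (nb G U univ).card)
    (hJ : Joined G m) (hl : 1 ≤ l) (hlam : l + 2 ≤ lam)
    (hr1 : 1 ≤ r) (hr : Fintype.card α ≤ r ^ 2) :
    ∃ (L : List (List α)) (M : ℕ), (∀ p ∈ L, p ≠ [] ∧ p.IsChain G.Adj) ∧ L.flatten.Nodup ∧
      (∀ x, x ∈ L.flatten) ∧ lam * M ≤ (l + 2) * Fintype.card α ∧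
      l * L.length ≤ l * (2 * M + 8 * lam * r) + Fintype.card α := by
  obtain ⟨F, hF, hmax⟩ := exists_max_good G l
  obtain ⟨M, hM1, hM2⟩ := few_ends hX hJ hF hmax hl hlam hr1 hr
  obtain ⟨L, h1, h2, h3, h4⟩ := cover_aux hF.deg hF.cyc _ univ rfl (by simp)
  refine ⟨L, M, fun p hp => ⟨(h1 p hp).1, (h1 p hp).2.imp fun a b h => hF.le h⟩, h2,
    fun x => (h3 x).2 (mem_univ _), hM1, ?_⟩
  have := Nat.mul_le_mul_left l hM2
  rw [card_univ] at h4
  omega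

end
end HE

namespace HE
noncomputable section
open scoped Classical
open Finset

variable {V : Type*} [Fintype V]

theorem split_one (R : V → V → Prop) (L : List (List V)) (h : ∀ p ∈ L, p ≠ [] ∧ p.IsChain R)
    (hlt : L.length < L.flatten.length) : ∃ L' : List (List V), (∀ p ∈ L', p ≠ [] ∧ p.IsChain R) ∧
      L'.flatten = L.flatten ∧ L'.length = L.length + 1 := by
  induction L with
  | nil => simp at hlt
  | cons p L ih =>
    rcases p with _ | ⟨x, _ | ⟨y, q⟩⟩
    · exact absurd rfl (h [] (by simp)).1
    · obtain ⟨L', h1, h2, h3⟩ := ih (fun p hp => h p (by simp [hp])) (by simpa using hlt)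
      refine ⟨[x] :: L', ?_, by simp [h2], by simp [h3]⟩
      intro p hp
      rcases List.mem_cons.1 hp with rfl | hp
      · simp
      · exact h1 p hp
    · refine ⟨[x] :: (y :: q) :: L, ?_, by simp, by simp⟩
      intro p hp
      have := (h (x :: y :: q) (by simp)).2
      simp only [List.mem_cons] at hp
      rcases hp with rfl | rfl | hp
      · simp
      · exact ⟨by simp, this.of_cons⟩
      · exact h p (by simp [hp])

theorem split_to (R : V → V → Prop) (L : List (List V)) (h : ∀ p ∈ L, p ≠ [] ∧ p.IsChain R) (k : ℕ)
    (h1 : L.length ≤ k) (h2 : k ≤ L.flatten.length) : ∃ L' : List (List V), (∀ p ∈ L', p ≠ [] ∧ p.IsChain R) ∧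
      L'.flatten = L.flatten ∧ L'.length = k := by
  induction k, h1 using Nat.le_induction with
  | base => exact ⟨L, h, rfl, rfl⟩
  | succ k hk ih =>
    obtain ⟨L1, a, b, c⟩ := ih (by omega)
    obtain ⟨L2, a', b', c'⟩ := split_one R L1 a (by rw [b]; omega)
    exact ⟨L2, a', b'.trans b, by omega⟩

theorem cover_set {G : SimpleGraph V} {m T : ℕ} (W : Finset V)
    (hX : ∀ U : Finset V, U ⊆ W → U.card < m → 8 * U.card ≤ (nb G U W).card)
    (hJ : Joined G m) (hT : 2 ≤ T) (hn : W.card ≤ T ^ 12) (k : ℕ) (hk : 15 * T ^ 10 ≤ k) (hkW : k ≤ W.card) :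
    ∃ L : List (List V), (∀ p ∈ L, p ≠ [] ∧ p.IsChain G.Adj) ∧ L.flatten.Nodup ∧
      (∀ x, x ∈ L.flatten ↔ x ∈ W) ∧ L.length = k := by
  have hTT : 2 * 2 ≤ T * T := Nat.mul_le_mul hT hT
  have hT2 : T ^ 2 + 2 ≤ T ^ 4 := by
    have : T ^ 4 = (T * T) * (T * T) := by ring
    have h2 : T ^ 2 = T * T := by ring
    rw [this, h2]
    nlinarith
  let W' := {x // x ∈ W}
  let G' : SimpleGraph {x // x ∈ W} := G.comap Subtype.val
  have hcardW : Fintype.card {x // x ∈ W} = W.card := Fintype.card_coe W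
  let mp : Finset {x // x ∈ W} → Finset V := fun U => U.map (Function.Embedding.subtype _)
  have hmp : ∀ U, mp U ⊆ W := by
    intro U x hx
    simp only [mp, mem_map, Function.Embedding.subtype_apply] at hx
    obtain ⟨y, _, rfl⟩ := hx
    exact y.2
  have hmem : ∀ U x, x ∈ mp U ↔ ∃ h : x ∈ W, (⟨x, h⟩ : {x // x ∈ W}) ∈ U := by
    intro U x
    simp [mp]
  obtain ⟨L, M, h1, h2, h3, h4, h5⟩ := cover (G := G') (m := m) (l := T ^ 2) (lam := T ^ 4) (r := T ^ 6) (by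
      intro U hU
      have := hX (mp U) (hmp U) (by simpa [mp] using hU)
      rw [show (mp U).card = U.card by simp [mp]] at this
      refine this.trans ?_
      have e : nb G (mp U) W ⊆ mp (nb G' U univ) := by
        intro x hx
        rw [mem_nb] at hx
        obtain ⟨hxW, u, hu, hux⟩ := hx
        rw [hmem] at hu ⊢
        obtain ⟨huW, hu⟩ := hu
        exact ⟨hxW, by rw [mem_nb]; exact ⟨mem_univ _, _, hu, hux⟩⟩
      refine (card_le_card e).trans ?_
      simp [mp])
    (by
      intro U U' hd hU hU'
      obtain ⟨u, hu, w, hw, huw⟩ := hJ (mp U) (mp U') (by simpa [mp] using hd) (by simpa [mp] using hU)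
        (by simpa [mp] using hU')
      rw [hmem] at hu hw
      obtain ⟨a, ha⟩ := hu
      obtain ⟨b, hb⟩ := hw
      exact ⟨_, ha, _, hb, huw⟩)
    (Nat.one_le_iff_ne_zero.2 (by positivity)) hT2 (Nat.one_le_iff_ne_zero.2 (by positivity))
    (by rw [hcardW, ← pow_mul]; exact hn)
  rw [hcardW] at h4 h5
  have hM : M ≤ 3 * T ^ 10 := by
    have a1 : T ^ 4 * M ≤ T ^ 4 * (3 * T ^ 10) := by
      refine h4.trans ((Nat.mul_le_mul_left _ hn).trans ?_)
      have : T ^ 2 + 2 ≤ 3 * T ^ 2 := by nlinarith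
      calc (T ^ 2 + 2) * T ^ 12 ≤ (3 * T ^ 2) * T ^ 12 := Nat.mul_le_mul_right _ this
        _ = _ := by ring
    exact Nat.le_of_mul_le_mul_left a1 (by positivity)
  have hlen : L.length ≤ 15 * T ^ 10 := by
    have : T ^ 2 * L.length ≤ T ^ 2 * (15 * T ^ 10) := by
      refine h5.trans ?_
      have b1 : T ^ 2 * (2 * M + 8 * T ^ 4 * T ^ 6) ≤ T ^ 2 * (14 * T ^ 10) := by
        apply Nat.mul_le_mul_left
        have : 8 * T ^ 4 * T ^ 6 = 8 * T ^ 10 := by ring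
        omega
      have b2 : T ^ 2 * (15 * T ^ 10) = T ^ 2 * (14 * T ^ 10) + T ^ 12 := by ring
      omega
    exact Nat.le_of_mul_le_mul_left this (by positivity)
  let L1 : List (List V) := L.map (List.map Subtype.val)
  have hfl : L1.flatten = L.flatten.map Subtype.val := by simp [L1, List.map_flatten]
  have hnd : L1.flatten.Nodup := by
    rw [hfl]; exact h2.map Subtype.val_injective
  have hcov : ∀ x, x ∈ L1.flatten ↔ x ∈ W := by
    intro x
    rw [hfl, List.mem_map]
    constructor
    · rintro ⟨y, _, rfl⟩; exact y.2
    · intro hx; exact ⟨⟨x, hx⟩, h3 _, rfl⟩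
  have hfc : L1.flatten.length = W.card := by
    rw [← List.toFinset_card_of_nodup hnd]
    congr 1
    ext x; rw [List.mem_toFinset, hcov]
  obtain ⟨L2, c1, c2, c3⟩ := split_to G.Adj L1 (by
    intro p hp
    simp only [L1, List.mem_map] at hp
    obtain ⟨q, hq, rfl⟩ := hp
    refine ⟨fun h => (h1 q hq).1 (List.map_eq_nil_iff.1 h), ?_⟩
    rw [List.isChain_map]
    exact (h1 q hq).2) k (by simp only [L1, List.length_map]; omega) (by omega)
  exact ⟨L2, c1, by rw [c2]; exact hnd, by rw [c2]; exact hcov, c3⟩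

end
end HE

namespace HE
noncomputable section
open scoped Classical
open Finset

variable {V : Type*} [Fintype V]

structure Env (G : SimpleGraph V) (W : Finset V) (K m Tm d B : ℕ) : Prop where
  hm : 1 ≤ m
  hs : ∀ U : Finset V, m < U.card → U.card ≤ 2 * m → K * U.card + Tm < (nb G U W).card
  hJ : Joined G m
  hd : m ≤ 2 ^ d
  hd1 : 1 ≤ d
  hK : 12 ≤ K
  hB : B + 2 ^ (d + 2) ≤ Tm

def Inv (W T : Finset V) (par : V → V) : Prop := ∀ y ∈ T, par y ∈ W → par y ∈ T

theorem grow {G : SimpleGraph V} {W : Finset V} {K m Tm d B : ℕ} (e : Env G W K m Tm d B)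
    {T : Finset V} {par : V → V} (h : Ext G W K (2 * m) T par) (hi : Inv W T par) (a : V)
    (ha : a ∈ W → a ∈ T) (hc : (ch T par a).card + 2 ≤ K) (j : ℕ) (hT : T.card + 2 ^ (j + 1) ≤ Tm) :
    ∃ (T' : Finset V) (par' : V → V) (X : Finset V), T ⊆ T' ∧ (∀ y ∈ T, par' y = par y) ∧ Ext G W K (2 * m) T' par' ∧ Inv W T' par' ∧
      (∀ v, v ≠ a → v ∉ T' \ T → ch T' par' v = ch T par v) ∧
      T'.card + 2 ≤ T.card + 2 ^ (j + 1) ∧ X.card = 2 ^ j ∧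
      ∀ x ∈ X, (ch T' par' x).card + 2 ≤ K ∧ (x ∈ W → x ∈ T') ∧ ∃ l : List V, l.length = j ∧ l.Nodup ∧
        (a :: l).IsChain (fun u v => par' v = u) ∧ (∀ z ∈ l, z ∈ T' \ T) ∧ (a :: l).getLast (by simp) = x := by
  induction j with
  | zero =>
    refine ⟨T, par, {a}, Subset.refl _, fun _ _ => rfl, h, hi, fun _ _ _ => rfl, by simp, by simp, ?_⟩
    intro x hx
    rw [mem_singleton] at hx; subst hx
    exact ⟨hc, ha, [], by simp⟩
  | succ j ih =>
    have hpow : 2 ^ (j + 1 + 1) = 2 * 2 ^ (j + 1) := by ring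
    have hpow' : 2 ^ (j + 1) = 2 * 2 ^ j := by ring
    obtain ⟨T1, par1, X, t1, t2, t3, t4, t5, t6, t7, t8⟩ := ih (by omega)
    obtain ⟨T2, par2, u1, u2, u3, u4, u5, u6⟩ := fill e.hm e.hs 2 X t3 (fun u hu => (t8 u hu).1) (by
      rw [t7]; omega)
    have hinv : Inv W T2 par2 := by
      intro y hy hyW
      by_cases hy1 : y ∈ T1
      · rw [u2 y hy1] at hyW ⊢
        exact u1 (t4 y hy1 hyW)
      · exact u1 ((t8 _ (u4 y (mem_sdiff.2 ⟨hy, hy1⟩))).2.1 hyW)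
    refine ⟨T2, par2, T2 \ T1, t1.trans u1, fun y hy => (u2 y (t1 hy)).trans (t2 y hy), u3, hinv, ?_, ?_, ?_, ?_⟩
    · intro v hva hv
      rw [← t5 v hva (fun hh => hv (sdiff_subset_sdiff u1 (Subset.refl _) hh))]
      apply ch_eq (U := X) u1 u2 u4
      intro hvX
      obtain ⟨l, l1, l2, l3, l4, l5⟩ := (t8 v hvX).2.2
      rcases l.eq_nil_or_concat with rfl | ⟨l', z, rfl⟩
      · simp at l5; exact hva l5.symm
      · have : z = v := by rw [← l5]; simp
        subst this
        have := l4 z (by simp)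
        exact hv (sdiff_subset_sdiff u1 (Subset.refl _) this)
    · rw [u6, t7]; omega
    · rw [card_sdiff_of_subset u1, u6, t7]; omega
    · intro y hy
      have hy' := mem_sdiff.1 hy
      refine ⟨?_, fun _ => hy'.1, ?_⟩
      · have : ch T2 par2 y = ∅ := by
          rw [Finset.eq_empty_iff_forall_notMem]
          intro z hz
          simp only [ch, mem_filter] at hz
          have hyW : y ∈ W := u3.2.1 hy'.1
          apply hy'.2
          by_cases hz1 : z ∈ T1
          · have := t4 z hz1
            rw [← u2 z hz1, hz.2] at this
            exact this hyW
          · have := u4 z (mem_sdiff.2 ⟨hz.1, hz1⟩)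
            rw [hz.2] at this
            exact (t8 _ this).2.1 hyW
        rw [this]; have := e.hK; simp; omega
      · obtain ⟨l, l1, l2, l3, l4, l5⟩ := (t8 _ (u4 y hy)).2.2
        refine ⟨l ++ [y], by simp [l1], ?_, ?_, ?_, ?_⟩
        · rw [List.nodup_append']
          refine ⟨l2, by simp, ?_⟩
          intro z hz hz'
          rw [List.mem_singleton] at hz'
          subst hz'
          exact hy'.2 (mem_sdiff.1 (l4 _ hz)).1
        · rw [← List.cons_append, List.isChain_append]
          refine ⟨?_, by simp, ?_⟩
          · refine l3.imp_of_mem_tail_imp ?_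
            intro u v hu hv huv
            rw [u2 v (mem_sdiff.1 (l4 v (by simpa using hv))).1]
            exact huv
          · intro u hu v hv
            simp only [List.head?_cons, Option.mem_some_iff] at hv
            subst hv
            obtain ⟨hne, rfl⟩ := List.mem_getLast?_eq_getLast hu
            exact l5.symm
        · intro z hz
          rw [List.mem_append, List.mem_singleton] at hz
          rcases hz with hz | rfl
          · exact sdiff_subset_sdiff u1 (Subset.refl _) (l4 z hz)
          · exact sdiff_subset_sdiff (Subset.refl _) t1 hy
        · simp

theorem chain_par {par : V → V} {l : List V} : ∀ {a : V}, (a :: l).IsChain (fun u v => par v = u) →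
    ∀ y ∈ l, par y ∈ a :: l := by
  induction l with
  | nil => simp
  | cons x l ih =>
    intro a h y hy
    rw [List.isChain_cons_cons] at h
    rcases List.mem_cons.1 hy with rfl | hy
    · rw [h.1]; simp
    · exact List.mem_cons_of_mem _ (ih h.2 y hy)

theorem chain_inj {par : V → V} {l : List V} : ∀ {a : V}, (a :: l).IsChain (fun u v => par v = u) →
    (a :: l).Nodup → ∀ y ∈ l, ∀ y' ∈ l, par y = par y' → y = y' := by
  induction l with
  | nil => simp
  | cons x l ih =>
    intro a h hn y hy y' hy' he
    rw [List.isChain_cons_cons] at h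
    rw [List.nodup_cons] at hn
    rcases List.mem_cons.1 hy with rfl | hy1
    · rcases List.mem_cons.1 hy' with rfl | hy'
      · rfl
      · have := chain_par h.2 y' hy'
        rw [← he, h.1] at this
        exact absurd this hn.1
    · rcases List.mem_cons.1 hy' with rfl | hy'
      · have := chain_par h.2 y hy1
        rw [he, h.1] at this
        exact absurd this hn.1
      · exact ih h.2 hn.2 y hy1 y' hy' he

theorem chain_adj {G : SimpleGraph V} {T : Finset V} {par : V → V} (h : ∀ y ∈ T, G.Adj (par y) y) {a : V} {l : List V}
    (hl : ∀ z ∈ l, z ∈ T) (hc : (a :: l).IsChain (fun u v => par v = u)) : (a :: l).IsChain G.Adj := by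
  refine hc.imp_of_mem_tail_imp ?_
  intro u v _ hv huv
  rw [← huv]
  exact h v (hl v (by simpa using hv))

theorem connect0 {G : SimpleGraph V} {W : Finset V} {K m Tm d B : ℕ} (e : Env G W K m Tm d B)
    {T : Finset V} {par : V → V} (h : Ext G W K (2 * m) T par) (hi : Inv W T par) {a b : V} (hab : a ≠ b)
    (ha : a ∈ W → a ∈ T) (hb : b ∈ W → b ∈ T) (hca : (ch T par a).card + 2 ≤ K)
    (hcb : (ch T par b).card + 2 ≤ K) (hT : T.card ≤ B) :
    ∃ (l : List V) (par' : V → V), l.length = 2 * d ∧ l.Nodup ∧ (∀ z ∈ l, z ∈ W ∧ z ∉ T) ∧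
      (a :: l ++ [b]).IsChain G.Adj ∧ Ext G W K (2 * m) (T ∪ l.toFinset) par' ∧
      Inv W (T ∪ l.toFinset) par' ∧
      (∀ v, (ch (T ∪ l.toFinset) par' v).card ≤ (ch T par v).card + 1) ∧
      (∀ v, v ≠ a → v ≠ b → v ∉ l → (ch (T ∪ l.toFinset) par' v).card ≤ (ch T par v).card) := by
  have hB := e.hB
  have hp1 : 2 ^ (d + 2) = 2 * 2 ^ (d + 1) := by ring
  obtain ⟨T1, par1, X, t1, t2, t3, t4, t5, t6, t7, t8⟩ := grow e h hi a ha hca d (by omega)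
  have hbT1 : b ∉ T1 \ T := by
    intro hh
    rw [mem_sdiff] at hh
    exact hh.2 (hb (t3.2.1 hh.1))
  obtain ⟨T2, par2, Y, u1, u2, u3, u4, u5, u6, u7, u8⟩ := grow e t3 t4 b (fun hh => t1 (hb hh))
    (by rw [t5 b hab.symm hbT1]; exact hcb) d (by omega)
  have hXT : X ⊆ T1 \ T := by
    intro x hx
    obtain ⟨l, l1, l2, l3, l4, l5⟩ := (t8 x hx).2.2
    rcases l.eq_nil_or_concat with rfl | ⟨l', z, rfl⟩
    · have := e.hd1; simp at l1; omega
    · have : z = x := by rw [← l5]; simp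
      subst this
      exact l4 z (by simp)
  have hYT : Y ⊆ T2 \ T1 := by
    intro x hx
    obtain ⟨l, l1, l2, l3, l4, l5⟩ := (u8 x hx).2.2
    rcases l.eq_nil_or_concat with rfl | ⟨l', z, rfl⟩
    · have := e.hd1; simp at l1; omega
    · have : z = x := by rw [← l5]; simp
      subst this
      exact l4 z (by simp)
  have hdis : Disjoint X Y := by
    rw [Finset.disjoint_left]
    intro x hx hy
    exact (mem_sdiff.1 (hYT hy)).2 (mem_sdiff.1 (hXT hx)).1
  obtain ⟨x, hx, y, hy, hxy⟩ := e.hJ X Y hdis (by rw [t7]; exact e.hd) (by rw [u7]; exact e.hd)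
  obtain ⟨la, a1, a2, a3, a4, a5⟩ := (t8 x hx).2.2
  obtain ⟨lb, b1, b2, b3, b4, b5⟩ := (u8 y hy).2.2
  have a3' : (a :: la).IsChain (fun u v => par2 v = u) := by
    refine a3.imp_of_mem_tail_imp ?_
    intro u v _ hv huv
    rw [u2 v (mem_sdiff.1 (a4 v (by simpa using hv))).1]
    exact huv
  have haT : a ∉ W \ T := fun hh => (mem_sdiff.1 hh).2 (ha (mem_sdiff.1 hh).1)
  have hbT : b ∉ W \ T := fun hh => (mem_sdiff.1 hh).2 (hb (mem_sdiff.1 hh).1)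
  have hlaW : ∀ z ∈ la, z ∈ W ∧ z ∉ T ∧ z ∈ T1 := by
    intro z hz
    have := mem_sdiff.1 (a4 z hz)
    exact ⟨t3.2.1 this.1, this.2, this.1⟩
  have hlbW : ∀ z ∈ lb, z ∈ W ∧ z ∉ T ∧ z ∉ T1 ∧ z ∈ T2 := by
    intro z hz
    have := mem_sdiff.1 (b4 z hz)
    exact ⟨u3.2.1 this.1, fun hh => this.2 (t1 hh), this.2, this.1⟩
  have hala : a ∉ la := fun hh => haT (mem_sdiff.2 ⟨(hlaW a hh).1, (hlaW a hh).2.1⟩)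
  have halb : a ∉ lb := fun hh => haT (mem_sdiff.2 ⟨(hlbW a hh).1, (hlbW a hh).2.1⟩)
  have hbla : b ∉ la := fun hh => hbT (mem_sdiff.2 ⟨(hlaW b hh).1, (hlaW b hh).2.1⟩)
  have hblb : b ∉ lb := fun hh => hbT (mem_sdiff.2 ⟨(hlbW b hh).1, (hlbW b hh).2.1⟩)
  have hlab : ∀ z ∈ la, z ∉ lb := fun z hz hz' => (hlbW z hz').2.2.1 (hlaW z hz).2.2
  have hT2 : T ⊆ T2 := t1.trans u1
  have hpar : ∀ z ∈ T, par2 z = par z := fun z hz => (u2 z (t1 hz)).trans (t2 z hz)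
  have hpa := chain_par a3'
  have hpb := chain_par b3
  have hia := chain_inj a3' (List.nodup_cons.2 ⟨hala, a2⟩)
  have hib := chain_inj b3 (List.nodup_cons.2 ⟨hblb, b2⟩)
  have hinj : ∀ z ∈ la ++ lb, ∀ z' ∈ la ++ lb, par2 z = par2 z' → z = z' := by
    have cross : ∀ z ∈ la, ∀ z' ∈ lb, par2 z ≠ par2 z' := by
      intro z hz z' hz' he
      have p1 := hpa z hz
      have p2 := hpb z' hz'
      rw [he] at p1
      rw [List.mem_cons] at p1 p2
      rcases p1 with p1 | p1 <;> rcases p2 with p2 | p2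
      · exact hab (p1.symm.trans p2)
      · rw [p1] at p2; exact halb p2
      · rw [p2] at p1; exact hbla p1
      · exact hlab _ p1 p2
    intro z hz z' hz' he
    rw [List.mem_append] at hz hz'
    rcases hz with hz | hz <;> rcases hz' with hz' | hz'
    · exact hia z hz z' hz' he
    · exact absurd he (cross z hz z' hz')
    · exact absurd he.symm (cross z' hz' z hz)
    · exact hib z hz z' hz' he
  have hmem : ∀ z, z ∈ la ++ lb.reverse ↔ z ∈ la ++ lb := by simp
  have hsplit : ∀ v, (ch (T ∪ (la ++ lb.reverse).toFinset) par2 v).card ≤ (ch T par v).card +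
      ((la ++ lb).toFinset.filter fun z => par2 z = v).card := by
    intro v
    refine (card_le_card ?_).trans (card_union_le _ _)
    intro z hz
    simp only [ch, mem_filter, mem_union, List.mem_toFinset, hmem] at hz ⊢
    rcases hz with ⟨hz | hz, hv⟩
    · exact Or.inl ⟨hz, by rw [← hpar z hz]; exact hv⟩
    · exact Or.inr ⟨hz, hv⟩
  refine ⟨la ++ lb.reverse, par2, by simp [a1, b1]; omega, ?_, ?_, ?_, ?_, ?_, ?_, ?_⟩
  · rw [List.nodup_append']
    refine ⟨a2, List.nodup_reverse.2 b2, ?_⟩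
    intro z hz hz'
    exact hlab z hz (List.mem_reverse.1 hz')
  · intro z hz
    rw [hmem, List.mem_append] at hz
    rcases hz with hz | hz
    · exact ⟨(hlaW z hz).1, (hlaW z hz).2.1⟩
    · exact ⟨(hlbW z hz).1, (hlbW z hz).2.1⟩
  · have c1 : (a :: la).IsChain G.Adj := chain_adj u3.2.2 (fun z hz => u1 (hlaW z hz).2.2) a3'
    have c2 : (b :: lb).IsChain G.Adj := chain_adj u3.2.2 (fun z hz => (hlbW z hz).2.2.2) b3
    have c3 := isChain_symm_reverse c2
    have : a :: (la ++ lb.reverse) ++ [b] = (a :: la) ++ (b :: lb).reverse := by simp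
    rw [this]
    refine c1.append c3 ?_
    intro u hu v hv
    obtain ⟨_, rfl⟩ := List.mem_getLast?_eq_getLast hu
    rw [List.head?_reverse] at hv
    obtain ⟨_, rfl⟩ := List.mem_getLast?_eq_getLast hv
    rw [a5, b5]; exact hxy
  · apply ext_sub u3
    apply union_subset hT2
    intro z hz
    rw [List.mem_toFinset, hmem, List.mem_append] at hz
    rcases hz with hz | hz
    · exact u1 (hlaW z hz).2.2
    · exact (hlbW z hz).2.2.2
  · intro z hz hzW
    simp only [mem_union, List.mem_toFinset, hmem] at hz ⊢
    rcases hz with hz | hz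
    · rw [hpar z hz] at hzW ⊢
      exact Or.inl (hi z hz hzW)
    · rw [List.mem_append] at hz ⊢
      rcases hz with hz | hz
      · have := hpa z hz
        rw [List.mem_cons] at this
        rcases this with this | this
        · rw [this] at hzW ⊢; exact Or.inl (ha hzW)
        · exact Or.inr (Or.inl this)
      · have := hpb z hz
        rw [List.mem_cons] at this
        rcases this with this | this
        · rw [this] at hzW ⊢; exact Or.inl (hb hzW)
        · exact Or.inr (Or.inr this)
  · intro v
    refine (hsplit v).trans (Nat.add_le_add_left ?_ _)
    rw [card_le_one]
    intro z hz z' hz'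
    simp only [mem_filter, List.mem_toFinset] at hz hz'
    exact hinj z hz.1 z' hz'.1 (hz.2.trans hz'.2.symm)
  · intro v hva hvb hv
    refine (hsplit v).trans ?_
    rw [hmem] at hv
    have : ((la ++ lb).toFinset.filter fun z => par2 z = v) = ∅ := by
      rw [Finset.eq_empty_iff_forall_notMem]
      intro z hz
      simp only [mem_filter, List.mem_toFinset, List.mem_append] at hz
      rw [List.mem_append] at hv
      rcases hz with ⟨hz | hz, rfl⟩
      · have := hpa z hz
        rw [List.mem_cons] at this
        tauto
      · have := hpb z hz
        rw [List.mem_cons] at this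
        tauto
    rw [this]; simp

end
end HE

namespace HE
noncomputable section
open scoped Classical
open Finset

variable {V : Type*} [Fintype V]

def St (G : SimpleGraph V) (W : Finset V) (K m : ℕ) (T : Finset V) (A : Multiset V) : Prop :=
  ∃ par, Ext G W K (2 * m) T par ∧ Inv W T par ∧
    ∀ v ∈ A, (v ∈ W → v ∈ T) ∧ (ch T par v).card + A.count v ≤ 10

theorem st_mono {G : SimpleGraph V} {W : Finset V} {K m : ℕ} {T : Finset V} {A A' : Multiset V}
    (h : St G W K m T A) (hA : A' ≤ A) : St G W K m T A' := by
  obtain ⟨par, h1, h2, h3⟩ := h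
  refine ⟨par, h1, h2, fun v hv => ?_⟩
  obtain ⟨h4, h5⟩ := h3 v (Multiset.mem_of_le hA hv)
  have := Multiset.count_le_of_le v hA
  exact ⟨h4, by omega⟩

theorem ch_fresh {W T : Finset V} {par : V → V} (h : Inv W T par) {v : V} (hv : v ∈ W) (hv' : v ∉ T) :
    ch T par v = ∅ := by
  rw [Finset.eq_empty_iff_forall_notMem]
  intro z hz
  simp only [ch, mem_filter] at hz
  have := h z hz.1
  rw [hz.2] at this
  exact hv' (this hv)

theorem connect {G : SimpleGraph V} {W : Finset V} {K m Tm d B : ℕ} (e : Env G W K m Tm d B)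
    {T : Finset V} {A : Multiset V} {a b : V} (h : St G W K m T (a ::ₘ b ::ₘ A)) (hab : a ≠ b) (hT : T.card ≤ B) :
    ∃ l : List V, l.length = 2 * d ∧ l.Nodup ∧ (∀ z ∈ l, z ∈ W ∧ z ∉ T) ∧
      (a :: l ++ [b]).IsChain G.Adj ∧ St G W K m (T ∪ l.toFinset) (A + (l : Multiset V)) := by
  obtain ⟨par, h1, h2, h3⟩ := h
  have hK := e.hK
  obtain ⟨a1, a2⟩ := h3 a (by simp)
  obtain ⟨b1, b2⟩ := h3 b (by simp)
  rw [Multiset.count_cons_self] at a2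
  rw [Multiset.count_cons_of_ne hab.symm, Multiset.count_cons_self] at b2
  obtain ⟨l, par', l1, l2, l3, l4, l5, l6, l7, l8⟩ := connect0 e h1 h2 hab a1 b1 (by omega) (by omega) hT
  refine ⟨l, l1, l2, l3, l4, par', l5, l6, ?_⟩
  intro v hv
  rw [Multiset.count_add, Multiset.coe_count]
  by_cases hvl : v ∈ l
  · have hA : v ∉ A := fun hh => (l3 v hvl).2 ((h3 v (by simp [hh])).1 (l3 v hvl).1)
    refine ⟨fun _ => by simp [hvl], ?_⟩
    rw [Multiset.count_eq_zero_of_notMem hA]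
    have c1 := List.nodup_iff_count_le_one.1 l2 v
    have c2 := l7 v
    rw [ch_fresh h2 (l3 v hvl).1 (l3 v hvl).2] at c2
    rw [card_empty] at c2
    omega
  · have hA : v ∈ A := by simpa [hvl] using hv
    obtain ⟨v1, v2⟩ := h3 v (by simp [hA])
    refine ⟨fun hh => mem_union_left _ (v1 hh), ?_⟩
    rw [List.count_eq_zero_of_not_mem hvl]
    have c2 := l7 v
    by_cases hva : v = a
    · subst hva
      rw [Multiset.count_cons_self, Multiset.count_cons_of_ne hab] at v2
      omega
    · by_cases hvb : v = b
      · subst hvb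
        rw [Multiset.count_cons_of_ne hva, Multiset.count_cons_self] at v2
        omega
      · have := l8 v hva hvb hvl
        rw [Multiset.count_cons_of_ne hva, Multiset.count_cons_of_ne hvb] at v2
        omega

theorem child {G : SimpleGraph V} {W : Finset V} {K m Tm d B : ℕ} (e : Env G W K m Tm d B)
    {T : Finset V} {A : Multiset V} {a : V} (h : St G W K m T (a ::ₘ A)) (hT : T.card ≤ B) :
    ∃ r, r ∈ W ∧ r ∉ T ∧ G.Adj a r ∧ St G W K m (insert r T) (r ::ₘ r ::ₘ A) := by
  obtain ⟨par, h1, h2, h3⟩ := h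
  have hK := e.hK
  have hB := e.hB
  obtain ⟨a1, a2⟩ := h3 a (by simp)
  rw [Multiset.count_cons_self] at a2
  obtain ⟨r, r1, r2, r3, r4⟩ := ext_add e.hm h1 (fun U hU hU' => by have := e.hs U hU hU'; have hB' : B ≤ Tm := (Nat.le_add_right _ _).trans e.hB; omega) a (by omega)
  have har : a ≠ r := r3.ne
  refine ⟨r, r1, r2, r3, _, r4, ?_, ?_⟩
  · intro y hy hyW
    rw [mem_insert] at hy
    by_cases hyr : y = r
    · subst hyr
      rw [Function.update_self] at hyW ⊢
      exact mem_insert_of_mem (a1 hyW)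
    · rw [Function.update_of_ne hyr] at hyW ⊢
      exact mem_insert_of_mem (h2 y (by tauto) hyW)
  · have hsub : ∀ v, ch (insert r T) (Function.update par r a) v ⊆ ch T par v ∪ (if v = a then {r} else ∅) := by
      intro v z hz
      simp only [ch, mem_filter, mem_insert, mem_union] at hz ⊢
      by_cases hzr : z = r
      · subst hzr
        rw [Function.update_self] at hz
        right; simp [hz.2]
      · rw [Function.update_of_ne hzr] at hz
        left; tauto
    intro v hv
    have c := (card_le_card (hsub v)).trans (card_union_le _ _)
    by_cases hvr : v = r
    · subst hvr
      refine ⟨fun _ => mem_insert_self _ _, ?_⟩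
      rw [Multiset.count_cons_self, Multiset.count_cons_self]
      have hA : v ∉ A := fun hh => r2 ((h3 v (by simp [hh])).1 r1)
      rw [Multiset.count_eq_zero_of_notMem hA]
      rw [ch_fresh h2 r1 r2, if_neg har.symm] at c
      simp at c
      rw [c]; simp
    · have hA : v ∈ A := by simpa [hvr] using hv
      obtain ⟨v1, v2⟩ := h3 v (by simp [hA])
      refine ⟨fun hh => mem_insert_of_mem (v1 hh), ?_⟩
      rw [Multiset.count_cons_of_ne hvr, Multiset.count_cons_of_ne hvr]
      by_cases hva : v = a
      · subst hva
        rw [Multiset.count_cons_self] at v2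
        rw [if_pos rfl, card_singleton] at c
        omega
      · rw [Multiset.count_cons_of_ne hva] at v2
        rw [if_neg hva, card_empty] at c
        omega

theorem gen {G : SimpleGraph V} {W : Finset V} {K m Tm d B : ℕ} (e : Env G W K m Tm d B) (p r : V) (A : Multiset V) :
    ∀ (j : ℕ) (rest : List V) (T : Finset V) (g q : V) (K1 K2 : List V), rest.length = 2 * j →
    St G W K m T (g ::ₘ q ::ₘ (rest : Multiset V) + A) → (g :: q :: rest).Nodup → T.card + 2 * d * j ≤ B →
    (g :: K1 ++ [q]).IsChain G.Adj → (g :: K2 ++ [p]).IsChain G.Adj → K1.Perm K2 →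
    (q :: rest ++ [r]).IsChain G.Adj →
    ∃ (g' q' : V) (N1 N2 E : List V), St G W K m (T ∪ E.toFinset) (g' ::ₘ q' ::ₘ A) ∧ E.Nodup ∧
      (∀ z ∈ E, z ∈ W ∧ z ∉ T) ∧ E.length = 2 * d * j ∧
      (g' :: N1 ++ [q']).IsChain G.Adj ∧ (g' :: N2 ++ [p]).IsChain G.Adj ∧ N1.Perm N2 ∧ G.Adj q' r ∧
      (g' :: N1 ++ [q']).Perm (g :: K1 ++ q :: rest ++ E) := by
  intro j
  induction j with
  | zero =>
    intro rest T g q K1 K2 hr hS hn hT c1 c2 hp c3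
    have : rest = [] := List.length_eq_zero_iff.1 (by omega)
    subst this
    refine ⟨g, q, K1, K2, [], by simpa using hS, by simp, by simp, by simp, c1, c2, hp, by simpa using c3, by simp⟩
  | succ j ih =>
    intro rest T g q K1 K2 hr hS hn hT c1 c2 hp c3
    obtain ⟨r', s, rest, rfl⟩ : ∃ r' s t, rest = r' :: s :: t := by
      rcases rest with _ | ⟨x, _ | ⟨y, t⟩⟩
      · simp at hr
      · simp at hr; omega
      · exact ⟨x, y, t, rfl⟩
    have hmul : 2 * d * (j + 1) = 2 * d * j + 2 * d := by ring
    have hgr : g ≠ r' := by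
      rintro rfl; simp at hn
    obtain ⟨l, l1, l2, l3, l4, l5⟩ := connect e (T := T) (a := g) (b := r') (A := q ::ₘ s ::ₘ (rest : Multiset V) + A)
      (by
        have : g ::ₘ q ::ₘ ((r' :: s :: rest : List V) : Multiset V) + A = g ::ₘ r' ::ₘ (q ::ₘ s ::ₘ (rest : Multiset V) + A) := by
          rw [← Multiset.cons_coe, ← Multiset.cons_coe]
          simp only [← Multiset.singleton_add]
          abel
        rwa [this] at hS) hgr (by omega)
    have hcard : (T ∪ l.toFinset).card ≤ T.card + 2 * d := by
      refine (card_union_le _ _).trans (Nat.add_le_add_left ?_ _)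
      rw [← l1]; exact List.toFinset_card_le l
    have c3a : G.Adj q r' := by simp at c3; tauto
    have c3b : G.Adj r' s := by simp at c3; tauto
    obtain ⟨g', q', N1, N2, E, x1, x2, x3, x4, x5, x6, x7, x8, x9⟩ := ih rest (T ∪ l.toFinset) q s
      (K1.reverse ++ g :: l ++ [r']) (r' :: l.reverse ++ g :: K2) (by simp at hr; omega)
      (st_mono l5 (Multiset.le_add_right _ _))
      (by simp at hn ⊢; tauto) (by omega)
      (by
        have d1 : (q :: K1.reverse ++ [g]).IsChain G.Adj := by simpa using isChain_symm_reverse c1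
        have d2 : (g :: (l ++ [r'] ++ [s])).IsChain G.Adj := by
          have : g :: (l ++ [r'] ++ [s]) = (g :: l) ++ r' :: [s] := by simp
          rw [this, List.isChain_split]
          exact ⟨by simpa using l4, by simpa using c3b⟩
        have : q :: (K1.reverse ++ g :: l ++ [r']) ++ [s] = (q :: K1.reverse) ++ g :: (l ++ [r'] ++ [s]) := by simp
        rw [this, List.isChain_split]
        exact ⟨d1, d2⟩)
      (by
        have d1 : (r' :: l.reverse ++ [g]).IsChain G.Adj := by simpa using isChain_symm_reverse l4
        have : q :: (r' :: l.reverse ++ g :: K2) ++ [p] = q :: ((r' :: l.reverse) ++ g :: (K2 ++ [p])) := by simp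
        rw [this]
        have d3 : ((r' :: l.reverse) ++ g :: (K2 ++ [p])).IsChain G.Adj := by
          rw [List.isChain_split]
          exact ⟨d1, by simpa using c2⟩
        rw [List.cons_append, List.isChain_cons_cons]
        exact ⟨c3a, d3⟩)
      (by
        rw [List.perm_iff_count]; intro z
        have := hp.count_eq z
        simp [List.count_append, List.count_cons, this]; omega)
      (by simp at c3 ⊢; tauto)
    refine ⟨g', q', N1, N2, l ++ E, ?_, ?_, ?_, ?_, x5, x6, x7, x8, ?_⟩
    · rw [List.toFinset_append, ← union_assoc]; exact x1
    · rw [List.nodup_append']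
      refine ⟨l2, x2, fun z hz hz' => ?_⟩
      exact (x3 z hz').2 (by simp [hz])
    · intro z hz
      rcases List.mem_append.1 hz with hz | hz
      · exact l3 z hz
      · exact ⟨(x3 z hz).1, fun hh => (x3 z hz).2 (by simp [hh])⟩
    · simp [l1, x4]; ring
    · refine x9.trans ?_
      rw [List.perm_iff_count]; intro z
      simp [List.count_append, List.count_cons]; omega

end
end HE

namespace HE
noncomputable section
open scoped Classical
open Finset

variable {V : Type*} [Fintype V]

set_option maxHeartbeats 2000000 in
theorem gadget {G : SimpleGraph V} {W : Finset V} {K m Tm d B : ℕ} (e : Env G W K m Tm d B)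
    {T : Finset V} {A : Multiset V} {x a b : V} (h : St G W K m T (x ::ₘ a ::ₘ b ::ₘ A))
    (hT : T.card + 8 * (d * d) ≤ B) :
    ∃ (t : V) (P1 P2 Q1 Q2 E : List V), t ∈ E ∧ E.Nodup ∧ (∀ z ∈ E, z ∈ W ∧ z ∉ T) ∧ E.length ≤ 8 * (d * d) ∧
      St G W K m (T ∪ E.toFinset) (t ::ₘ A) ∧
      (x :: P1 ++ [b]).IsChain G.Adj ∧ (a :: P2 ++ [t]).IsChain G.Adj ∧
      (x :: Q1 ++ [t]).IsChain G.Adj ∧ (a :: Q2 ++ [b]).IsChain G.Adj ∧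
      (P1 ++ P2 ++ [t]).Perm E ∧ (Q1 ++ Q2 ++ [t]).Perm E := by
  have hd1 := e.hd1
  have hdd : d ≤ d * d := Nat.le_mul_self d
  have hx := (h.choose_spec.2.2 x (by simp)).1
  have hb := (h.choose_spec.2.2 b (by simp)).1
  obtain ⟨r, r1, r2, r3, r4⟩ := child e (T := T) (a := a) (A := x ::ₘ b ::ₘ A)
    (by rwa [Multiset.cons_swap] at h) (by omega)
  have hT1 : (insert r T).card = T.card + 1 := card_insert_of_notMem r2
  obtain ⟨p, p1, p2, p3, p4⟩ := child e (T := insert r T) (a := r) r4 (by omega)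
  have hT2 : (insert p (insert r T)).card = T.card + 2 := by rw [card_insert_of_notMem p2, hT1]
  have hrp : r ≠ p := p3.ne
  obtain ⟨l, l1, l2, l3, l4, l5⟩ := connect e (T := insert p (insert r T)) (a := r) (b := p)
    (A := p ::ₘ x ::ₘ b ::ₘ A)
    (by
      refine st_mono p4 (le_of_eq ?_)
      simp only [← Multiset.singleton_add]; abel) hrp (by omega)
  obtain ⟨w1, w2, rest, hw⟩ : ∃ w1 w2 t, l.reverse = w1 :: w2 :: t := by
    have hl : l.reverse.length = 2 * d := by simp [l1]
    rcases hh : l.reverse with _ | ⟨u, _ | ⟨v, t⟩⟩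
    · rw [hh] at hl; simp at hl; omega
    · rw [hh] at hl; simp at hl; omega
    · exact ⟨u, v, t, rfl⟩
  have hrest : rest.length = 2 * (d - 1) := by
    have hl : l.reverse.length = 2 * d := by simp [l1]
    rw [hw] at hl; simp at hl; omega
  have hT3 : (insert p (insert r T) ∪ l.toFinset).card ≤ T.card + 2 + 2 * d := by
    refine (card_union_le _ _).trans ?_
    rw [hT2]
    have := List.toFinset_card_le l
    omega
  have hlr : (p :: w1 :: w2 :: rest ++ [r]).IsChain G.Adj := by
    have := isChain_symm_reverse l4
    simp only [List.reverse_append, List.reverse_cons, List.reverse_nil, List.nil_append, hw] at this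
    simpa using this
  have hlm : (l : Multiset V) = w1 ::ₘ w2 ::ₘ (rest : Multiset V) := by
    rw [← Multiset.coe_reverse, hw]; rfl
  have hnr : (w1 :: w2 :: rest).Nodup := by rw [← hw]; exact List.nodup_reverse.2 l2
  have hmul : 2 * d * (d - 1) + 2 * d = 2 * (d * d) := by
    obtain ⟨k, rfl⟩ : ∃ k, d = k + 1 := ⟨d - 1, by omega⟩
    simp; ring
  obtain ⟨g, q, N1, N2, E, x1, x2, x3, x4, x5, x6, x7, x8, x9⟩ := gen e p r (p ::ₘ x ::ₘ b ::ₘ A) (d - 1) rest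
    (insert p (insert r T) ∪ l.toFinset) w1 w2 [] [] hrest
    (by
      refine st_mono l5 (le_of_eq ?_)
      rw [hlm]
      simp only [← Multiset.singleton_add]; abel) hnr (by omega)
    (by simp at hlr ⊢; tauto) (by simp at hlr ⊢; exact hlr.1.symm) (by simp) (by simp at hlr ⊢; tauto)
  set T4 := insert p (insert r T) ∪ l.toFinset ∪ E.toFinset with hT4
  have hT4c : T4.card ≤ T.card + 2 + 2 * (d * d) := by
    refine (card_union_le _ _).trans ?_
    have := List.toFinset_card_le E
    omega
  have hmem9 : ∀ z, z ∈ g :: N1 ++ [q] ↔ z ∈ l ∨ z ∈ E := by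
    intro z
    rw [x9.mem_iff]
    have : z ∈ l ↔ z ∈ l.reverse := List.mem_reverse.symm
    rw [this, hw]; simp [or_assoc]
  have hfr9 : ∀ z ∈ g :: N1 ++ [q], z ∈ W ∧ z ∉ T := by
    intro z hz
    rw [hmem9] at hz
    rcases hz with hz | hz
    · exact ⟨(l3 z hz).1, fun hh => (l3 z hz).2 (by simp [hh])⟩
    · exact ⟨(x3 z hz).1, fun hh => (x3 z hz).2 (by simp [hh])⟩
  have hg := hfr9 g (by simp)
  have hq := hfr9 q (by simp)
  obtain ⟨lx, m1, m2, m3, m4, m5⟩ := connect e (T := T4) (a := x) (b := g) (A := q ::ₘ b ::ₘ p ::ₘ A)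
    (by
      refine st_mono x1 (le_of_eq ?_)
      simp only [← Multiset.singleton_add]; abel) (fun hh => hg.2 (hh ▸ hx (hh ▸ hg.1))) (by omega)
  have hT5 : (T4 ∪ lx.toFinset).card ≤ T4.card + 2 * d := by
    refine (card_union_le _ _).trans ?_
    have := List.toFinset_card_le lx
    omega
  obtain ⟨lb, k1, k2, k3, k4, k5⟩ := connect e (T := T4 ∪ lx.toFinset) (a := q) (b := b)
    (A := p ::ₘ A + (lx : Multiset V))
    (by
      refine st_mono m5 (le_of_eq ?_)
      simp only [← Multiset.singleton_add]; abel) (fun hh => hq.2 (hh ▸ hb (hh ▸ hq.1))) (by omega)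
  refine ⟨p, lx ++ g :: N1 ++ q :: lb, [r], lx ++ g :: N2, r :: q :: lb, [r, p] ++ l ++ E ++ lx ++ lb,
    by simp, ?_, ?_, ?_, ?_, ?_, ?_, ?_, ?_, ?_, ?_⟩
  · simp only [List.nodup_append', List.disjoint_left, List.mem_append, List.mem_cons, List.not_mem_nil, or_false]
    have i1 : ∀ z, z = r ∨ z = p → z ∈ insert p (insert r T) := by
      intro z hz
      rcases hz with rfl | rfl <;> simp
    have i2 : ∀ z, (z = r ∨ z = p) ∨ z ∈ l → z ∈ insert p (insert r T) ∪ l.toFinset := by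
      intro z hz
      rcases hz with hz | hz
      · exact mem_union_left _ (i1 z hz)
      · exact mem_union_right _ (List.mem_toFinset.2 hz)
    have i3 : ∀ z, ((z = r ∨ z = p) ∨ z ∈ l) ∨ z ∈ E → z ∈ T4 := by
      intro z hz
      rcases hz with hz | hz
      · exact mem_union_left _ (i2 z hz)
      · exact mem_union_right _ (List.mem_toFinset.2 hz)
    have i4 : ∀ z, (((z = r ∨ z = p) ∨ z ∈ l) ∨ z ∈ E) ∨ z ∈ lx → z ∈ T4 ∪ lx.toFinset := by
      intro z hz
      rcases hz with hz | hz
      · exact mem_union_left _ (i3 z hz)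
      · exact mem_union_right _ (List.mem_toFinset.2 hz)
    refine ⟨⟨⟨⟨by simpa using hrp, l2, ?_⟩, x2, ?_⟩, m2, ?_⟩, k2, ?_⟩
    · exact fun z hz hz' => (l3 z hz').2 (i1 z hz)
    · exact fun z hz hz' => (x3 z hz').2 (i2 z hz)
    · exact fun z hz hz' => (m3 z hz').2 (i3 z hz)
    · exact fun z hz hz' => (k3 z hz').2 (i4 z hz)
  · intro z hz
    simp only [List.mem_append] at hz
    have hsub : ∀ z, z ∈ T → z ∈ T4 := by
      intro z hz; rw [hT4]; simp [hz]
    rcases hz with (((hz | hz) | hz) | hz) | hz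
    · simp only [List.mem_cons, List.not_mem_nil, or_false] at hz
      rcases hz with rfl | rfl
      · exact ⟨r1, r2⟩
      · exact ⟨p1, fun hh => p2 (by simp [hh])⟩
    · exact hfr9 z ((hmem9 z).2 (Or.inl hz))
    · exact hfr9 z ((hmem9 z).2 (Or.inr hz))
    · exact ⟨(m3 z hz).1, fun hh => (m3 z hz).2 (hsub z hh)⟩
    · exact ⟨(k3 z hz).1, fun hh => (k3 z hz).2 (mem_union_left _ (hsub z hh))⟩
  · simp [l1, x4, m1, k1]; omega
  · have hTT : T ∪ ([r, p] ++ l ++ E ++ lx ++ lb).toFinset = T4 ∪ lx.toFinset ∪ lb.toFinset := by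
      rw [hT4]; ext z; simp only [mem_union, mem_insert, List.mem_toFinset, List.mem_append, List.mem_cons, List.not_mem_nil, or_false]; clear * -; tauto
    rw [hTT]
    exact st_mono k5 (by rw [add_assoc]; exact Multiset.le_add_right _ _)
  · have : x :: (lx ++ g :: N1 ++ q :: lb) ++ [b] = (x :: lx) ++ g :: (N1 ++ q :: (lb ++ [b])) := by simp
    rw [this, List.isChain_split]
    refine ⟨by simpa using m4, ?_⟩
    have : g :: (N1 ++ q :: (lb ++ [b])) = (g :: N1) ++ q :: (lb ++ [b]) := by simp
    rw [this, List.isChain_split]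
    exact ⟨x5, by simpa using k4⟩
  · simp; exact ⟨r3, p3⟩
  · have : x :: (lx ++ g :: N2) ++ [p] = (x :: lx) ++ g :: (N2 ++ [p]) := by simp
    rw [this, List.isChain_split]
    exact ⟨by simpa using m4, by simpa using x6⟩
  · simp at k4 ⊢; exact ⟨r3, x8.symm, k4⟩
  · rw [List.perm_iff_count]; intro z
    have c1 := x9.count_eq z
    have c2 : l.count z = (w1 :: w2 :: rest).count z := by rw [← hw]; simp
    simp [List.count_append, List.count_cons] at c1 c2 ⊢; omega
  · rw [List.perm_iff_count]; intro z
    have c1 := x9.count_eq z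
    have c2 : l.count z = (w1 :: w2 :: rest).count z := by rw [← hw]; simp
    have c3 := x7.count_eq z
    simp [List.count_append, List.count_cons] at c1 c2 ⊢; omega

inductive Cov (G : SimpleGraph V) : Multiset V → Multiset V → Prop
  | nil : Cov G 0 0
  | cons (a b : V) (mid : List V) (R S : Multiset V) (hc : (a :: mid ++ [b]).IsChain G.Adj) (h : Cov G R S) :
      Cov G (a ::ₘ b ::ₘ R) (S + ((a :: mid ++ [b] : List V) : Multiset V))

theorem cov_extract {G : SimpleGraph V} {R S : Multiset V} (h : Cov G R S) : ∀ a ∈ R,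
    ∃ (c : V) (mid : List V) (R' S' : Multiset V), (c :: mid ++ [a]).IsChain G.Adj ∧ R = a ::ₘ c ::ₘ R' ∧
      S = S' + ((c :: mid ++ [a] : List V) : Multiset V) ∧ Cov G R' S' := by
  induction h with
  | nil => simp
  | cons a b mid R S hc h ih =>
    intro z hz
    by_cases hzb : z = b
    · subst hzb
      exact ⟨a, mid, R, S, hc, Multiset.cons_swap _ _ _, rfl, h⟩
    by_cases hza : z = a
    · subst hza
      refine ⟨b, mid.reverse, R, S, by simpa using isChain_symm_reverse hc, rfl, ?_, h⟩
      congr 1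
      rw [← Multiset.coe_reverse]; simp
    obtain ⟨c, mid', R', S', h1, h2, h3, h4⟩ := ih z (by simpa [hza, hzb] using hz)
    refine ⟨c, mid', a ::ₘ b ::ₘ R', S' + ((a :: mid ++ [b] : List V) : Multiset V), h1, ?_, ?_, Cov.cons a b mid _ _ hc h4⟩
    · rw [h2]; simp only [← Multiset.singleton_add]; abel
    · rw [h3]; abel

def Lad (G : SimpleGraph V) (x y : V) (R E : Multiset V) : Prop :=
  ∀ S, Cov G R S → ∃ P : List V, (x :: P ++ [y]).IsChain G.Adj ∧ (P : Multiset V) = S + E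

def rts : List (V × V) → Multiset V
  | [] => 0
  | ab :: l => ab.1 ::ₘ ab.2 ::ₘ rts l

theorem ladder {G : SimpleGraph V} {W : Finset V} {K m Tm d B : ℕ} (e : Env G W K m Tm d B) (y : V)
    (ab : List (V × V)) : ∀ (T : Finset V) (x : V), x ≠ y → St G W K m T (x ::ₘ y ::ₘ rts ab) →
    T.card + (ab.length + 1) * (8 * (d * d)) ≤ B →
    ∃ E : List V, E.Nodup ∧ (∀ z ∈ E, z ∈ W ∧ z ∉ T) ∧ E.length ≤ (ab.length + 1) * (8 * (d * d)) ∧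
      Lad G x y (rts ab) E := by
  have hd1 := e.hd1
  have hdd : d ≤ d * d := Nat.le_mul_self d
  induction ab with
  | nil =>
    intro T x hxy hS hT
    simp only [List.length_nil, zero_add, one_mul] at hT
    obtain ⟨l, l1, l2, l3, l4, l5⟩ := connect e hS hxy (by omega)
    refine ⟨l, l2, l3, by simp; omega, ?_⟩
    intro S hc
    generalize hR : rts ([] : List (V × V)) = R at hc
    cases hc with
    | nil => exact ⟨l, l4, by simp⟩
    | cons a b mid R S hc h => simp [rts] at hR
  | cons u ab ih =>
    intro T x hxy hS hT
    obtain ⟨a, b⟩ := u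
    have hmul : ((a, b) :: ab).length + 1 = (ab.length + 1) + 1 := by simp
    rw [hmul, Nat.add_mul, one_mul] at hT
    have hy := (hS.choose_spec.2.2 y (by simp)).1
    obtain ⟨t, P1, P2, Q1, Q2, E, e1, e2, e3, e4, e5, p1, p2, q1, q2, pe, qe⟩ := gadget e (T := T) (x := x) (a := a) (b := b)
      (A := y ::ₘ rts ab) (by
        refine st_mono hS (le_of_eq ?_)
        simp only [rts, ← Multiset.singleton_add]; abel) (by omega)
    have hc1 : (T ∪ E.toFinset).card ≤ T.card + 8 * (d * d) := by
      refine (card_union_le _ _).trans ?_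
      have := List.toFinset_card_le E
      omega
    obtain ⟨E', f1, f2, f3, f4⟩ := ih (T ∪ E.toFinset) t (by
      rintro rfl
      exact (e3 t e1).2 (hy (e3 t e1).1)) e5 (by omega)
    refine ⟨E ++ E', ?_, ?_, ?_, ?_⟩
    · rw [List.nodup_append']
      refine ⟨e2, f1, fun z hz hz' => ?_⟩
      exact (f2 z hz').2 (by simp [hz])
    · intro z hz
      rcases List.mem_append.1 hz with hz | hz
      · exact e3 z hz
      · exact ⟨(f2 z hz).1, fun hh => (f2 z hz).2 (by simp [hh])⟩
    · rw [hmul, Nat.add_mul, one_mul, List.length_append]; omega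
    · intro S hS'
      simp only [rts] at hS'
      obtain ⟨c, mid, R1, S1, c1, c2, c3, c4⟩ := cov_extract hS' a (by simp)
      rw [Multiset.cons_inj_right] at c2
      have hpe := congrArg (fun z => z) (Multiset.coe_eq_coe.2 pe)
      have hqe := congrArg (fun z => z) (Multiset.coe_eq_coe.2 qe)
      simp only [← Multiset.coe_add] at hpe hqe
      by_cases hcb : c = b
      · subst hcb
        rw [Multiset.cons_inj_right] at c2
        rw [← c2] at c4
        obtain ⟨P, g1, g2⟩ := f4 S1 c4
        refine ⟨P1 ++ (c :: mid ++ [a]) ++ P2 ++ [t] ++ P, ?_, ?_⟩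
        · have e1 : x :: (P1 ++ (c :: mid ++ [a]) ++ P2 ++ [t] ++ P) ++ [y] =
            (x :: P1) ++ c :: (mid ++ a :: (P2 ++ t :: (P ++ [y]))) := by simp
          have e2 : c :: (mid ++ a :: (P2 ++ t :: (P ++ [y]))) = (c :: mid) ++ a :: (P2 ++ t :: (P ++ [y])) := by simp
          have e3 : a :: (P2 ++ t :: (P ++ [y])) = (a :: P2) ++ t :: (P ++ [y]) := by simp
          rw [e1]; refine List.isChain_split.2 ⟨p1, ?_⟩
          rw [e2]; refine List.isChain_split.2 ⟨c1, ?_⟩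
          rw [e3]; exact List.isChain_split.2 ⟨p2, by simpa using g1⟩
        · rw [c3]
          simp only [← Multiset.coe_add, g2, ← hpe]
          abel
      · have hbR : b ∈ R1 := by
          have : b ∈ c ::ₘ R1 := by rw [← c2]; simp
          rcases Multiset.mem_cons.1 this with h | h
          · exact absurd h.symm hcb
          · exact h
        obtain ⟨c', mid', R2, S2, d1, d2, d3, d4⟩ := cov_extract c4 b hbR
        rw [d2, Multiset.cons_swap, Multiset.cons_inj_right] at c2
        have d1' : (b :: mid'.reverse ++ [c']).IsChain G.Adj := by simpa using isChain_symm_reverse d1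
        have key : Cov G (rts ab) (S2 + ((c :: (mid ++ a :: Q2 ++ b :: mid'.reverse) ++ [c'] : List V) : Multiset V)) := by
          rw [c2]
          refine Cov.cons c c' _ R2 S2 ?_ d4
          have e1 : c :: (mid ++ a :: Q2 ++ b :: mid'.reverse) ++ [c'] =
            (c :: mid) ++ a :: (Q2 ++ b :: (mid'.reverse ++ [c'])) := by simp
          have e2 : a :: (Q2 ++ b :: (mid'.reverse ++ [c'])) = (a :: Q2) ++ b :: (mid'.reverse ++ [c']) := by simp
          rw [e1]; refine List.isChain_split.2 ⟨c1, ?_⟩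
          rw [e2]; exact List.isChain_split.2 ⟨q2, by simpa using d1'⟩
        obtain ⟨P, g1, g2⟩ := f4 _ key
        refine ⟨Q1 ++ [t] ++ P, ?_, ?_⟩
        · have e1 : x :: (Q1 ++ [t] ++ P) ++ [y] = (x :: Q1) ++ t :: (P ++ [y]) := by simp
          rw [e1, List.isChain_split]
          exact ⟨q1, by simpa using g1⟩
        · rw [c3, d3]
          simp only [← Multiset.coe_add, g2, ← hqe, ← Multiset.cons_coe, ← Multiset.singleton_add, Multiset.coe_reverse]
          simp only [Multiset.coe_nil, Multiset.cons_zero]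
          abel

end
end HE

namespace HE
noncomputable section
open scoped Classical
open Finset

variable {V : Type*} [Fintype V]

def vs (Q : Multiset (List V)) : Multiset V := Q.bind (fun l => (l : Multiset V))
def hds (Q : Multiset (List V)) : Multiset (Option V) := Q.map List.head?
def lts (Q : Multiset (List V)) : Multiset (Option V) := Q.map List.getLast?
def Sys (G : SimpleGraph V) (Q : Multiset (List V)) : Prop := ∀ p ∈ Q, p ≠ [] ∧ p.IsChain G.Adj

inductive Rch (G : SimpleGraph V) (R : Finset V) (p0 : List V) (Q0 : Multiset (List V)) :
    List V → Multiset (List V) → Prop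
  | base : Rch G R p0 Q0 p0 Q0
  | other (p q1 q2 : List V) (r e z : V) (Q : Multiset (List V)) (h : Rch G R p0 Q0 (p ++ [r]) ((q1 ++ e :: z :: q2) ::ₘ Q))
      (ha : G.Adj r z) (hz : z ∈ R) : Rch G R p0 Q0 (q1 ++ [e]) ((p ++ r :: z :: q2) ::ₘ Q)
  | self (p1 t : List V) (r e z : V) (Q : Multiset (List V)) (h : Rch G R p0 Q0 (p1 ++ z :: t) Q)
      (h1 : t.head? = some e) (h2 : t.getLast? = some r)
      (ha : G.Adj r z) (hz : z ∈ R) : Rch G R p0 Q0 (p1 ++ z :: t.reverse) Q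

theorem ch_other {r : V → V → Prop} {p q1 q2 : List V} {a e z : V} (h1 : (p ++ [a]).IsChain r)
    (h2 : (q1 ++ e :: z :: q2).IsChain r) (h : r a z) : (q1 ++ [e]).IsChain r ∧ (p ++ a :: z :: q2).IsChain r ∧ r e z := by
  rw [List.isChain_split, List.isChain_cons_cons] at h2
  refine ⟨h2.1, ?_, h2.2.1⟩
  rw [List.isChain_split, List.isChain_cons_cons]
  exact ⟨h1, h, h2.2.2⟩

theorem ch_self {r : V → V → Prop} (hr : ∀ a b, r a b → r b a) {p1 t : List V} {a e z : V}
    (h : (p1 ++ z :: t).IsChain r) (h1 : t.head? = some e) (h2 : t.getLast? = some a) (ha : r a z) :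
    (p1 ++ z :: t.reverse).IsChain r ∧ r z e := by
  rw [List.isChain_split, List.isChain_cons] at h
  refine ⟨?_, h.2.1 e h1⟩
  rw [List.isChain_split, List.isChain_cons]
  refine ⟨h.1, ?_, ?_⟩
  · intro y hy
    rw [List.head?_reverse, h2] at hy
    cases hy
    exact hr _ _ ha
  · rw [List.isChain_reverse]
    exact h.2.2.imp (fun a b => hr a b)

theorem list_succ (l : List V) (h : l.Nodup) : ∃ s p : V → V, l.IsChain (fun u w => w = s u ∧ u = p w) := by
  induction l with
  | nil => exact ⟨id, id, List.isChain_nil⟩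
  | cons a l ih =>
    obtain ⟨s, p, hc⟩ := ih (List.nodup_cons.1 h).2
    cases l with
    | nil => exact ⟨id, id, List.isChain_singleton _⟩
    | cons b t =>
      refine ⟨Function.update s a b, Function.update p b a, ?_⟩
      rw [List.isChain_cons_cons]
      refine ⟨by simp, ?_⟩
      refine List.IsChain.imp_of_mem_tail_imp ?_ hc
      intro u w hu hw huw
      simp only [List.nodup_cons, List.mem_cons, List.tail_cons] at h hw
      rw [Function.update_of_ne, Function.update_of_ne]
      · exact huw
      · rintro rfl; exact h.2.1 hw
      · rintro rfl; exact h.1 (List.mem_cons.1 hu)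

theorem sys_succ (Q : Multiset (List V)) (h : (vs Q).Nodup) :
    ∃ s p : V → V, ∀ l ∈ Q, l.IsChain (fun u w => w = s u ∧ u = p w) := by
  induction Q using Multiset.induction with
  | empty => exact ⟨id, id, by simp⟩
  | cons l Q ih =>
    simp only [vs, Multiset.cons_bind] at h ih
    rw [Multiset.nodup_add] at h
    obtain ⟨s, p, hc⟩ := ih h.2.1
    obtain ⟨s', p', hc'⟩ := list_succ l h.1
    refine ⟨fun u => if u ∈ l then s' u else s u, fun u => if u ∈ l then p' u else p u, ?_⟩
    intro l2 hl2
    rcases Multiset.mem_cons.1 hl2 with rfl | hl2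
    · refine List.IsChain.imp_of_mem_imp ?_ hc'
      intro u w hu hw huw
      simpa [hu, hw] using huw
    · have hn : ∀ u ∈ l2, u ∉ l := by
        intro u hu hu'
        exact Multiset.disjoint_left.1 h.2.2 hu' (Multiset.mem_bind.2 ⟨l2, hl2, hu⟩)
      refine List.IsChain.imp_of_mem_imp ?_ (hc l2 hl2)
      intro u w hu hw huw
      simpa [hn u hu, hn w hw] using huw

theorem rch_inv {G : SimpleGraph V} {R : Finset V} {p0 : List V} {Q0 : Multiset (List V)} (h0 : Sys G (p0 ::ₘ Q0))
    {p : List V} {Q : Multiset (List V)} (h : Rch G R p0 Q0 p Q) :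
    Sys G (p ::ₘ Q) ∧ vs (p ::ₘ Q) = vs (p0 ::ₘ Q0) ∧ hds (p ::ₘ Q) = hds (p0 ::ₘ Q0) ∧ lts Q = lts Q0 := by
  induction h with
  | base => exact ⟨h0, rfl, rfl, rfl⟩
  | other p q1 q2 r e z Q h ha hz ih =>
    obtain ⟨i1, i2, i3, i4⟩ := ih
    have c1 := i1 (p ++ [r]) (by simp)
    have c2 := i1 (q1 ++ e :: z :: q2) (by simp)
    obtain ⟨c3, c4, -⟩ := ch_other c1.2 c2.2 ha
    refine ⟨?_, ?_, ?_, ?_⟩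
    · intro l hl
      simp only [Multiset.mem_cons] at hl
      rcases hl with rfl | rfl | hl
      · exact ⟨by simp, c3⟩
      · exact ⟨by simp, c4⟩
      · exact i1 l (by simp [hl])
    · rw [← i2]
      simp only [vs, Multiset.cons_bind, ← Multiset.coe_add, ← Multiset.cons_coe]
      simp only [← Multiset.singleton_add, Multiset.coe_nil]
      abel
    · rw [← i3]
      simp only [hds, Multiset.map_cons]
      rw [Multiset.cons_swap]
      congr 1
      · cases p <;> simp
      · congr 1
        cases q1 <;> simp
    · rw [← i4]
      simp only [lts, Multiset.map_cons]
      congr 1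
      simp [List.getLast?_append, List.getLast?_cons]
  | self p1 t r e z Q h h1 h2 ha hz ih =>
    obtain ⟨i1, i2, i3, i4⟩ := ih
    have c1 := i1 (p1 ++ z :: t) (by simp)
    obtain ⟨c3, -⟩ := ch_self (fun _ _ h => h.symm) c1.2 h1 h2 ha
    refine ⟨?_, ?_, ?_, i4⟩
    · intro l hl
      simp only [Multiset.mem_cons] at hl
      rcases hl with rfl | hl
      · exact ⟨by simp, c3⟩
      · exact i1 l (by simp [hl])
    · rw [← i2]
      simp only [vs, Multiset.cons_bind, ← Multiset.coe_add, ← Multiset.cons_coe, Multiset.coe_reverse]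
    · rw [← i3]
      simp only [hds, Multiset.map_cons]
      congr 1
      cases p1 <;> simp

theorem rot_many {G : SimpleGraph V} {R : Finset V} {m : ℕ} {p0 : List V} {Q0 : Multiset (List V)}
    (h0 : Sys G (p0 ::ₘ Q0)) (hn : (vs (p0 ::ₘ Q0)).Nodup) (hR : ∀ z ∈ R, z ∈ vs (p0 ::ₘ Q0))
    (hH : ∀ z ∈ R, some z ∉ hds (p0 ::ₘ Q0)) (hX : ∀ U : Finset V, U.card < m → 4 * U.card ≤ (nb G U R).card) :
    ∃ X : Finset V, m ≤ X.card ∧ ∀ r ∈ X, ∃ p Q, Sys G (p ::ₘ Q) ∧ vs (p ::ₘ Q) = vs (p0 ::ₘ Q0) ∧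
      hds (p ::ₘ Q) = hds (p0 ::ₘ Q0) ∧ lts Q = lts Q0 ∧ p.getLast? = some r := by
  obtain ⟨s, pr, hs⟩ := sys_succ _ hn
  set X : Finset V := univ.filter (fun r => ∃ p Q, Rch G R p0 Q0 p Q ∧ p.getLast? = some r) with hXd
  have hmX : ∀ {p Q r}, Rch G R p0 Q0 p Q → p.getLast? = some r → r ∈ X := by
    intro p Q r h1 h2
    rw [hXd, mem_filter]
    exact ⟨mem_univ _, p, Q, h1, h2⟩
  set Y : Finset V := X ∪ X.image s ∪ X.image pr with hY
  have hYc : Y.card ≤ 3 * X.card := by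
    have a1 := card_union_le (X ∪ X.image s) (X.image pr)
    have a2 := card_union_le X (X.image s)
    have a3 : (X.image s).card ≤ X.card := card_image_le
    have a4 : (X.image pr).card ≤ X.card := card_image_le
    rw [hY]
    omega
  let rel : V → V → Prop := fun u w => (w = s u ∧ u = pr w) ∨ (u = s w ∧ w = pr u) ∨ (u ∈ Y ∧ w ∈ Y)
  have hsym : ∀ u w, rel u w → rel w u := by
    intro u w h
    rcases h with h | h | h
    · exact Or.inr (Or.inl h)
    · exact Or.inl h
    · exact Or.inr (Or.inr ⟨h.2, h.1⟩)
  have hXY : ∀ u ∈ X, u ∈ Y := fun u hu => by rw [hY]; simp [hu]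
  have hrelY : ∀ z e, rel z e → e ∈ X → z ∈ Y := by
    intro z e h he
    rcases h with h | h | h
    · rw [hY, h.2]; exact mem_union_right _ (mem_image_of_mem _ he)
    · rw [hY, h.1]; exact mem_union_left _ (mem_union_right _ (mem_image_of_mem _ he))
    · exact h.1
  have hrel : ∀ {p Q}, Rch G R p0 Q0 p Q → ∀ l ∈ p ::ₘ Q, l.IsChain rel := by
    intro p Q h
    induction h with
    | base =>
      intro l hl
      exact (hs l hl).imp (fun a b hab => Or.inl hab)
    | other p q1 q2 r e z Q h ha hz ih =>
      have heX : e ∈ X := hmX (Rch.other p q1 q2 r e z Q h ha hz) (by simp)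
      have hrX : r ∈ X := hmX h (by simp)
      have hez : rel e z := by
        have := ih (q1 ++ e :: z :: q2) (by simp)
        rw [List.isChain_split, List.isChain_cons_cons] at this
        exact this.2.1
      have hzY := hrelY z e (hsym _ _ hez) heX
      obtain ⟨c1, c2, -⟩ := ch_other (ih (p ++ [r]) (by simp)) (ih (q1 ++ e :: z :: q2) (by simp))
        (Or.inr (Or.inr ⟨hXY r hrX, hzY⟩))
      intro l hl
      simp only [Multiset.mem_cons] at hl
      rcases hl with rfl | rfl | hl
      · exact c1
      · exact c2
      · exact ih l (by simp [hl])
    | self p1 t r e z Q h h1 h2 ha hz ih =>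
      have hrX : r ∈ X := hmX h (by rw [List.getLast?_append, List.getLast?_cons, h2]; rfl)
      have heX : e ∈ X := hmX (Rch.self p1 t r e z Q h h1 h2 ha hz)
        (by rw [List.getLast?_append, List.getLast?_cons, List.getLast?_reverse, h1]; rfl)
      have hc := ih (p1 ++ z :: t) (by simp)
      have hze : rel z e := by
        rw [List.isChain_split, List.isChain_cons] at hc
        exact hc.2.1 e h1
      have hzY := hrelY z e hze heX
      obtain ⟨c1, -⟩ := ch_self hsym hc h1 h2 (Or.inr (Or.inr ⟨hXY r hrX, hzY⟩))
      intro l hl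
      simp only [Multiset.mem_cons] at hl
      rcases hl with rfl | hl
      · exact c1
      · exact ih l (by simp [hl])
  have hsub : nb G X R ⊆ Y := by
    intro z hz
    rw [mem_nb] at hz
    obtain ⟨hzR, r, hr, hrz⟩ := hz
    obtain ⟨p, Q, h1, h2⟩ := (mem_filter.1 hr).2
    obtain ⟨i1, i2, i3, i4⟩ := rch_inv h0 h1
    have hz1 : z ∈ vs (p ::ₘ Q) := by rw [i2]; exact hR z hzR
    have hz2 : some z ∉ hds (p ::ₘ Q) := by rw [i3]; exact hH z hzR
    simp only [vs, Multiset.cons_bind, Multiset.mem_add, Multiset.mem_coe, Multiset.mem_bind] at hz1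
    simp only [hds, Multiset.map_cons, Multiset.mem_cons, Multiset.mem_map, not_or, not_exists, not_and] at hz2
    rcases hz1 with hz1 | ⟨q, hq, hz1⟩
    · obtain ⟨p1, t, rfl⟩ := List.append_of_mem hz1
      cases t with
      | nil =>
        simp at h2
        subst h2
        exact absurd hrz (G.loopless.irrefl _)
      | cons e t =>
        have h2' : (e :: t).getLast? = some r := by
          rw [List.getLast?_append, List.getLast?_cons] at h2
          simp [List.getLast?_cons] at h2 ⊢
          exact h2
        have heX := hmX (Rch.self p1 (e :: t) r e z Q h1 rfl h2' hrz hzR) (by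
          simp [List.getLast?_append, List.getLast?_cons] : _ = some e)
        have hc := hrel h1 (p1 ++ z :: e :: t) (by simp)
        rw [List.isChain_split, List.isChain_cons_cons] at hc
        exact hrelY z e hc.2.1 heX
    · obtain ⟨q1, q2, rfl⟩ := List.append_of_mem hz1
      rcases List.eq_nil_or_concat q1 with rfl | ⟨q1, e, rfl⟩
      · exact absurd rfl (hz2.2 _ hq)
      · obtain ⟨Q', rfl⟩ := Multiset.exists_cons_of_mem hq
        have hp : ∃ p', p = p' ++ [r] := by
          rcases List.eq_nil_or_concat p with rfl | ⟨p', e', rfl⟩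
          · simp at h2
          · simp at h2; subst h2; exact ⟨p', by simp⟩
        obtain ⟨p', rfl⟩ := hp
        have hq' : q1.concat e ++ z :: q2 = q1 ++ e :: z :: q2 := by simp
        rw [hq'] at h1
        have heX := hmX (Rch.other p' q1 q2 r e z Q' h1 hrz hzR) (by simp : _ = some e)
        have hc := hrel h1 (q1 ++ e :: z :: q2) (by simp)
        rw [List.isChain_split, List.isChain_cons_cons] at hc
        exact hrelY z e (hsym _ _ hc.2.1) heX
  refine ⟨X, ?_, ?_⟩
  · by_contra hlt
    push Not at hlt
    have a1 := hX X hlt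
    have a2 := card_le_card hsub
    have a3 : 0 < X.card := by
      obtain ⟨r, hr⟩ : ∃ r, p0.getLast? = some r := ⟨p0.getLast (h0 p0 (by simp)).1, List.getLast?_eq_some_getLast _⟩
      exact card_pos.2 ⟨r, hmX Rch.base hr⟩
    omega
  · intro r hr
    obtain ⟨p, Q, h1, h2⟩ := (mem_filter.1 hr).2
    obtain ⟨i1, i2, i3, i4⟩ := rch_inv h0 h1
    exact ⟨p, Q, i1, i2, i3, i4, h2⟩

end
end HE

namespace HE
noncomputable section
open scoped Classical
open Finset

variable {V : Type*} [Fintype V]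

theorem mem_vs_of_last {p : List V} {Q : Multiset (List V)} {r : V} (h : p.getLast? = some r) :
    r ∈ vs (p ::ₘ Q) := by
  simp only [vs, Multiset.cons_bind, Multiset.mem_add, Multiset.mem_coe]
  exact Or.inl (List.mem_of_getLast? h)

theorem lts_pick {A : Multiset (List V)} {o : Option V} {L : Multiset (Option V)} (h : lts A = o ::ₘ L) :
    ∃ p Q, A = p ::ₘ Q ∧ p.getLast? = o ∧ lts Q = L := by
  have : o ∈ lts A := by rw [h]; simp
  obtain ⟨p, hp, hpo⟩ := Multiset.mem_map.1 this
  obtain ⟨Q, rfl⟩ := Multiset.exists_cons_of_mem hp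
  refine ⟨p, Q, rfl, hpo, ?_⟩
  simp only [lts, Multiset.map_cons, hpo, Multiset.cons_inj_right] at h
  exact h

theorem join_match {G : SimpleGraph V} {m : ℕ} {RA RB : Finset V} {SA SB : Multiset V} {HA HB : Multiset (Option V)}
    (hJ : Joined G m)
    (nA : SA.Nodup) (nB : SB.Nodup) (hAB : Disjoint SA SB)
    (rA : ∀ z ∈ RA, z ∈ SA ∧ some z ∉ HA) (rB : ∀ z ∈ RB, z ∈ SB ∧ some z ∉ HB)
    (xA : ∀ U : Finset V, U.card < m → 4 * U.card ≤ (nb G U RA).card)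
    (xB : ∀ U : Finset V, U.card < m → 4 * U.card ≤ (nb G U RB).card) (k : ℕ) :
    ∀ (A B : Multiset (List V)) (M : Multiset (V × V)) (LA LB : Multiset (Option V)),
      Sys G A → Sys G B → vs A = SA → vs B = SB → hds A = HA → hds B = HB →
      lts A = M.map (fun z => some z.1) + LA → lts B = M.map (fun z => some z.2) + LB →
      LA.card = k → LB.card = k → (∀ z ∈ M, G.Adj z.1 z.2) →
      ∃ (A B : Multiset (List V)) (M : Multiset (V × V)), Sys G A ∧ Sys G B ∧ vs A = SA ∧ vs B = SB ∧ hds A = HA ∧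
        hds B = HB ∧ lts A = M.map (fun z => some z.1) ∧ lts B = M.map (fun z => some z.2) ∧
        (∀ z ∈ M, G.Adj z.1 z.2) := by
  induction k with
  | zero =>
    intro A B M LA LB a1 b1 a2 b2 a3 b3 a4 b4 a5 b5 hM
    rw [Multiset.card_eq_zero] at a5 b5
    subst a5; subst b5
    rw [add_zero] at a4 b4
    exact ⟨A, B, M, a1, b1, a2, b2, a3, b3, a4, b4, hM⟩
  | succ k ih =>
    intro A B M LA LB a1 b1 a2 b2 a3 b3 a4 b4 a5 b5 hM
    obtain ⟨oA, LA, rfl⟩ : ∃ o L, LA = o ::ₘ L := by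
      obtain ⟨o, ho⟩ := Multiset.card_pos_iff_exists_mem.1 (by omega : 0 < LA.card)
      obtain ⟨L, hL⟩ := Multiset.exists_cons_of_mem ho
      exact ⟨o, L, hL⟩
    obtain ⟨oB, LB, rfl⟩ : ∃ o L, LB = o ::ₘ L := by
      obtain ⟨o, ho⟩ := Multiset.card_pos_iff_exists_mem.1 (by omega : 0 < LB.card)
      obtain ⟨L, hL⟩ := Multiset.exists_cons_of_mem ho
      exact ⟨o, L, hL⟩
    rw [Multiset.add_cons] at a4 b4
    obtain ⟨pA, QA, rfl, a6, a7⟩ := lts_pick a4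
    obtain ⟨pB, QB, rfl, b6, b7⟩ := lts_pick b4
    obtain ⟨XA, a8, a9⟩ := rot_many a1 (by rw [a2]; exact nA) (R := RA) (m := m)
      (fun z hz => by rw [a2]; exact (rA z hz).1) (fun z hz => by rw [a3]; exact (rA z hz).2) xA
    obtain ⟨XB, b8, b9⟩ := rot_many b1 (by rw [b2]; exact nB) (R := RB) (m := m)
      (fun z hz => by rw [b2]; exact (rB z hz).1) (fun z hz => by rw [b3]; exact (rB z hz).2) xB
    have hdis : Disjoint XA XB := by
      rw [Finset.disjoint_left]
      intro z hz hz'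
      obtain ⟨p, Q, -, c2, -, -, c3⟩ := a9 z hz
      obtain ⟨p', Q', -, d2, -, -, d3⟩ := b9 z hz'
      have e1 := mem_vs_of_last (Q := Q) c3
      have e2 := mem_vs_of_last (Q := Q') d3
      rw [c2, a2] at e1
      rw [d2, b2] at e2
      exact Multiset.disjoint_left.1 hAB e1 e2
    obtain ⟨u, hu, w, hw, huw⟩ := hJ XA XB hdis a8 b8
    obtain ⟨p, Q, c1, c2, c3, c4, c5⟩ := a9 u hu
    obtain ⟨p', Q', d1, d2, d3, d4, d5⟩ := b9 w hw
    rw [Multiset.card_cons] at a5 b5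
    refine ih (p ::ₘ Q) (p' ::ₘ Q') ((u, w) ::ₘ M) LA LB c1 d1 (c2.trans a2) (d2.trans b2) (c3.trans a3) (d3.trans b3)
      ?_ ?_ (by omega) (by omega) ?_
    · simp only [lts, Multiset.map_cons, c5, Multiset.cons_add, Multiset.cons_inj_right]
      rw [← a7, ← c4]; rfl
    · simp only [lts, Multiset.map_cons, d5, Multiset.cons_add, Multiset.cons_inj_right]
      rw [← b7, ← d4]; rfl
    · intro z hz
      rcases Multiset.mem_cons.1 hz with rfl | hz
      · exact huw
      · exact hM z hz

theorem join_merge {G : SimpleGraph V} (M : Multiset (V × V)) : ∀ (A B : Multiset (List V)),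
    Sys G A → Sys G B → lts A = M.map (fun z => some z.1) → lts B = M.map (fun z => some z.2) →
    (∀ z ∈ M, G.Adj z.1 z.2) → ∃ C, Sys G C ∧ (∀ p ∈ C, 2 ≤ p.length) ∧ vs C = vs A + vs B ∧ hds C = hds A ∧ lts C = hds B := by
  induction M using Multiset.induction with
  | empty =>
    intro A B _ _ a b _
    simp only [lts, Multiset.map_zero, Multiset.map_eq_zero] at a b
    subst a; subst b
    exact ⟨0, by simp [Sys], by simp, by simp [vs], by simp [hds], by simp [hds, lts]⟩
  | cons z M ih =>
    intro A B sA sB a b hM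
    rw [Multiset.map_cons] at a b
    obtain ⟨p, A, rfl, a1, a2⟩ := lts_pick a
    obtain ⟨q, B, rfl, b1, b2⟩ := lts_pick b
    obtain ⟨C, c1, c2, c3, c4, c5⟩ := ih A B (fun p hp => sA p (by simp [hp])) (fun p hp => sB p (by simp [hp])) a2 b2
      (fun z hz => hM z (by simp [hz]))
    have hp := sA p (by simp)
    have hq := sB q (by simp)
    refine ⟨(p ++ q.reverse) ::ₘ C, ?_, ?_, ?_, ?_, ?_⟩
    · intro l hl
      rcases Multiset.mem_cons.1 hl with rfl | hl
      · refine ⟨by simp [hp.1], ?_⟩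
        rw [List.isChain_append]
        refine ⟨hp.2, isChain_symm_reverse hq.2, ?_⟩
        intro u hu w hw
        rw [a1] at hu
        rw [List.head?_reverse, b1] at hw
        cases hu; cases hw
        exact hM z (by simp)
      · exact c1 l hl
    · intro l hl
      rcases Multiset.mem_cons.1 hl with rfl | hl
      · have := List.length_pos_iff.2 hp.1
        have := List.length_pos_iff.2 hq.1
        simp; omega
      · exact c2 l hl
    · simp only [vs, Multiset.cons_bind] at c3 ⊢
      rw [c3, ← Multiset.coe_add, Multiset.coe_reverse]
      abel
    · simp only [hds, Multiset.map_cons] at c4 ⊢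
      rw [c4]
      congr 1
      rw [List.head?_append_of_ne_nil _ hp.1]
    · simp only [hds, lts, Multiset.map_cons] at c5 ⊢
      rw [c5]
      congr 1
      rw [List.getLast?_append_of_ne_nil _ (by simpa using hq.1), List.getLast?_reverse]

theorem join {G : SimpleGraph V} {m : ℕ} {RA RB : Finset V} {A B : Multiset (List V)}
    (hJ : Joined G m) (sA : Sys G A) (sB : Sys G B) (hn : (vs A + vs B).Nodup) (hc : A.card = B.card)
    (rA : ∀ z ∈ RA, z ∈ vs A ∧ some z ∉ hds A) (rB : ∀ z ∈ RB, z ∈ vs B ∧ some z ∉ hds B)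
    (xA : ∀ U : Finset V, U.card < m → 4 * U.card ≤ (nb G U RA).card)
    (xB : ∀ U : Finset V, U.card < m → 4 * U.card ≤ (nb G U RB).card) :
    ∃ C, Sys G C ∧ (∀ p ∈ C, 2 ≤ p.length) ∧ vs C = vs A + vs B ∧ hds C = hds A ∧ lts C = hds B := by
  rw [Multiset.nodup_add] at hn
  obtain ⟨A', B', M, h1, h2, h3, h4, h5, h6, h7, h8, h9⟩ := join_match hJ hn.1 hn.2.1 hn.2.2 rA rB xA xB A.card A B 0 (lts A) (lts B)
    sA sB rfl rfl rfl rfl (by simp) (by simp) (by simp [lts]) (by simp [lts, hc]) (by simp)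
  obtain ⟨C, c1, c2, c3, c4, c5⟩ := join_merge M A' B' h1 h2 h7 h8 h9
  exact ⟨C, c1, c2, by rw [c3, h3, h4], by rw [c4, h5], by rw [c5, h6]⟩

theorem cov_of {G : SimpleGraph V} (C : Multiset (List V)) (h1 : Sys G C) (h2 : ∀ p ∈ C, 2 ≤ p.length) :
    Cov G ((hds C).filterMap id + (lts C).filterMap id) (vs C) := by
  induction C using Multiset.induction with
  | empty => simp only [hds, lts, vs, Multiset.map_zero, Multiset.filterMap_zero, add_zero, Multiset.zero_bind]; exact Cov.nil
  | cons p C ih =>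
    have ih := ih (fun p hp => h1 p (by simp [hp])) (fun p hp => h2 p (by simp [hp]))
    have hl := h2 p (by simp)
    have hp := (h1 p (by simp)).2
    rcases p with _ | ⟨a, t⟩
    · simp at hl
    rcases List.eq_nil_or_concat t with rfl | ⟨mid, b, rfl⟩
    · simp at hl
    have := Cov.cons a b mid _ _ (by simpa using hp) ih
    convert this using 1
    · simp only [hds, lts, Multiset.map_cons]
      rw [Multiset.filterMap_cons_some id (a :: mid.concat b).head? _ (b := a) (by simp), Multiset.filterMap_cons_some id _ _ (b := b) (by simp [List.getLast?_cons])]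
      simp only [← Multiset.singleton_add]; abel
    · simp only [vs, Multiset.cons_bind]
      rw [add_comm]; simp

end
end HE

namespace HE
noncomputable section
open scoped Classical
open Finset

variable {V : Type*} [Fintype V]

theorem vs_add (A B : Multiset (List V)) : vs (A + B) = vs A + vs B := by simp [vs]
theorem hds_add (A B : Multiset (List V)) : hds (A + B) = hds A + hds B := by simp [hds]
theorem lts_add (A B : Multiset (List V)) : lts (A + B) = lts A + lts B := by simp [lts]

theorem sys_add {G : SimpleGraph V} {A B : Multiset (List V)} (h1 : Sys G A) (h2 : Sys G B) : Sys G (A + B) := by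
  intro p hp
  rcases Multiset.mem_add.1 hp with h | h
  · exact h1 p h
  · exact h2 p h

theorem map_split {α β : Type*} (f : α → β) (a b : Multiset β) : ∀ (C : Multiset α), C.map f = a + b →
    ∃ C1 C2, C = C1 + C2 ∧ C1.map f = a ∧ C2.map f = b := by
  induction a using Multiset.induction with
  | empty => intro C h; exact ⟨0, C, by simp, by simp, by simpa using h⟩
  | cons o a ih =>
    intro C h
    have : o ∈ C.map f := by rw [h]; simp
    obtain ⟨c, hc, rfl⟩ := Multiset.mem_map.1 this
    obtain ⟨C, rfl⟩ := Multiset.exists_cons_of_mem hc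
    rw [Multiset.map_cons, Multiset.cons_add, Multiset.cons_inj_right] at h
    obtain ⟨C1, C2, rfl, h2, h3⟩ := ih C h
    exact ⟨c ::ₘ C1, C2, by simp, by simp [h2], h3⟩

def rev (Q : Multiset (List V)) : Multiset (List V) := Q.map List.reverse

theorem vs_rev (Q : Multiset (List V)) : vs (rev Q) = vs Q := by
  simp [vs, rev, Multiset.bind_map]
theorem hds_rev (Q : Multiset (List V)) : hds (rev Q) = lts Q := by
  simp [hds, lts, rev]
theorem lts_rev (Q : Multiset (List V)) : lts (rev Q) = hds Q := by
  simp [hds, lts, rev]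
theorem sys_rev {G : SimpleGraph V} {Q : Multiset (List V)} (h : Sys G Q) : Sys G (rev Q) := by
  intro p hp
  obtain ⟨q, hq, rfl⟩ := Multiset.mem_map.1 hp
  exact ⟨by simpa using (h q hq).1, isChain_symm_reverse (h q hq).2⟩

theorem head_mem {A : Multiset (List V)} {z : V} (h : some z ∈ hds A) : z ∈ vs A := by
  obtain ⟨p, hp, hz⟩ := Multiset.mem_map.1 h
  exact Multiset.mem_bind.2 ⟨p, hp, List.mem_of_head? hz⟩

theorem nodup_disj {A B C D : Multiset V} (h : (A + B + (C + D)).Nodup) {z : V} (hz : z ∈ B) :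
    z ∉ A ∧ z ∉ C := by
  rw [Multiset.nodup_iff_count_le_one] at h
  have h1 := h z
  simp only [Multiset.count_add] at h1
  have h2 := Multiset.one_le_count_iff_mem.2 hz
  constructor
  · intro hh
    have := Multiset.one_le_count_iff_mem.2 hh
    omega
  · intro hh
    have := Multiset.one_le_count_iff_mem.2 hh
    omega

theorem assemble {G : SimpleGraph V} {m s : ℕ} {W1 W2 W3 W4 : Finset V} {H1 H2 H3 H4 L : Multiset V}
    {A1 A2 A3 A4 Q : Multiset (List V)} (hJ : Joined G m)
    (s1 : Sys G A1) (s2 : Sys G A2) (s3 : Sys G A3) (s4 : Sys G A4) (s0 : Sys G Q)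
    (v1 : vs A1 = H1 + W1.val) (v2 : vs A2 = H2 + W2.val) (v3 : vs A3 = H3 + W3.val) (v4 : vs A4 = H4 + W4.val)
    (v0 : vs Q = L)
    (h1 : hds A1 = H1.map some) (h2 : hds A2 = H2.map some) (h3 : hds A3 = H3.map some) (h4 : hds A4 = H4.map some)
    (c1 : A1.card = s) (c2 : A2.card = 2 * s) (c3 : A3.card = s) (c4 : A4.card = 2 * s) (c0 : Q.card = s)
    (hn : (H1 + H2 + H3 + H4 + W1.val + W2.val + W3.val + W4.val + L).Nodup)
    (x1 : ∀ U : Finset V, U.card < m → 4 * U.card ≤ (nb G U W1).card)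
    (x2 : ∀ U : Finset V, U.card < m → 4 * U.card ≤ (nb G U W2).card)
    (x3 : ∀ U : Finset V, U.card < m → 4 * U.card ≤ (nb G U W3).card)
    (x4 : ∀ U : Finset V, U.card < m → 4 * U.card ≤ (nb G U W4).card) :
    Cov G (H1 + H2 + H3 + H4) (H1 + H2 + H3 + H4 + W1.val + W2.val + W3.val + W4.val + L) := by
  have hsome : ∀ (H : Multiset V) (z : V), some z ∈ H.map some ↔ z ∈ H := by
    intro H z; simp
  have key : ∀ z, (H1 + H2 + H3 + H4 + W1.val + W2.val + W3.val + W4.val + L).count z ≤ 1 :=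
    Multiset.nodup_iff_count_le_one.1 hn
  simp only [Multiset.count_add] at key
  have pos : ∀ (M : Multiset V) (z : V), z ∈ M → 1 ≤ M.count z := fun M z hz => Multiset.one_le_count_iff_mem.2 hz
  -- first join
  obtain ⟨C, C1, C2, C3, C4, C5⟩ := join (A := A1 + Q) (B := A2) (RA := W1) (RB := W2) hJ (sys_add s1 s0) s2
    (by
      refine Multiset.nodup_of_le ?_ hn
      rw [vs_add, v1, v2, v0]
      rw [Multiset.le_iff_count]; intro z; simp only [Multiset.count_add]; omega)
    (by rw [Multiset.card_add, c1, c2, c0]; omega)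
    (by
      intro z hz
      have p1 := pos W1.val z hz
      have p2 := key z
      rw [vs_add, v1, v0, hds_add, h1]
      refine ⟨by simp [hz], ?_⟩
      rw [Multiset.mem_add, hsome]
      rintro (hh | hh)
      · have := pos _ _ hh; omega
      · have hh := head_mem hh
        rw [v0] at hh
        have := pos _ _ hh; omega)
    (by
      intro z hz
      have p1 := pos W2.val z hz
      have p2 := key z
      rw [v2, h2, hsome]
      refine ⟨by simp [hz], ?_⟩
      intro hh
      have := pos _ _ hh; omega) x1 x2
  rw [hds_add, h1] at C4
  obtain ⟨D1, D2, rfl, d1, d2⟩ := map_split List.head? _ _ C C4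
  have hcD2 : D2.card = s := by
    have := congrArg Multiset.card d2
    rw [Multiset.card_map, hds, Multiset.card_map, c0] at this
    exact this
  rw [vs_add, vs_add, v1, v2, v0] at C3
  rw [lts_add, h2] at C5
  have sD1 : Sys G D1 := fun p hp => C1 p (by simp [hp])
  have sD2 : Sys G D2 := fun p hp => C1 p (by simp [hp])
  have C3' : ∀ z, (vs D1).count z + (vs D2).count z = H1.count z + W1.val.count z + L.count z + (H2.count z + W2.val.count z) := by
    intro z
    have := congrArg (Multiset.count z) C3
    simpa only [Multiset.count_add] using this
  have hl2 : ∀ z, some z ∈ lts D2 → z ∈ H2 := by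
    intro z hz
    rw [← hsome, ← C5]; simp [hz]
  obtain ⟨J, J1, J2, J3, J4, J5⟩ := join (A := A3 + rev D2) (B := A4) (RA := W3) (RB := W4) hJ (sys_add s3 (sys_rev sD2)) s4
    (by
      refine Multiset.nodup_of_le ?_ hn
      rw [vs_add, vs_rev, v3, v4]
      rw [Multiset.le_iff_count]; intro z; simp only [Multiset.count_add]
      have := C3' z
      omega)
    (by rw [Multiset.card_add, c3, c4, rev, Multiset.card_map, hcD2]; omega)
    (by
      intro z hz
      have p1 := pos W3.val z hz
      have p2 := key z
      rw [vs_add, v3, hds_add, h3, hds_rev]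
      refine ⟨by simp [hz], ?_⟩
      rw [Multiset.mem_add, hsome]
      rintro (hh | hh)
      · have := pos _ _ hh; omega
      · have := pos _ _ (hl2 z hh); omega)
    (by
      intro z hz
      have p1 := pos W4.val z hz
      have p2 := key z
      rw [v4, h4, hsome]
      refine ⟨by simp [hz], ?_⟩
      intro hh
      have := pos _ _ hh; omega) x3 x4
  have fin := cov_of (D1 + J) (sys_add sD1 J1) (by
    intro p hp
    rcases Multiset.mem_add.1 hp with h | h
    · exact C2 p (by simp [h])
    · exact J2 p h)
  have e1 : vs (D1 + J) = H1 + H2 + H3 + H4 + W1.val + W2.val + W3.val + W4.val + L := by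
    ext z
    rw [vs_add, J3, vs_add, vs_rev, v3, v4]
    simp only [Multiset.count_add]
    have := C3' z
    omega
  have e2 : hds (D1 + J) + lts (D1 + J) = (H1 + H2 + H3 + H4).map some := by
    rw [hds_add, lts_add, J4, J5, hds_add, hds_rev, h3, h4]
    have : hds D1 = H1.map some := d1
    rw [this]
    simp only [Multiset.map_add]
    rw [← C5]; abel
  rw [e1, ← Multiset.filterMap_add, e2] at fin
  have e3 : Multiset.filterMap id ((H1 + H2 + H3 + H4).map some) = H1 + H2 + H3 + H4 := by
    rw [Multiset.filterMap_map]; simp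
  rw [e3] at fin
  exact fin

end
end HE

namespace HE
noncomputable section
open scoped Classical
open Finset

variable {V : Type*} [Fintype V]

def hv (Q : Multiset (List V)) : Multiset V := (hds Q).filterMap id
def pre (h : V → V) (Q : Multiset (List V)) : Multiset (List V) := Q.map (fun p => (p.head?.map h).toList ++ p)

theorem hv_cons (a : V) (p : List V) (Q : Multiset (List V)) : hv ((a :: p) ::ₘ Q) = a ::ₘ hv Q := by
  simp only [hv, hds, Multiset.map_cons, List.head?_cons]
  rw [Multiset.filterMap_cons_some id (some a) _ (b := a) rfl]

theorem sys_cons {G : SimpleGraph V} {p : List V} {Q : Multiset (List V)} (h : Sys G (p ::ₘ Q)) :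
    (∃ a t, p = a :: t) ∧ Sys G Q := by
  refine ⟨?_, fun q hq => h q (by simp [hq])⟩
  rcases p with _ | ⟨a, t⟩
  · exact absurd rfl (h [] (by simp)).1
  · exact ⟨a, t, rfl⟩

theorem pre_all {G : SimpleGraph V} (h : V → V) (Q : Multiset (List V)) : Sys G Q →
    (∀ a ∈ hv Q, G.Adj a (h a)) →
    Sys G (pre h Q) ∧ vs (pre h Q) = (hv Q).map h + vs Q ∧ hds (pre h Q) = ((hv Q).map h).map some ∧
      (hv Q).card = Q.card ∧ hv Q ≤ vs Q ∧ (pre h Q).card = Q.card := by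
  induction Q using Multiset.induction with
  | empty => intro _ _; simp [Sys, pre, vs, hv, hds]
  | cons p Q ih =>
    intro hS hA
    obtain ⟨⟨a, t, rfl⟩, hS'⟩ := sys_cons hS
    rw [hv_cons] at hA ⊢
    obtain ⟨i1, i2, i3, i4, i5, i6⟩ := ih hS' (fun b hb => hA b (by simp [hb]))
    have hpre : pre h ((a :: t) ::ₘ Q) = (h a :: a :: t) ::ₘ pre h Q := by simp [pre]
    rw [hpre]
    have hvs : vs ((h a :: a :: t) ::ₘ pre h Q) = h a ::ₘ a ::ₘ ((t : Multiset V) + vs (pre h Q)) := by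
      simp [vs, ← Multiset.cons_coe]
    have hvs' : vs ((a :: t) ::ₘ Q) = a ::ₘ ((t : Multiset V) + vs Q) := by
      simp [vs, ← Multiset.cons_coe]
    refine ⟨?_, ?_, ?_, ?_, ?_, ?_⟩
    · intro q hq
      rcases Multiset.mem_cons.1 hq with rfl | hq
      · refine ⟨by simp, ?_⟩
        rw [List.isChain_cons_cons]
        exact ⟨(hA a (by simp)).symm, (hS (a :: t) (by simp)).2⟩
      · exact i1 q hq
    · rw [hvs, hvs', i2, Multiset.map_cons]
      simp only [← Multiset.singleton_add]; abel
    · rw [hds, Multiset.map_cons] at *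
      rw [i3]; simp
    · simp [i4]
    · rw [hvs']
      refine Multiset.cons_le_cons _ (i5.trans (Multiset.le_add_left _ _))
    · simp [i6]

theorem cover_sys {G : SimpleGraph V} {m T : ℕ} (W : Finset V)
    (hX : ∀ U : Finset V, U.card < m → 8 * U.card ≤ (nb G U W).card)
    (hJ : Joined G m) (hT : 2 ≤ T) (hn : W.card ≤ T ^ 12) (k : ℕ) (hk : 15 * T ^ 10 ≤ k) (hkW : k ≤ W.card) :
    ∃ Q, Sys G Q ∧ vs Q = W.val ∧ Q.card = k := by
  obtain ⟨L, h1, h2, h3, h4⟩ := cover_set W (fun U _ => hX U) hJ hT hn k hk hkW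
  refine ⟨(L : Multiset (List V)), fun p hp => h1 p (by simpa using hp), ?_, by simpa using h4⟩
  have : vs (L : Multiset (List V)) = (L.flatten : Multiset V) := by
    clear h1 h2 h3 h4
    induction L with
    | nil => simp [vs]
    | cons p L ih =>
      rw [← Multiset.cons_coe, vs, Multiset.cons_bind, List.flatten_cons, ← Multiset.coe_add]
      congr 1
  rw [this, Multiset.Nodup.ext (Multiset.coe_nodup.2 h2) W.nodup]
  intro a
  rw [Multiset.mem_coe, h3]; rfl

theorem rts_exists (k : ℕ) : ∀ M : Multiset V, M.card = 2 * k → ∃ ab : List (V × V), rts ab = M ∧ ab.length = k := by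
  induction k with
  | zero =>
    intro M hM
    refine ⟨[], ?_, rfl⟩
    rw [Multiset.card_eq_zero.1 (by omega : M.card = 0)]; rfl
  | succ k ih =>
    intro M hM
    obtain ⟨a, ha⟩ := Multiset.card_pos_iff_exists_mem.1 (by omega : 0 < M.card)
    obtain ⟨M, rfl⟩ := Multiset.exists_cons_of_mem ha
    rw [Multiset.card_cons] at hM
    obtain ⟨b, hb⟩ := Multiset.card_pos_iff_exists_mem.1 (by omega : 0 < M.card)
    obtain ⟨M, rfl⟩ := Multiset.exists_cons_of_mem hb
    rw [Multiset.card_cons] at hM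
    obtain ⟨ab, h1, h2⟩ := ih M (by omega)
    exact ⟨(a, b) :: ab, by simp [rts, h1], by simp [h2]⟩

/-- Attach a private neighbour in `W` to every vertex of `D`. -/
theorem attach_heads {G : SimpleGraph V} {W : Finset V} {K m Tm : ℕ} (hm : 1 ≤ m)
    (hs : ∀ U : Finset V, m < U.card → U.card ≤ 2 * m → K * U.card + Tm < (nb G U W).card)
    (hs0 : ∀ U : Finset V, U.card ≤ 2 * m → K * U.card ≤ (nb G U W).card) (hK : 1 ≤ K)
    (D : Finset V) (hD : D.card ≤ Tm) (hDW : ∀ z ∈ D, z ∉ W) :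
    ∃ (T : Finset V) (h : V → V), T ⊆ W ∧ T.val = D.val.map h ∧ (∀ u ∈ D, G.Adj u (h u)) ∧ T.card = D.card ∧
      ∃ par, Ext G W K (2 * m) T par ∧ Inv W T par ∧ ∀ v, v ∉ D → ch T par v = ∅ := by
  have e0 : Ext G W K (2 * m) ∅ id := by
    refine ⟨?_, by simp, by simp⟩
    intro U hU
    have := hs0 U hU
    rw [sdiff_empty]; omega
  obtain ⟨T, par, -, -, h3, h4, h5, h6⟩ := fill hm hs 1 D e0 (by intro u hu; simp [ch]; omega) (by simp; omega)
  have hne : ∀ u ∈ D, ∃ y, ch T par u = {y} := by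
    intro u hu
    rw [← card_eq_one, h5 u hu]; simp [ch]
  choose! h hh using hne
  have hmem : ∀ u ∈ D, h u ∈ T ∧ par (h u) = u := by
    intro u hu
    have : h u ∈ ch T par u := by rw [hh u hu]; simp
    simpa [ch] using this
  have hparD : ∀ y ∈ T, par y ∈ D := fun y hy => h4 y (by simp [hy])
  have hinj : ∀ u ∈ D, ∀ v ∈ D, h u = h v → u = v := by
    intro u hu v hv huv
    rw [← (hmem u hu).2, ← (hmem v hv).2, huv]
  have hT : T = D.image h := by
    ext y
    rw [mem_image]
    constructor
    · intro hy
      refine ⟨par y, hparD y hy, ?_⟩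
      have : y ∈ ch T par (par y) := by simp [ch, hy]
      rw [hh _ (hparD y hy)] at this
      exact (mem_singleton.1 this).symm
    · rintro ⟨u, hu, rfl⟩
      exact (hmem u hu).1
  refine ⟨T, h, h3.2.1, ?_, ?_, by simpa using h6, par, h3, ?_, ?_⟩
  · rw [hT, image_val_of_injOn (fun u hu v hv => hinj u hu v hv)]
  · intro u hu
    have := h3.2.2 (h u) (hmem u hu).1
    rwa [(hmem u hu).2] at this
  · intro y hy hy'
    exact absurd hy' (hDW _ (hparD y hy))
  · intro v hv
    rw [Finset.eq_empty_iff_forall_notMem]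
    intro y hy
    simp only [ch, mem_filter] at hy
    exact hv (hy.2 ▸ hparD y hy.1)

end
end HE

namespace HE
noncomputable section
open scoped Classical
open Finset

variable {V : Type*} [Fintype V]

theorem hv_facts {G : SimpleGraph V} (Q : Multiset (List V)) : Sys G Q → (hv Q).card = Q.card ∧ hv Q ≤ vs Q := by
  induction Q using Multiset.induction with
  | empty => intro _; simp [hv, hds]
  | cons p Q ih =>
    intro hS
    obtain ⟨⟨a, t, rfl⟩, hS'⟩ := sys_cons hS
    rw [hv_cons]
    obtain ⟨i4, i5⟩ := ih hS'
    have hvs' : vs ((a :: t) ::ₘ Q) = a ::ₘ ((t : Multiset V) + vs Q) := by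
      simp [vs, ← Multiset.cons_coe]
    refine ⟨by simp [i4], ?_⟩
    rw [hvs']
    exact Multiset.cons_le_cons _ (i5.trans (Multiset.le_add_left _ _))

set_option maxHeartbeats 2000000 in
theorem main_big {G : SimpleGraph V} {m T d : ℕ} {x y : V} (hxy : x ≠ y) (hm : 1 ≤ m) (hJ : Joined G m)
    (hn : 100000 * m ≤ Fintype.card V)
    (hX : ∀ U : Finset V, U.card < m → 360 * U.card ≤ (nb G U univ).card)
    (hT : 2 ≤ T) (hTn : Fintype.card V ≤ T ^ 12) (hd : m ≤ 2 ^ d) (hd2 : 2 ^ d ≤ 2 * m) (hd1 : 1 ≤ d)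
    (hbig : 100 * (6 * (15 * T ^ 10) + (3 * (15 * T ^ 10) + 1) * (8 * (d * d)) + 8 * m) ≤ Fintype.card V) :
    ∃ P : List V, (x :: P ++ [y]).IsChain G.Adj ∧ ∀ z, (x :: P ++ [y]).count z = 1 := by
  obtain ⟨p, hp⟩ := partition hm hJ hn hX
  set n := Fintype.card V with hnd
  set s := 15 * T ^ 10 with hsd
  set W : Fin 6 → Finset V := fun i => (univ.filter fun z => p z = i) \ {x, y} with hW
  have hWm : ∀ i z, z ∈ W i ↔ p z = i ∧ z ≠ x ∧ z ≠ y := by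
    intro i z
    simp [hW]
  have hWc : ∀ i, n ≤ 7 * ((W i).card + 2) := by
    intro i
    have h1 := (hp i).1
    have h2 := card_le_sdiff (univ.filter fun z => p z = i) ({x, y} : Finset V)
    have h3 : ({x, y} : Finset V).card ≤ 2 := card_le_two
    have h4 : (W i).card = ((univ.filter fun z => p z = i) \ {x, y}).card := rfl
    omega
  have hWn : ∀ A : Finset V, A.card ≤ T ^ 12 := fun A => (card_le_univ A).trans hTn
  have hWx : ∀ i (U : Finset V), U.card < m → 28 * U.card ≤ (nb G U (W i)).card := by
    intro i U hU
    rcases Nat.eq_zero_or_pos U.card with h0 | h0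
    · omega
    have h1 := (hp i).2 U hU
    have h2 := card_le_sdiff (nb G U (univ.filter fun z => p z = i)) ({x, y} : Finset V)
    have h3 : ({x, y} : Finset V).card ≤ 2 := card_le_two
    have h4 : nb G U (univ.filter fun z => p z = i) \ {x, y} ⊆ nb G U (W i) := by
      intro z hz
      rw [mem_sdiff, mem_nb] at hz
      rw [mem_nb, hWm]
      simp at hz
      exact ⟨⟨hz.1.1, hz.2⟩, hz.1.2⟩
    have h5 := card_le_card h4
    omega
  have hcW : ∀ i z, (W i).val.count z = if p z = i ∧ z ≠ x ∧ z ≠ y then 1 else 0 := by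
    intro i z
    rw [Multiset.count_eq_of_nodup (W i).nodup]
    simp only [mem_val, hWm]
  have hX8 : ∀ i (U : Finset V), U.card < m → 8 * U.card ≤ (nb G U (W i)).card := by
    intro i U hU
    have := hWx i U hU; omega
  have hX4 : ∀ i (U : Finset V), U.card < m → 4 * U.card ≤ (nb G U (W i)).card := by
    intro i U hU
    have := hWx i U hU; omega
  -- the four covers
  obtain ⟨Q1, q11, q12, q13⟩ := cover_sys (W 1) (hX8 1) hJ hT (hWn _) s le_rfl (by have := hWc 1; omega)
  obtain ⟨Q2, q21, q22, q23⟩ := cover_sys (W 2) (hX8 2) hJ hT (hWn _) (2 * s) (by omega) (by have := hWc 2; omega)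
  obtain ⟨Q3, q31, q32, q33⟩ := cover_sys (W 3) (hX8 3) hJ hT (hWn _) s le_rfl (by have := hWc 3; omega)
  obtain ⟨Q4, q41, q42, q43⟩ := cover_sys (W 4) (hX8 4) hJ hT (hWn _) (2 * s) (by omega) (by have := hWc 4; omega)
  obtain ⟨g1, g1'⟩ := hv_facts Q1 q11
  obtain ⟨g2, g2'⟩ := hv_facts Q2 q21
  obtain ⟨g3, g3'⟩ := hv_facts Q3 q31
  obtain ⟨g4, g4'⟩ := hv_facts Q4 q41
  rw [q12] at g1'
  rw [q22] at g2'
  rw [q32] at g3'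
  rw [q42] at g4'
  have hZn : (hv Q1 + hv Q2 + hv Q3 + hv Q4).Nodup := by
    rw [Multiset.nodup_iff_count_le_one]
    intro z
    have c1 := Multiset.count_le_of_le z g1'
    have c2 := Multiset.count_le_of_le z g2'
    have c3 := Multiset.count_le_of_le z g3'
    have c4 := Multiset.count_le_of_le z g4'
    rw [hcW] at c1 c2 c3 c4
    simp only [Multiset.count_add]
    by_cases hz : z ≠ x ∧ z ≠ y
    · generalize p z = j at c1 c2 c3 c4
      generalize Multiset.count z (hv Q1) = n1 at *
      generalize Multiset.count z (hv Q2) = n2 at *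
      generalize Multiset.count z (hv Q3) = n3 at *
      generalize Multiset.count z (hv Q4) = n4 at *
      fin_cases j <;> simp [hz] at c1 c2 c3 c4 <;> omega
    · simp only [hz, and_false, if_false] at c1 c2 c3 c4; omega
  obtain ⟨D, hDv⟩ : ∃ D : Finset V, D.val = hv Q1 + hv Q2 + hv Q3 + hv Q4 := ⟨⟨_, hZn⟩, rfl⟩
  have hDm : ∀ z ∈ D, z ≠ x ∧ z ≠ y ∧ z ∉ W 0 := by
    intro z hz
    rw [← mem_val, hDv] at hz
    have : z ∈ W 1 ∨ z ∈ W 2 ∨ z ∈ W 3 ∨ z ∈ W 4 := by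
      simp only [Multiset.mem_add] at hz
      rcases hz with ((hz | hz) | hz) | hz
      · exact Or.inl (Multiset.mem_of_le g1' hz)
      · exact Or.inr (Or.inl (Multiset.mem_of_le g2' hz))
      · exact Or.inr (Or.inr (Or.inl (Multiset.mem_of_le g3' hz)))
      · exact Or.inr (Or.inr (Or.inr (Multiset.mem_of_le g4' hz)))
    simp only [hWm] at this ⊢
    rcases this with h | h | h | h <;> refine ⟨h.2.1, h.2.2, ?_⟩ <;> rw [h.1] <;> simp
  have hDc : D.card = 6 * s := by
    have : D.card = D.val.card := rfl
    rw [this, hDv]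
    simp only [Multiset.card_add]; omega
  set B := 6 * s + (3 * s + 1) * (8 * (d * d)) with hB
  have hpow : 2 ^ (d + 2) = 4 * 2 ^ d := by rw [pow_add]; ring
  have hTm : 100 * (B + 2 ^ (d + 2)) ≤ n := by omega
  have hs : ∀ U : Finset V, m < U.card → U.card ≤ 2 * m → 12 * U.card + (B + 2 ^ (d + 2)) < (nb G U (W 0)).card := by
    intro U h1 h2
    have h3 := joined_nb hJ U (W 0) h1.le
    have h4 := hWc 0
    omega
  have hs0 : ∀ U : Finset V, U.card ≤ 2 * m → 12 * U.card ≤ (nb G U (W 0)).card := by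
    intro U h2
    rcases lt_or_ge U.card m with h1 | h1
    · have := hWx 0 U h1; omega
    · have h3 := joined_nb hJ U (W 0) h1
      have h4 := hWc 0
      omega
  have env : Env G (W 0) 12 m (B + 2 ^ (d + 2)) d B := ⟨hm, hs, hJ, hd, hd1, le_rfl, le_rfl⟩
  obtain ⟨T', h, t1, t2, t3, t4, par, t5, t6, t7⟩ := attach_heads hm hs hs0 (by norm_num) D (by omega) (fun z hz => (hDm z hz).2.2)
  obtain ⟨ab, r1, r2⟩ := rts_exists (3 * s) T'.val (by
    have : T'.val.card = T'.card := rfl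
    rw [this]; omega)
  obtain ⟨E, e1, e2, e3, e4⟩ := ladder env y ab T' x hxy (by
      refine ⟨par, t5, t6, ?_⟩
      intro v hv
      rw [r1] at hv ⊢
      have hv' : v = x ∨ v = y ∨ v ∈ T' := by simpa using hv
      have hcount : (x ::ₘ y ::ₘ T'.val).count v ≤ 10 := by
        have c1 := Multiset.nodup_iff_count_le_one.1 T'.nodup v
        simp only [Multiset.count_cons]
        split_ifs <;> omega
      have hvD : v ∉ D := by
        intro hvD
        obtain ⟨d1, d2, d3⟩ := hDm v hvD
        rcases hv' with h | h | h
        · exact d1 h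
        · exact d2 h
        · exact d3 (t1 h)
      rw [t7 v hvD, card_empty, zero_add]
      refine ⟨?_, hcount⟩
      intro hv0
      rw [hWm] at hv0
      rcases hv' with h | h | h
      · exact absurd h hv0.2.1
      · exact absurd h hv0.2.2
      · exact h) (by rw [r2]; omega)
  rw [r1] at e4
  -- the leftover
  set Lf : Finset V := (W 0 \ T') \ E.toFinset ∪ W 5 with hLf
  obtain ⟨Q0, q01, q02, q03⟩ := cover_sys Lf (by
      intro U hU
      refine (hX8 5 U hU).trans (card_le_card ?_)
      intro z hz
      rw [mem_nb] at hz ⊢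
      exact ⟨by rw [hLf]; exact mem_union_right _ hz.1, hz.2⟩) hJ hT (hWn _) s le_rfl (by
      have h1 := hWc 5
      have h2 : (W 5).card ≤ Lf.card := card_le_card (by rw [hLf]; exact subset_union_right)
      omega)
  have hadj : ∀ {Q}, hv Q ≤ D.val → ∀ a ∈ hv Q, G.Adj a (h a) := by
    intro Q hQ a ha
    exact t3 a (Multiset.mem_of_le hQ ha)
  obtain ⟨a11, a12, a13, -, -, a14⟩ := pre_all h Q1 q11 (hadj (by
    rw [hDv, Multiset.le_iff_count]; intro z; simp only [Multiset.count_add]; omega))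
  obtain ⟨a21, a22, a23, -, -, a24⟩ := pre_all h Q2 q21 (hadj (by
    rw [hDv, Multiset.le_iff_count]; intro z; simp only [Multiset.count_add]; omega))
  obtain ⟨a31, a32, a33, -, -, a34⟩ := pre_all h Q3 q31 (hadj (by
    rw [hDv, Multiset.le_iff_count]; intro z; simp only [Multiset.count_add]; omega))
  obtain ⟨a41, a42, a43, -, -, a44⟩ := pre_all h Q4 q41 (hadj (by
    rw [hDv, Multiset.le_iff_count]; intro z; simp only [Multiset.count_add]; omega))
  rw [q12] at a12
  rw [q22] at a22
  rw [q32] at a32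
  rw [q42] at a42
  have hTv : (hv Q1).map h + (hv Q2).map h + (hv Q3).map h + (hv Q4).map h = T'.val := by
    rw [t2, hDv]; simp only [Multiset.map_add]
  have hcnt0 : ∀ z, T'.val.count z + E.count z + Lf.val.count z = (W 0).val.count z + (W 5).val.count z := by
    intro z
    rw [e1.count, Multiset.count_eq_of_nodup T'.nodup, Multiset.count_eq_of_nodup Lf.nodup,
      Multiset.count_eq_of_nodup (W 0).nodup, Multiset.count_eq_of_nodup (W 5).nodup]
    simp only [mem_val, hLf, mem_union, mem_sdiff, List.mem_toFinset]
    have h05 : z ∈ W 0 → z ∉ W 5 := by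
      intro h1 h2
      rw [hWm] at h1 h2
      have := h1.1.symm.trans h2.1
      simp at this
    have hT0 : z ∈ T' → z ∈ W 0 := fun h => t1 h
    have hE0 := e2 z
    by_cases w0 : z ∈ W 0
    · have w5 := h05 w0
      by_cases wT : z ∈ T'
      · have wE : z ∉ E := fun h => (hE0 h).2 wT
        simp [w0, w5, wT, wE]
      · by_cases wE : z ∈ E
        · simp [w0, w5, wT, wE]
        · simp [w0, w5, wT, wE]
    · have wT : z ∉ T' := fun h => w0 (hT0 h)
      have wE : z ∉ E := fun h => w0 (hE0 h).1
      simp [w0, wT, wE]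
  have hcnt : ∀ z, T'.val.count z + E.count z + Lf.val.count z + (W 1).val.count z + (W 2).val.count z +
      (W 3).val.count z + (W 4).val.count z = if z ≠ x ∧ z ≠ y then 1 else 0 := by
    intro z
    rw [hcnt0]
    simp only [hcW]
    by_cases hz : z ≠ x ∧ z ≠ y
    · generalize p z = j
      fin_cases j <;> simp [hz]
    · simp only [hz, and_false, if_false]
  have cov := assemble (W1 := W 1) (W2 := W 2) (W3 := W 3) (W4 := W 4) hJ a11 a21 a31 a41 q01 a12 a22 a32 a42 q02 a13 a23 a33 a43
    (a14.trans q13) (a24.trans q23) (a34.trans q33) (a44.trans q43) q03 (by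
      rw [hTv, Multiset.nodup_iff_count_le_one]
      intro z
      have := hcnt z
      simp only [Multiset.count_add]
      split_ifs at this <;> omega) (hX4 1) (hX4 2) (hX4 3) (hX4 4)
  rw [hTv] at cov
  obtain ⟨P, p1, p2⟩ := e4 _ cov
  refine ⟨P, p1, ?_⟩
  intro z
  have h1 : P.count z = (P : Multiset V).count z := (Multiset.coe_count z P).symm
  have h2 := hcnt z
  rw [p2] at h1
  simp only [Multiset.count_add, Multiset.coe_count] at h1
  simp only [List.cons_append, List.count_cons, List.count_append, List.count_nil, beq_iff_eq]
  by_cases hzx : z = x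
  · subst hzx
    rw [if_pos rfl, if_neg (Ne.symm hxy)]
    rw [if_neg (by simp)] at h2
    omega
  · by_cases hzy : z = y
    · subst hzy
      rw [if_pos rfl, if_neg hxy]
      rw [if_neg (by simp)] at h2
      omega
    · simp [hzx, hzy] at h2
      rw [if_neg (Ne.symm hzx), if_neg (Ne.symm hzy)]
      omega

end
end HE

namespace HE
noncomputable section
open scoped Classical
open Finset

variable {V : Type*} [Fintype V]

theorem pow_big (u : ℕ) (hu : 23 ≤ u) : 2 ^ 18 * u ≤ 2 ^ u := by
  induction u, hu using Nat.le_induction with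
  | base => norm_num
  | succ k hk ih => rw [pow_succ]; omega

theorem numeric {u T d n m : ℕ} (hu : 23 ≤ u) (hT : T = 2 ^ u) (hn : T ^ 12 ≤ 4096 * n) (hd : d ≤ 12 * u)
    (hm : 100000 * m ≤ n) :
    100 * (6 * (15 * T ^ 10) + (3 * (15 * T ^ 10) + 1) * (8 * (d * d)) + 8 * m) ≤ n := by
  have h1 : 2 ^ 18 * u ≤ T := hT ▸ pow_big u hu
  have h2 : T ^ 12 = T ^ 10 * (T * T) := by ring
  have hT1 : 1 ≤ T ^ 10 := Nat.one_le_pow _ _ (by omega)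
  have h3 : T ^ 10 * ((2 ^ 18 * u) * (2 ^ 18 * u)) ≤ T ^ 12 := by
    rw [h2]
    exact Nat.mul_le_mul_left _ (Nat.mul_le_mul h1 h1)
  have h4 : T ^ 10 * ((2 ^ 18 * u) * (2 ^ 18 * u)) = 68719476736 * (T ^ 10 * (u * u)) := by ring
  have h5 : d * d ≤ 144 * (u * u) := by
    calc d * d ≤ (12 * u) * (12 * u) := Nat.mul_le_mul hd hd
      _ = 144 * (u * u) := by ring
  have h6 : (3 * (15 * T ^ 10) + 1) * (8 * (d * d)) ≤ (46 * T ^ 10) * (8 * (144 * (u * u))) :=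
    Nat.mul_le_mul (by omega) (by omega)
  have h7 : (46 * T ^ 10) * (8 * (144 * (u * u))) = 52992 * (T ^ 10 * (u * u)) := by ring
  have h8 : T ^ 10 ≤ T ^ 10 * (u * u) := Nat.le_mul_of_pos_right _ (by positivity)
  omega

theorem ham_list {G : SimpleGraph V} {m : ℕ} {x y : V} (hxy : x ≠ y) (hm : 2 ≤ m) (hJ : Joined G m)
    (hn : 100000 * m ≤ Fintype.card V)
    (hX : ∀ U : Finset V, U.card < m → 360 * U.card ≤ (nb G U univ).card)
    (hbig : 2 ^ 264 < Fintype.card V) :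
    ∃ P : List V, (x :: P ++ [y]).IsChain G.Adj ∧ (x :: P ++ [y]).Nodup ∧ ∀ z, z ∈ x :: P ++ [y] := by
  set n := Fintype.card V with hnd
  have ex1 : ∃ u, n ≤ 2 ^ (12 * u) := ⟨n, (Nat.lt_two_pow_self).le.trans (Nat.pow_le_pow_right (by norm_num) (by omega))⟩
  have ex2 : ∃ d, m ≤ 2 ^ d := ⟨m, (Nat.lt_two_pow_self).le⟩
  obtain ⟨u, hu1, hu2⟩ : ∃ u, n ≤ 2 ^ (12 * u) ∧ ∀ v < u, ¬ n ≤ 2 ^ (12 * v) :=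
    ⟨Nat.find ex1, Nat.find_spec ex1, fun v hv => Nat.find_min ex1 hv⟩
  obtain ⟨d, hd1, hd2⟩ : ∃ d, m ≤ 2 ^ d ∧ ∀ v < d, ¬ m ≤ 2 ^ v :=
    ⟨Nat.find ex2, Nat.find_spec ex2, fun v hv => Nat.find_min ex2 hv⟩
  have hu : 23 ≤ u := by
    by_contra hlt
    have : 2 ^ (12 * u) ≤ 2 ^ 264 := Nat.pow_le_pow_right (by norm_num) (by omega)
    exact absurd (le_trans hu1 this) (not_le.2 hbig)
  have hd0 : 1 ≤ d := by
    rcases Nat.eq_zero_or_pos d with rfl | h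
    · simp at hd1; omega
    · exact h
  have hd3 : d ≤ 12 * u := by
    by_contra hlt
    exact hd2 (12 * u) (by omega) ((by omega : m ≤ n).trans hu1)
  have hdd : 2 ^ d ≤ 2 * m := by
    have h1 := hd2 (d - 1) (by omega)
    have h2 : 2 ^ d = 2 * 2 ^ (d - 1) := by rw [← pow_succ']; congr 1; omega
    omega
  have hT : (2 ^ u) ^ 12 ≤ 4096 * n := by
    have h1 := hu2 (u - 1) (by omega)
    have h2 : (2 ^ u) ^ 12 = 4096 * 2 ^ (12 * (u - 1)) := by
      rw [← pow_mul, show u * 12 = 12 + 12 * (u - 1) by omega, pow_add]; norm_num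
    omega
  have hT2 : 2 ≤ 2 ^ u := by
    calc 2 = 2 ^ 1 := by norm_num
      _ ≤ 2 ^ u := Nat.pow_le_pow_right (by norm_num) (by omega)
  obtain ⟨P, h1, h2⟩ := main_big hxy (by omega) hJ hn hX hT2 (by rw [← pow_mul, mul_comm]; exact hu1) hd1 hdd hd0
    (numeric hu rfl hT hd3 hn)
  refine ⟨P, h1, ?_, ?_⟩
  · rw [List.nodup_iff_count_le_one]
    intro z; rw [h2]
  · intro z
    rw [← List.one_le_count_iff, h2]

theorem ham_complete {G : SimpleGraph V} {x y : V} (hxy : x ≠ y) (hG : ∀ u v, u ≠ v → G.Adj u v) :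
    ∃ P : List V, (x :: P ++ [y]).IsChain G.Adj ∧ (x :: P ++ [y]).Nodup ∧ ∀ z, z ∈ x :: P ++ [y] := by
  have hnd : (x :: (univ \ {x, y} : Finset V).toList ++ [y]).Nodup := by
    rw [List.nodup_append']
    refine ⟨?_, by simp, ?_⟩
    · rw [List.nodup_cons]
      exact ⟨by simp, nodup_toList _⟩
    · rw [List.disjoint_singleton]
      simp [hxy.symm]
  refine ⟨(univ \ {x, y} : Finset V).toList, ?_, hnd, ?_⟩
  · exact (List.Pairwise.isChain hnd).imp (fun a b hab => hG a b hab)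
  · intro z; simp; tauto

theorem walk_of_list {G : SimpleGraph V} {x y : V} {P : List V} (h : (x :: P ++ [y]).IsChain G.Adj) :
    ∃ w : G.Walk x y, w.support = x :: P ++ [y] := by
  induction P generalizing x with
  | nil =>
    have h' : G.Adj x y := by simpa using h
    exact ⟨SimpleGraph.Walk.cons h' SimpleGraph.Walk.nil, by simp⟩
  | cons z P ih =>
    have h1 : G.Adj x z ∧ (z :: P ++ [y]).IsChain G.Adj := by
      simpa [List.isChain_cons_cons] using h
    obtain ⟨w, hw⟩ := ih h1.2
    exact ⟨SimpleGraph.Walk.cons h1.1 w, by simp [hw]⟩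

end

theorem ham_walk {n : ℕ} {G : SimpleGraph (Fin n)} {x y : Fin n}
    (h : ∃ P : List (Fin n), (x :: P ++ [y]).IsChain G.Adj ∧ (x :: P ++ [y]).Nodup ∧ ∀ z, z ∈ x :: P ++ [y]) :
    ∃ w : G.Walk x y, w.IsHamiltonian := by
  obtain ⟨P, h1, h2, h3⟩ := h
  obtain ⟨w, hw⟩ := walk_of_list h1
  refine ⟨w, fun z => ?_⟩
  rw [hw]
  exact List.count_eq_one_of_mem h2 (h3 z)

theorem nb_ncard {n : ℕ} (G : SimpleGraph (Fin n)) (U : Finset (Fin n)) :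
    (nbhdSet G U).ncard = (nb G U Finset.univ).card := by
  rw [← Set.ncard_coe_finset]
  congr 1
  ext z
  simp [nbhdSet, mem_nb]

end HE

theorem statement_4 :
    ∃ C : ℝ, 1 ≤ C ∧ ∀ (n : ℕ) (G : SimpleGraph (Fin n)),
      (∀ U : Finset (Fin n), (U.card : ℝ) < n / (2 * C) →
        C * U.card ≤ ((nbhdSet G U).ncard : ℝ)) →
      (∀ U W : Finset (Fin n), Disjoint U W → (n / (2 * C) : ℝ) ≤ U.card →
        (n / (2 * C) : ℝ) ≤ W.card → ∃ u ∈ U, ∃ w ∈ W, G.Adj u w) →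
      HamiltonConnected G := by
  obtain ⟨C, hC⟩ : ∃ C : ℝ, ∀ t : ℕ, t ≤ 300 → (2 : ℝ) ^ t ≤ C :=
    ⟨2 ^ 300, fun t ht => pow_le_pow_right₀ (by norm_num) ht⟩
  have hC1 : (1000000 : ℝ) ≤ C := le_trans (by norm_num) (hC 20 (by norm_num))
  have hC0 : 0 < 2 * C := by linarith
  refine ⟨C, by linarith, ?_⟩
  intro n G h1 h2 x y hxy
  apply HE.ham_walk
  rcases le_or_gt (n : ℝ) (2 * C) with hn | hn
  · apply HE.ham_complete hxy
    intro u v huv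
    have hle : (n / (2 * C) : ℝ) ≤ ((1 : ℕ) : ℝ) := by
      rw [div_le_iff₀ hC0]; simpa using hn
    obtain ⟨a, ha, b, hb, hab⟩ := h2 {u} {v} (by simpa using huv) (by simpa using hle) (by simpa using hle)
    rw [Finset.mem_singleton] at ha hb
    subst ha; subst hb
    exact hab
  · have hq : 1 < (n / (2 * C) : ℝ) := by rw [lt_div_iff₀ hC0]; linarith
    have hqC : (n / (2 * C) : ℝ) * (2 * C) = n := div_mul_cancel₀ _ hC0.ne'
    refine HE.ham_list (m := ⌈(n / (2 * C) : ℝ)⌉₊) hxy ?_ ?_ ?_ ?_ ?_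
    · have : 1 < ⌈(n / (2 * C) : ℝ)⌉₊ := by rw [Nat.lt_ceil]; simpa using hq
      exact this
    · intro U W hUW hU hW
      exact h2 U W hUW (Nat.ceil_le.1 hU) (Nat.ceil_le.1 hW)
    · have hlt := Nat.ceil_lt_add_one (by linarith : (0 : ℝ) ≤ n / (2 * C))
      rw [Fintype.card_fin]
      have : ((100000 * ⌈(n / (2 * C) : ℝ)⌉₊ : ℕ) : ℝ) ≤ n := by
        push_cast
        have h3 : (n / (2 * C) : ℝ) * 2000000 ≤ (n / (2 * C) : ℝ) * (2 * C) :=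
          mul_le_mul_of_nonneg_left (by linarith) (by linarith)
        linarith
      exact_mod_cast this
    · intro U hU
      rw [Nat.lt_ceil] at hU
      have h3 := h1 U hU
      rw [HE.nb_ncard] at h3
      have : ((360 * U.card : ℕ) : ℝ) ≤ ((HE.nb G U Finset.univ).card : ℝ) := by
        push_cast
        have : (0 : ℝ) ≤ U.card := Nat.cast_nonneg _
        nlinarith
      exact_mod_cast this
    · rw [Fintype.card_fin]
      have : ((2 ^ 264 : ℕ) : ℝ) < n := by
        rw [Nat.cast_pow, Nat.cast_ofNat]
        exact (hC 264 (by norm_num)).trans_lt (by linarith)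
      exact Nat.cast_lt.1 this
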